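/- Let k > 2 be a fixed real number, let C > 0 be a fixed constant, let q be a large integer such that every Dirichlet L-function modulo q satisfies the Riemann Hypothesis, let 2 ≤ y ≤ q, and set T = y/(log y)^C. Define f : ℝ_{>0} → ℝ by f(x) = 1 for 0 < x ≤ y − T, f(x) = 1 − (x − y + T)/T for y − T ≤ x ≤ y, and f(x) = 0 for x ≥ y. Then there is a constant C' depending only on k and C such that ∑_{χ ∈ X_q^*} |∑_{n ≤ y} (1 − f(n))χ(n)|^{2k} ≤ C' · φ(q) · y^k · (log y)^{2k² − C/2}. -/

import Mathlib

open Complex Real Finset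

def dirichletRH {q : ℕ} [NeZero q] (χ : DirichletCharacter ℂ q) : Prop :=
  ∀ s : ℂ, 0 < s.re → s.re < 1 → DirichletCharacter.LFunction χ s = 0 → s.re = 1 / 2


/-! ## Part A: orthogonality -/

lemma A1_inner {q : ℕ} [NeZero q] (a b : ZMod q) :
    ∑ χ : DirichletCharacter ℂ q, χ a * (starRingEnd ℂ) (χ b) =
      if IsUnit b ∧ a = b then (q.totient : ℂ) else 0 := by
  by_cases hb : IsUnit b
  · have h := DirichletCharacter.sum_char_inv_mul_char_eq ℂ hb a
    have : ∀ χ : DirichletCharacter ℂ q, χ a * (starRingEnd ℂ) (χ b) = χ b⁻¹ * χ a := by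
      intro χ
      have : (starRingEnd ℂ) (χ b) = χ b⁻¹ := by
        have h2 := MulChar.star_apply χ b
        rw [MulChar.star_eq_inv, MulChar.inv_apply] at h2
        obtain ⟨u, rfl⟩ := hb
        rw [Ring.inverse_unit, ← ZMod.inv_coe_unit] at h2
        exact h2.symm
      rw [this, mul_comm]
    simp only [this, h, hb, true_and]
    simp [eq_comm]
  · simp only [hb, false_and, if_false]
    apply Finset.sum_eq_zero
    intro χ _
    rw [MulChar.map_nonunit χ hb]; simp

lemma A1 {q : ℕ} [NeZero q] (X : Finset (DirichletCharacter ℂ q)) {ι : Type*} (I : Finset ι)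
    (ν : ι → ℕ) (c : ι → ℂ) (hν : ∀ i ∈ I, 1 ≤ ν i ∧ ν i ≤ q) (inj : Set.InjOn ν I) :
    ∑ χ ∈ X, ‖∑ i ∈ I, c i * χ (ν i)‖ ^ 2 ≤ (q.totient : ℝ) * ∑ i ∈ I, ‖c i‖ ^ 2 := by
  classical
  have inj' : ∀ i ∈ I, ∀ j ∈ I, ((ν i : ZMod q) = (ν j : ZMod q)) → i = j := by
    intro i hi j hj h
    apply inj hi hj
    rw [ZMod.natCast_eq_natCast_iff] at h
    obtain ⟨h1, h2⟩ := hν i hi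
    obtain ⟨h3, h4⟩ := hν j hj
    have hmod : (ν i - 1) ≡ (ν j - 1) [MOD q] := by
      apply Nat.ModEq.add_right_cancel' 1
      rwa [Nat.sub_add_cancel h1, Nat.sub_add_cancel h3]
    have := Nat.ModEq.eq_of_lt_of_lt hmod (by omega) (by omega)
    omega
  have key : ((∑ χ : DirichletCharacter ℂ q, ‖∑ i ∈ I, c i * χ (ν i)‖ ^ 2 : ℝ) : ℂ) =
      ∑ i ∈ I, if IsUnit (ν i : ZMod q) then (q.totient : ℂ) * (‖c i‖ ^ 2 : ℝ) else 0 := by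
    push_cast
    have e1 : ∀ χ : DirichletCharacter ℂ q, ((‖∑ i ∈ I, c i * χ (ν i)‖ : ℂ)) ^ 2 =
        ∑ i ∈ I, ∑ j ∈ I, (c i * (starRingEnd ℂ) (c j)) * (χ (ν i) * (starRingEnd ℂ) (χ (ν j))) := by
      intro χ
      rw [← Complex.mul_conj', map_sum, Finset.sum_mul_sum]
      refine Finset.sum_congr rfl fun i _ => Finset.sum_congr rfl fun j _ => ?_
      rw [map_mul]; ring
    simp only [e1]
    rw [Finset.sum_comm]
    refine Finset.sum_congr rfl fun i hi => ?_
    rw [Finset.sum_comm]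
    simp only [← Finset.mul_sum, A1_inner]
    rw [Finset.sum_eq_single i]
    · split_ifs with h1 h2 h2
      · rw [← Complex.mul_conj']; ring
      · exact absurd h1.1 h2
      · exact absurd ⟨h2, rfl⟩ h1
      · simp
    · intro j hj hji
      rw [if_neg, mul_zero]
      rintro ⟨_, h⟩
      exact hji (inj' i hi j hj h).symm
    · intro h; exact absurd hi h
  have key2 : (∑ χ : DirichletCharacter ℂ q, ‖∑ i ∈ I, c i * χ (ν i)‖ ^ 2 : ℝ) =
      ∑ i ∈ I, if IsUnit (ν i : ZMod q) then (q.totient : ℝ) * (‖c i‖ ^ 2) else 0 := by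
    apply Complex.ofReal_injective
    rw [key]
    push_cast
    refine Finset.sum_congr rfl fun i _ => ?_
    split_ifs <;> simp
  calc _ ≤ ∑ χ : DirichletCharacter ℂ q, ‖∑ i ∈ I, c i * χ (ν i)‖ ^ 2 :=
        Finset.sum_le_sum_of_subset_of_nonneg (Finset.subset_univ _) (fun _ _ _ => by positivity)
    _ = _ := key2
    _ ≤ _ := by
      rw [Finset.mul_sum]
      refine Finset.sum_le_sum fun i _ => ?_
      split_ifs
      · exact le_rfl
      · positivity

lemma A2_gen {q : ℕ} [NeZero q] (X : Finset (DirichletCharacter ℂ q)) (S : Finset ℕ)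
    (hS : ∀ p ∈ S, p.Prime) (e : ℕ) (he : 1 ≤ e) (b : ℕ → ℂ) (Z J : ℕ) (hZ1 : 1 ≤ Z)
    (hZ : ∀ p ∈ S, p ^ e ≤ Z) (hJ : Z ^ J ≤ q) (d : ℕ → ℂ) :
    ∑ χ ∈ X, ‖∑ j ∈ range (J + 1), d j * (∑ p ∈ S, b p * χ (p : ZMod q) ^ e) ^ j‖ ^ 2 ≤
      (q.totient : ℝ) * ∑ j ∈ range (J + 1),
        ‖d j‖ ^ 2 * (j.factorial * (∑ p ∈ S, ‖b p‖ ^ 2) ^ j) := by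
  classical
  set I : Finset (Σ _ : ℕ, ℕ → ℕ) := (range (J + 1)).sigma fun j => piAntidiag S j with hI
  set ν : (Σ _ : ℕ, ℕ → ℕ) → ℕ := fun x => ∏ p ∈ S, p ^ (e * x.2 p) with hνdef
  set c : (Σ _ : ℕ, ℕ → ℕ) → ℂ := fun x =>
    d x.1 * (Nat.multinomial S x.2 * ∏ p ∈ S, b p ^ x.2 p) with hc
  have e1 : ∀ χ : DirichletCharacter ℂ q,
      ∑ j ∈ range (J + 1), d j * (∑ p ∈ S, b p * χ (p : ZMod q) ^ e) ^ j =
        ∑ x ∈ I, c x * χ (ν x) := by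
    intro χ
    rw [hI, Finset.sum_sigma]
    refine Finset.sum_congr rfl fun j _ => ?_
    rw [Finset.sum_pow_eq_sum_piAntidiag, Finset.mul_sum]
    refine Finset.sum_congr rfl fun k _ => ?_
    simp only [hc, hνdef]
    rw [Nat.cast_prod, map_prod]
    simp only [Nat.cast_pow, map_pow, mul_pow, Finset.prod_mul_distrib, pow_mul]
    ring
  simp only [e1]
  have hb1 : ∀ x ∈ I, 1 ≤ ν x ∧ ν x ≤ q := by
    intro x hx
    rw [hI, Finset.mem_sigma, mem_piAntidiag] at hx
    obtain ⟨h1, h2, h3⟩ := hx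
    constructor
    · exact Nat.one_le_iff_ne_zero.2 (Finset.prod_ne_zero_iff.2 fun p hp =>
        pow_ne_zero _ (hS p hp).ne_zero)
    · refine le_trans ?_ hJ
      calc ν x = ∏ p ∈ S, (p ^ e) ^ (x.2 p) := by simp [hνdef, pow_mul]
        _ ≤ ∏ p ∈ S, Z ^ (x.2 p) := Finset.prod_le_prod' fun p hp =>
            Nat.pow_le_pow_left (hZ p hp) _
        _ = Z ^ x.1 := by rw [Finset.prod_pow_eq_pow_sum]; exact congrArg _ h2
        _ ≤ Z ^ J := Nat.pow_le_pow_right hZ1 (by simpa [Nat.lt_succ_iff] using h1)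
  have hfac : ∀ x ∈ I, ∀ p ∈ S, (ν x).factorization p = e * x.2 p := by
    intro x hx p hp
    simp only [hνdef]
    rw [Nat.factorization_prod_apply (fun p hp => pow_ne_zero _ (hS p hp).ne_zero)]
    rw [Finset.sum_eq_single p]
    · simp [(hS p hp).factorization_pow]
    · intro r hr hrp
      simp [(hS r hr).factorization_pow, hrp]
    · exact fun h => absurd hp h
  have hinj : Set.InjOn ν I := by
    intro x hx y hy hxy
    have hx' := hx; have hy' := hy
    simp only [Finset.mem_coe] at hx' hy'
    have h4 : x.2 = y.2 := by
      funext p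
      by_cases hp : p ∈ S
      · have h5 := hfac x hx' p hp
        rw [hxy, hfac y hy' p hp] at h5
        exact (Nat.eq_of_mul_eq_mul_left (by omega) h5).symm
      · rw [hI, Finset.mem_sigma, mem_piAntidiag] at hx' hy'
        have h6 : x.2 p = 0 := by by_contra h; exact hp (hx'.2.2 p h)
        have h7 : y.2 p = 0 := by by_contra h; exact hp (hy'.2.2 p h)
        rw [h6, h7]
    have h5 : x.1 = y.1 := by
      rw [hI, Finset.mem_sigma, mem_piAntidiag] at hx' hy'
      rw [← hx'.2.1, ← hy'.2.1, h4]
    obtain ⟨x1, x2⟩ := x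
    obtain ⟨y1, y2⟩ := y
    simp_all
  refine (A1 X I ν c hb1 hinj).trans ?_
  refine mul_le_mul_of_nonneg_left ?_ (Nat.cast_nonneg _)
  rw [hI, Finset.sum_sigma]
  refine Finset.sum_le_sum fun j hj => ?_
  rw [Finset.sum_pow_eq_sum_piAntidiag, Finset.mul_sum, Finset.mul_sum]
  refine Finset.sum_le_sum fun k hk => ?_
  simp only [hc, norm_mul, norm_prod, norm_pow, mul_pow, Complex.norm_natCast]
  have hm : (Nat.multinomial S k : ℝ) ≤ j.factorial := by
    rw [mem_piAntidiag] at hk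
    have := Nat.multinomial_spec S k
    rw [hk.1] at this
    rw [← this]
    exact_mod_cast Nat.le_mul_of_pos_left _ (Finset.prod_pos fun i _ => Nat.factorial_pos _)
  have h8 : (∏ x ∈ S, ‖b x‖ ^ k x) ^ 2 = ∏ i ∈ S, (‖b i‖ ^ 2) ^ k i := by
    rw [← Finset.prod_pow]
    exact Finset.prod_congr rfl fun i _ => by rw [← pow_mul, ← pow_mul, mul_comm]
  rw [h8]
  have h9 : (0 : ℝ) ≤ ∏ i ∈ S, (‖b i‖ ^ 2) ^ k i := Finset.prod_nonneg fun i _ => by positivity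
  refine mul_le_mul_of_nonneg_left ?_ (by positivity)
  rw [← mul_assoc]
  refine mul_le_mul_of_nonneg_right ?_ h9
  nlinarith [Nat.cast_nonneg (α := ℝ) (Nat.multinomial S k)]

lemma A2_mom {q : ℕ} [NeZero q] (X : Finset (DirichletCharacter ℂ q)) (S : Finset ℕ)
    (hS : ∀ p ∈ S, p.Prime) (e : ℕ) (he : 1 ≤ e) (b : ℕ → ℂ) (Z J : ℕ) (hZ1 : 1 ≤ Z)
    (hZ : ∀ p ∈ S, p ^ e ≤ Z) (hJ : Z ^ J ≤ q) :
    ∑ χ ∈ X, ‖∑ p ∈ S, b p * χ (p : ZMod q) ^ e‖ ^ (2 * J) ≤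
      (q.totient : ℝ) * (J.factorial * (∑ p ∈ S, ‖b p‖ ^ 2) ^ J) := by
  classical
  have h := A2_gen X S hS e he b Z J hZ1 hZ hJ (fun j => if j = J then 1 else 0)
  have h1 : ∀ g : ℕ → ℂ, ∑ j ∈ range (J + 1), (if j = J then (1 : ℂ) else 0) * g j = g J := by
    intro g
    simp
  have h2 : ∀ g : ℕ → ℝ, ∑ j ∈ range (J + 1), ‖(if j = J then (1 : ℂ) else 0)‖ ^ 2 * g j = g J := by
    intro g
    rw [Finset.sum_eq_single J] <;> simp +contextual
  simp only [h1, h2] at h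
  simpa only [norm_pow, ← pow_mul, mul_comm] using h

lemma A2_exp {q : ℕ} [NeZero q] (X : Finset (DirichletCharacter ℂ q)) (S : Finset ℕ)
    (hS : ∀ p ∈ S, p.Prime) (b : ℕ → ℂ) (Z J : ℕ) (hZ1 : 1 ≤ Z)
    (hZ : ∀ p ∈ S, p ≤ Z) (hJ : Z ^ J ≤ q) :
    ∑ χ ∈ X, ‖∑ j ∈ range (J + 1), (∑ p ∈ S, b p * χ (p : ZMod q)) ^ j / j.factorial‖ ^ 2 ≤
      (q.totient : ℝ) * Real.exp (∑ p ∈ S, ‖b p‖ ^ 2) := by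
  classical
  have h := A2_gen X S hS 1 le_rfl b Z J hZ1 (by simpa using hZ) hJ (fun j => 1 / (j.factorial : ℂ))
  simp only [pow_one, one_div, ← div_eq_inv_mul] at h
  refine h.trans (mul_le_mul_of_nonneg_left ?_ (Nat.cast_nonneg _))
  refine le_trans (le_of_eq ?_) (Real.sum_le_exp_of_nonneg (x := ∑ p ∈ S, ‖b p‖ ^ 2)
    (Finset.sum_nonneg fun i _ => by positivity) (J + 1))
  refine Finset.sum_congr rfl fun j _ => ?_
  have : (j.factorial : ℝ) ≠ 0 := by positivity
  simp only [norm_inv, Complex.norm_natCast]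
  field_simp


/-! ## Short sums: diagonal count -/

lemma dvd_prod_split {M : ℕ} : ∀ (m : Fin M → ℕ) (n : ℕ), n ∣ ∏ j, m j →
    ∃ a : Fin M → ℕ, (∀ j, a j ∣ m j) ∧ ∏ j, a j = n := by
  induction M with
  | zero =>
    intro m n h
    exact ⟨m, fun j => dvd_rfl, by simpa using (Nat.dvd_one.1 (by simpa using h)).symm⟩
  | succ M ih =>
    intro m n h
    rw [Fin.prod_univ_succ] at h
    obtain ⟨u, v, hu, hv, rfl⟩ := exists_dvd_and_dvd_of_dvd_mul h
    obtain ⟨a, ha, hav⟩ := ih _ _ hv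
    refine ⟨Fin.cons u a, ?_, ?_⟩
    · intro j
      refine Fin.cases ?_ (fun j => ?_) j
      · simpa using hu
      · simpa using ha j
    · rw [Fin.prod_univ_succ]; simp [hav]

lemma factor_matrix {M' : ℕ} : ∀ (M : ℕ) (n : Fin M → ℕ) (m : Fin M' → ℕ),
    (∀ i, n i ≠ 0) → ∏ i, n i = ∏ j, m j →
    ∃ a : Fin M → Fin M' → ℕ, (∀ i, ∏ j, a i j = n i) ∧ (∀ j, ∏ i, a i j = m j) := by
  intro M
  induction M with
  | zero =>
    intro n m _ h
    refine ⟨fun i => i.elim0, fun i => i.elim0, fun j => ?_⟩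
    simp at h
    have : m j ∣ 1 := by rw [h]; exact Finset.dvd_prod_of_mem m (Finset.mem_univ j)
    simpa using (Nat.dvd_one.1 this).symm
  | succ M ih =>
    intro n m hn h
    rw [Fin.prod_univ_succ] at h
    obtain ⟨a0, ha0, hp⟩ := dvd_prod_split m (n 0) ⟨_, h.symm⟩
    have h2 : ∏ i : Fin M, n i.succ = ∏ j, (m j / a0 j) := by
      have h3 : (∏ j, a0 j) * ∏ j, (m j / a0 j) = ∏ j, m j := by
        rw [← Finset.prod_mul_distrib]
        exact Finset.prod_congr rfl fun j _ => Nat.mul_div_cancel' (ha0 j)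
      rw [← h, hp] at h3
      exact (Nat.eq_of_mul_eq_mul_left (Nat.pos_of_ne_zero (hn 0)) h3).symm
    obtain ⟨a, h4, h5⟩ := ih (fun i => n i.succ) (fun j => m j / a0 j) (fun i => hn _) h2
    refine ⟨Fin.cons a0 a, ?_, ?_⟩
    · intro i
      refine Fin.cases ?_ (fun i => ?_) i
      · simpa using hp
      · simpa using h4 i
    · intro j
      rw [Fin.prod_univ_succ]
      simp only [Fin.cons_zero, Fin.cons_succ, h5]
      exact Nat.mul_div_cancel' (ha0 j)

lemma diag_count (M N : ℕ) :
    ((((Fintype.piFinset fun _ : Fin M => Icc 1 N) ×ˢ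
      (Fintype.piFinset fun _ : Fin M => Icc 1 N)).filter
        fun x => ∏ i, x.1 i = ∏ i, x.2 i).card : ℝ) ≤
      (N : ℝ) ^ M * (∑ a ∈ Icc 1 N, (1 / a : ℝ)) ^ (M * M) := by
  classical
  set Ω := Fintype.piFinset fun _ : Fin M => Icc 1 N
  set D := (Ω ×ˢ Ω).filter fun x => ∏ i, x.1 i = ∏ i, x.2 i with hD
  have hmem : ∀ x ∈ D, (∀ i, 1 ≤ x.1 i ∧ x.1 i ≤ N) ∧ ∏ i, x.1 i = ∏ i, x.2 i := by
    intro x hx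
    simp only [hD, Finset.mem_filter, Finset.mem_product, Ω, Fintype.mem_piFinset,
      Finset.mem_Icc] at hx
    exact ⟨hx.1.1, hx.2⟩
  have hex : ∀ x : (Fin M → ℕ) × (Fin M → ℕ), x ∈ D → ∃ a : Fin M → Fin M → ℕ,
      (∀ i, ∏ j, a i j = x.1 i) ∧ (∀ j, ∏ i, a i j = x.2 j) := by
    intro x hx
    obtain ⟨h1, h2⟩ := hmem x hx
    exact factor_matrix M x.1 x.2 (fun i => by have := (h1 i).1; omega) h2
  choose! A hA1 hA2 using hex
  set g : (Fin M → ℕ) × (Fin M → ℕ) → (Fin M × Fin M → ℕ) := fun x p => A x p.1 p.2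
  have hsum : (∑ a ∈ Icc 1 N, (1 / a : ℝ)) ^ (M * M) =
      ∑ p ∈ Fintype.piFinset (fun _ : Fin M × Fin M => Icc 1 N), ∏ i, (1 / (p i : ℝ)) := by
    rw [Finset.sum_prod_piFinset (Icc 1 N) (fun (_ : Fin M × Fin M) (a : ℕ) => (1 / (a : ℝ)))]
    simp
  have hmaps : ∀ x ∈ D, g x ∈ Fintype.piFinset (fun _ : Fin M × Fin M => Icc 1 N) := by
    intro x hx
    rw [Fintype.mem_piFinset]
    rintro ⟨i, j⟩
    have h1 := hA1 x hx i
    have h2 := (hmem x hx).1 i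
    have h3 : A x i j ∣ x.1 i := by
      rw [← h1]; exact Finset.dvd_prod_of_mem (A x i) (Finset.mem_univ j)
    rw [Finset.mem_Icc]
    exact ⟨Nat.pos_of_dvd_of_pos h3 h2.1, (Nat.le_of_dvd h2.1 h3).trans h2.2⟩
  have hinj : Set.InjOn g D := by
    intro x hx y hy hxy
    have : ∀ i j, A x i j = A y i j := fun i j => congrFun hxy (i, j)
    apply Prod.ext
    · funext i; rw [← hA1 x hx i, ← hA1 y hy i]; simp only [this]
    · funext i; rw [← hA2 x hx i, ← hA2 y hy i]; simp only [this]
  rw [hsum, Finset.card_eq_sum_ones, Finset.mul_sum]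
  push_cast
  calc ∑ x ∈ D, (1 : ℝ) ≤ ∑ x ∈ D, (N : ℝ) ^ M * ∏ i, (1 / (g x i : ℝ)) := by
        refine Finset.sum_le_sum fun x hx => ?_
        have h1 : ∏ i, (1 / (g x i : ℝ)) = ∏ i, (1 / (x.1 i : ℝ)) := by
          rw [Fintype.prod_prod_type]
          refine Finset.prod_congr rfl fun i _ => ?_
          rw [← hA1 x hx i]
          push_cast
          simp only [one_div, Finset.prod_inv_distrib, g]
        rw [h1]
        have h2 : (N : ℝ) ^ M = ∏ i : Fin M, (N : ℝ) := by simp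
        rw [h2, ← Finset.prod_mul_distrib]
        have h3 : ∏ i : Fin M, (1 : ℝ) ≤ ∏ i : Fin M, (N : ℝ) * (1 / (x.1 i : ℝ)) := by
          refine Finset.prod_le_prod (fun _ _ => zero_le_one) fun i _ => ?_
          have h4 := (hmem x hx).1 i
          have h5 : (1 : ℝ) ≤ x.1 i := by exact_mod_cast h4.1
          have h6 : (x.1 i : ℝ) ≤ N := by exact_mod_cast h4.2
          rw [mul_one_div, le_div_iff₀ (by linarith)]; linarith
        simpa using h3
    _ = ∑ p ∈ D.image g, (N : ℝ) ^ M * ∏ i, (1 / (p i : ℝ)) := by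
        rw [Finset.sum_image hinj]
    _ ≤ _ := by
        refine Finset.sum_le_sum_of_subset_of_nonneg ?_ fun p _ _ => ?_
        · intro p hp
          obtain ⟨x, hx, rfl⟩ := Finset.mem_image.1 hp
          exact hmaps x hx
        · exact mul_nonneg (by positivity) (Finset.prod_nonneg fun i _ => by positivity)

lemma short_moment {q : ℕ} [NeZero q] (X : Finset (DirichletCharacter ℂ q)) (M N : ℕ)
    (hN : N ^ M ≤ q) (w : ℕ → ℂ) (hw : ∀ n ∈ Icc 1 N, ‖w n‖ ≤ 1) :
    ∑ χ ∈ X, ‖∑ n ∈ Icc 1 N, w n * χ (n : ZMod q)‖ ^ (2 * M) ≤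
      (q.totient : ℝ) * ((N : ℝ) ^ M * (∑ a ∈ Icc 1 N, (1 / a : ℝ)) ^ (M * M)) := by
  classical
  set Ω := Fintype.piFinset fun _ : Fin M => Icc 1 N with hΩ
  set c : ℕ → ℂ := fun a => ∑ x ∈ Ω.filter (fun x => ∏ i, x i = a), ∏ i, w (x i) with hc
  set I := Ω.image (fun x => ∏ i, x i) with hI
  have e1 : ∀ χ : DirichletCharacter ℂ q,
      (∑ n ∈ Icc 1 N, w n * χ (n : ZMod q)) ^ M = ∑ a ∈ I, c a * χ (a : ZMod q) := by
    intro χ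
    rw [Finset.sum_pow']
    rw [← Finset.sum_fiberwise_of_maps_to (s := Ω) (t := I) (g := fun x => ∏ i, x i)
      (fun x hx => Finset.mem_image_of_mem _ hx)]
    refine Finset.sum_congr rfl fun a _ => ?_
    rw [hc, Finset.sum_mul]
    refine Finset.sum_congr rfl fun x hx => ?_
    rw [Finset.mem_filter] at hx
    rw [← hx.2, Nat.cast_prod, map_prod, Finset.prod_mul_distrib]
  have hx1 : ∀ x ∈ Ω, ∀ i, 1 ≤ x i ∧ x i ≤ N := by
    intro x hx i
    rw [hΩ, Fintype.mem_piFinset] at hx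
    simpa using hx i
  have h1 : ∀ a ∈ I, 1 ≤ a ∧ a ≤ q := by
    intro a ha
    obtain ⟨x, hx, rfl⟩ := Finset.mem_image.1 ha
    constructor
    · exact Finset.one_le_prod' fun i _ => (hx1 x hx i).1
    · refine le_trans ?_ hN
      calc ∏ i, x i ≤ ∏ i : Fin M, N := Finset.prod_le_prod' fun i _ => (hx1 x hx i).2
        _ = N ^ M := by simp
  have h2 := A1 X I (fun a => a) c h1 (fun _ _ _ _ h => h)
  simp only [pow_mul', ← norm_pow, ← e1] at h2 ⊢
  refine h2.trans (mul_le_mul_of_nonneg_left ?_ (Nat.cast_nonneg _))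
  refine le_trans ?_ (by simpa only [pow_mul] using diag_count M N)
  have h3 : ∀ a ∈ I, ‖c a ^ 2‖ ≤ ((Ω.filter (fun x => ∏ i, x i = a)).card : ℝ) ^ 2 := by
    intro a _
    rw [norm_pow]
    refine pow_le_pow_left₀ (norm_nonneg _) ?_ 2
    rw [hc]
    refine (norm_sum_le _ _).trans ?_
    rw [Finset.card_eq_sum_ones]
    push_cast
    refine Finset.sum_le_sum fun x hx => ?_
    rw [Finset.mem_filter] at hx
    rw [norm_prod]
    exact Finset.prod_le_one (fun _ _ => norm_nonneg _)
      fun i _ => hw _ (by simpa using hx1 x hx.1 i)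
  refine (Finset.sum_le_sum h3).trans (le_of_eq ?_)
  rw [Finset.card_eq_sum_card_fiberwise (f := fun x => ∏ i, x.1 i) (t := I)]
  · push_cast
    refine Finset.sum_congr rfl fun a _ => ?_
    rw [sq, ← Nat.cast_mul, ← Finset.card_product]
    congr 2
    ext x
    simp only [Finset.mem_product, Finset.mem_filter]
    constructor
    · rintro ⟨⟨h1, h2⟩, h3, h4⟩; exact ⟨⟨⟨h1, h3⟩, by rw [h2, h4]⟩, h2⟩
    · rintro ⟨⟨⟨h1, h3⟩, h4⟩, h2⟩; exact ⟨⟨h1, h2⟩, h3, by rw [← h4, h2]⟩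
  · intro x hx
    have hx' := (Finset.mem_filter.1 (Finset.mem_coe.1 hx)).1
    have hx'' := (Finset.mem_product.1 hx').1
    rw [Finset.mem_coe, hI, Finset.mem_image]
    exact ⟨x.1, hx'', rfl⟩


/-! ## Part B1: trivial bound for L -/

lemma sum_range_zmod {q : ℕ} [NeZero q] (g : ZMod q → ℂ) :
    ∑ k ∈ range q, g (k : ZMod q) = ∑ a : ZMod q, g a := by
  refine Finset.sum_nbij' (fun k => (k : ZMod q)) ZMod.val (by simp) ?_ ?_ (by simp) (by simp)
  · intro a _; simpa using ZMod.val_lt a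
  · intro k hk; exact ZMod.val_cast_of_lt (by simpa using hk)

lemma partial_sum_bound_aux {q : ℕ} [NeZero q] (g : ZMod q → ℂ) (hg : ∑ a, g a = 0)
    (hb : ∀ a, ‖g a‖ ≤ 1) (n : ℕ) : ‖∑ k ∈ range n, g (k : ZMod q)‖ ≤ q := by
  induction n using Nat.strong_induction_on with
  | _ n ih =>
    by_cases h : n ≤ q
    · refine (norm_sum_le _ _).trans ?_
      refine (Finset.sum_le_sum fun k _ => hb _).trans ?_
      simpa using h
    · push Not at h
      obtain ⟨m, rfl⟩ := Nat.exists_eq_add_of_lt h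
      have hq : 0 < q := Nat.pos_of_ne_zero (NeZero.ne q)
      have : ∑ k ∈ range (q + m + 1), g (k : ZMod q) = ∑ k ∈ range (m + 1), g (k : ZMod q) := by
        rw [add_assoc, Finset.sum_range_add, sum_range_zmod, hg, zero_add]
        simp
      rw [this]
      exact ih (m + 1) (by omega)

lemma partial_sum_bound {q : ℕ} [NeZero q] (χ : DirichletCharacter ℂ q) (hχ : χ ≠ 1) (n : ℕ) :
    ‖∑ k ∈ Icc 1 n, χ (k : ZMod q)‖ ≤ q := by
  have h1 : ∑ k ∈ Icc 1 n, χ (k : ZMod q) = ∑ k ∈ range n, χ ((k : ZMod q) + 1) := by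
    rw [Finset.range_eq_Ico, Finset.sum_Ico_eq_sum_range]
    rw [show Icc 1 n = Ico 1 (n + 1) by ext; simp, Finset.sum_Ico_eq_sum_range]
    simp [add_comm]
  rw [h1]
  refine partial_sum_bound_aux (fun a => χ (a + 1)) ?_ (fun a => χ.norm_le_one _) n
  rw [← MulChar.sum_eq_zero_of_ne_one hχ]
  exact Fintype.sum_equiv (Equiv.addRight 1) _ _ (fun a => rfl)

open MeasureTheory Set in
lemma L_integral_rep {q : ℕ} [NeZero q] (χ : DirichletCharacter ℂ q) (hχ : χ ≠ 1) {s : ℂ}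
    (hs : 0 < s.re) : DirichletCharacter.LFunction χ s =
      s * ∫ t in Set.Ioi (1 : ℝ), (∑ k ∈ Finset.Icc 1 ⌊t⌋₊, χ (k : ZMod q)) * (t : ℂ) ^ (-(s + 1)) := by
  set A : ℝ → ℂ := fun t => ∑ k ∈ Finset.Icc 1 ⌊t⌋₊, χ (k : ZMod q) with hA
  set f : ℝ → ℂ := (Set.Ioi (1 : ℝ)).indicator A with hf
  have hAm : Measurable A :=
    (measurable_from_nat (f := fun n : ℕ => ∑ k ∈ Finset.Icc 1 n, χ (k : ZMod q))).comp
      Nat.measurable_floor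
  have hfm : Measurable f := hAm.indicator measurableSet_Ioi
  have hfb : ∀ t, ‖f t‖ ≤ q := by
    intro t
    refine (norm_indicator_le_norm_self _ _).trans (partial_sum_bound χ hχ _)
  have hloc : LocallyIntegrableOn f (Ioi 0) := by
    refine LocallyIntegrable.locallyIntegrableOn ?_ _
    have : LocallyIntegrable (fun _ : ℝ => (q : ℝ)) := locallyIntegrable_const _
    exact this.mono hfm.aestronglyMeasurable (Filter.Eventually.of_forall fun t => by
      simpa using hfb t)
  have hintg : ∀ s : ℂ, ∫ t in Set.Ioi (1 : ℝ), A t * (t : ℂ) ^ (-(s + 1)) = mellin f (-s) := by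
    intro s
    rw [mellin]
    rw [show (Set.Ioi (1 : ℝ)) = Set.Ioi (0 : ℝ) ∩ Set.Ioi (1 : ℝ) by ext; simp]
    rw [← setIntegral_indicator measurableSet_Ioi]
    congr 1
    funext t
    by_cases ht : t ∈ Set.Ioi (1 : ℝ)
    · simp only [Set.indicator_of_mem ht, hf, smul_eq_mul]
      rw [mul_comm]; congr 2; ring
    · simp only [Set.indicator_of_notMem ht, hf, smul_zero]
  have hdiff : ∀ s : ℂ, 0 < s.re → DifferentiableAt ℂ (mellin f) (-s) := by
    intro s hs
    refine mellin_differentiableAt_of_isBigO_rpow (a := 0) (b := -s.re - 1) hloc ?_ (by simpa) ?_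
      (by simp)
    · refine Asymptotics.IsBigO.of_bound q (Filter.Eventually.of_forall fun t => ?_)
      simpa using hfb t
    · refine Asymptotics.IsBigO.of_bound 1 ?_
      have : ∀ᶠ t in nhdsWithin (0 : ℝ) (Ioi 0), t < 1 :=
        eventually_nhdsWithin_of_eventually_nhds (eventually_lt_nhds one_pos)
      filter_upwards [this] with t ht
      have : f t = 0 := by
        rw [hf, Set.indicator_of_notMem]; simp; linarith
      rw [this]; simp
  have hU : IsOpen {z : ℂ | 0 < z.re} := isOpen_lt continuous_const Complex.continuous_re
  have e1 : AnalyticOnNhd ℂ (fun z => DirichletCharacter.LFunction χ z) {z : ℂ | 0 < z.re} :=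
    (DirichletCharacter.differentiable_LFunction hχ).differentiableOn.analyticOnNhd hU
  have e2 : AnalyticOnNhd ℂ (fun z => z * mellin f (-z)) {z : ℂ | 0 < z.re} := by
    refine DifferentiableOn.analyticOnNhd ?_ hU
    intro z hz
    refine DifferentiableAt.differentiableWithinAt ?_
    exact differentiableAt_id.mul ((hdiff z hz).comp z differentiableAt_id.neg)
  have hconn : IsPreconnected {z : ℂ | 0 < z.re} :=
    (convex_halfSpace_re_gt 0).isPreconnected
  have hev : (fun z => DirichletCharacter.LFunction χ z) =ᶠ[nhds (2 : ℂ)]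
      (fun z => z * mellin f (-z)) := by
    have : ∀ᶠ z : ℂ in nhds 2, 1 < z.re :=
      Complex.continuous_re.continuousAt.eventually (lt_mem_nhds (by norm_num))
    filter_upwards [this] with z hz
    rw [DirichletCharacter.LFunction_eq_LSeries χ hz,
      LSeries_eq_mul_integral (r := 0) _ le_rfl (by linarith)
        (DirichletCharacter.LSeriesSummable_of_one_lt_re χ hz) ?_]
    · rw [← hintg]
    · refine Asymptotics.IsBigO.of_bound q (Filter.Eventually.of_forall fun t => ?_)
      simpa using partial_sum_bound χ hχ t
  have := e1.eqOn_of_preconnected_of_eventuallyEq e2 hconn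
    (show (2 : ℂ) ∈ {z : ℂ | 0 < z.re} by simp) hev hs
  rw [hintg]
  exact this

open MeasureTheory Set in
lemma L_bound {q : ℕ} [NeZero q] (χ : DirichletCharacter ℂ q) (hχ : χ ≠ 1) {s : ℂ}
    (hs : 0 < s.re) : ‖DirichletCharacter.LFunction χ s‖ ≤ q * ‖s‖ / s.re := by
  rw [L_integral_rep χ hχ hs, norm_mul, mul_comm (q : ℝ), mul_div_assoc]
  refine mul_le_mul_of_nonneg_left ?_ (norm_nonneg _)
  have h1 : ∫ t in Set.Ioi (1 : ℝ), (q : ℝ) * t ^ (-(s.re + 1)) = q / s.re := by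
    rw [integral_const_mul, integral_Ioi_rpow_of_lt (by linarith) one_pos]
    have : -(s.re + 1) + 1 = -s.re := by ring
    rw [this]; simp; field_simp
  rw [← h1]
  refine norm_integral_le_of_norm_le ?_ ?_
  · exact (integrableOn_Ioi_rpow_of_lt (by linarith) one_pos).const_mul _
  · filter_upwards [ae_restrict_mem measurableSet_Ioi] with t ht
    rw [norm_mul, Complex.norm_cpow_eq_rpow_re_of_pos (by simp at ht; linarith)]
    simp only [neg_re, add_re, one_re]
    exact mul_le_mul_of_nonneg_right (partial_sum_bound χ hχ _) (by simp at ht; positivity)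


/-! ## Holomorphic logarithms -/

lemma holo_log {U : Set ℂ} (hU : IsOpen U) (hc : Convex ℝ U) (hne : U.Nonempty) {g : ℂ → ℂ}
    (hg : DifferentiableOn ℂ g U) (h0 : ∀ s ∈ U, g s ≠ 0) :
    ∃ H : ℂ → ℂ, DifferentiableOn ℂ H U ∧ ∀ s ∈ U, Complex.exp (H s) = g s := by
  have hsc : IsSimplyConnected U := by
    have := hc.contractibleSpace hne
    exact (inferInstance : SimplyConnectedSpace U)
  obtain ⟨H, hH, hexp⟩ := Complex.exists_continuousOn_eqOn_exp_comp hsc hU hg.continuousOn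
    (by rintro ⟨s, hs, h⟩; exact h0 s hs h)
  refine ⟨H, fun a ha => ?_, fun s hs => hexp hs⟩
  have hUa : U ∈ nhds a := hU.mem_nhds ha
  have hca : ContinuousAt H a := (hH a ha).continuousAt hUa
  have hga : DifferentiableAt ℂ g a := hg.differentiableAt hUa
  have hev : H =ᶠ[nhds a] fun s => H a + Complex.log (g s / g a) := by
    have h1 : ∀ᶠ s in nhds a, ‖H s - H a‖ < 1 := by
      have := Metric.continuousAt_iff'.1 hca 1 one_pos
      simpa [dist_eq_norm] using this
    filter_upwards [h1, hUa] with s hs hsU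
    have e1 : g s / g a = Complex.exp (H s - H a) := by
      rw [Complex.exp_sub]; rw [← hexp hsU, ← hexp ha]; rfl
    have h2 : |(H s - H a).im| < 1 := (Complex.abs_im_le_norm _).trans_lt hs
    rw [abs_lt] at h2
    rw [e1, Complex.log_exp (by linarith [Real.pi_gt_three]) (by linarith [Real.pi_gt_three])]
    ring
  refine DifferentiableAt.differentiableWithinAt ?_
  refine DifferentiableAt.congr_of_eventuallyEq ?_ hev
  refine (differentiableAt_const _).add (DifferentiableAt.clog (hga.div_const _) ?_)
  rw [div_self (h0 a ha)]
  exact Complex.one_mem_slitPlane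

/-- coefficients of the logarithm of zeta -/
noncomputable def cL (n : ℕ) : ℝ := ArithmeticFunction.vonMangoldt n / Real.log n

lemma cL_nonneg (n : ℕ) : 0 ≤ cL n :=
  div_nonneg ArithmeticFunction.vonMangoldt_nonneg (Real.log_natCast_nonneg n)

lemma cL_le_one (n : ℕ) : cL n ≤ 1 :=
  div_le_one_of_le₀ ArithmeticFunction.vonMangoldt_le_log (Real.log_natCast_nonneg n)

/-- coefficients of the logarithm of L -/
noncomputable def cχ {q : ℕ} (χ : DirichletCharacter ℂ q) (n : ℕ) : ℂ := cL n * χ (n : ZMod q)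

lemma cχ_norm_le {q : ℕ} (χ : DirichletCharacter ℂ q) (n : ℕ) : ‖cχ χ n‖ ≤ 1 := by
  rw [cχ, norm_mul, Complex.norm_real, Real.norm_of_nonneg (cL_nonneg n)]
  exact mul_le_one₀ (cL_le_one n) (norm_nonneg _) (χ.norm_le_one _)

lemma cχ_abscissa {q : ℕ} (χ : DirichletCharacter ℂ q) : LSeries.abscissaOfAbsConv (cχ χ) ≤ 1 := by
  refine LSeries.abscissaOfAbsConv_le_one_of_isBigO_one ?_
  refine Asymptotics.IsBigO.of_bound 1 (Filter.Eventually.of_forall fun n => ?_)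
  simpa using cχ_norm_le χ n

lemma cχ_summable {q : ℕ} (χ : DirichletCharacter ℂ q) {s : ℂ} (hs : 1 < s.re) :
    LSeriesSummable (cχ χ) s :=
  LSeriesSummable_of_abscissaOfAbsConv_lt_re
    (lt_of_le_of_lt (cχ_abscissa χ) (by exact_mod_cast hs))

lemma exp_LSeries_cχ {q : ℕ} [NeZero q] (χ : DirichletCharacter ℂ q) {s : ℂ} (hs : 1 < s.re) :
    Complex.exp (LSeries (cχ χ) s) = DirichletCharacter.LFunction χ s := by
  set U : Set ℂ := {z : ℂ | 1 < z.re} with hUdef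
  have hU : IsOpen U := isOpen_lt continuous_const Complex.continuous_re
  have hpre : IsPreconnected U := (convex_halfSpace_re_gt 1).isPreconnected
  set Lf : ℂ → ℂ := LSeries (fun n : ℕ => χ (n : ZMod q)) with hLf
  have hL0 : ∀ z ∈ U, Lf z ≠ 0 := fun z hz =>
    DirichletCharacter.LSeries_ne_zero_of_one_lt_re χ hz
  have hLab : LSeries.abscissaOfAbsConv (fun n : ℕ => χ (n : ZMod q)) ≤ 1 := by
    refine LSeries.abscissaOfAbsConv_le_one_of_isBigO_one ?_
    refine Asymptotics.IsBigO.of_bound 1 (Filter.Eventually.of_forall fun n => ?_)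
    simpa using χ.norm_le_one _
  have hLd : ∀ z ∈ U, HasDerivAt Lf (deriv Lf z) z := fun z hz =>
    (LSeries_hasDerivAt (lt_of_le_of_lt hLab (by exact_mod_cast hz))).differentiableAt.hasDerivAt
  have hFd : ∀ z ∈ U, HasDerivAt (LSeries (cχ χ)) (deriv Lf z / Lf z) z := by
    intro z hz
    have h1 := LSeries_hasDerivAt (f := cχ χ) (s := z)
      (lt_of_le_of_lt (cχ_abscissa χ) (by exact_mod_cast hz))
    have h2 := DirichletCharacter.LSeries_twist_vonMangoldt_eq χ hz
    have h3 : LSeries (LSeries.logMul (cχ χ)) z = - deriv Lf z / Lf z := by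
      rw [hLf, ← h2]
      refine LSeries_congr (fun {n} hn => ?_) z
      simp only [LSeries.logMul, cχ, cL, Pi.mul_apply]
      by_cases h1 : n = 1
      · subst h1; simp
      · have : Real.log n ≠ 0 := by
          apply Real.log_ne_zero_of_pos_of_ne_one
          · exact_mod_cast Nat.pos_of_ne_zero hn
          · exact_mod_cast h1
        rw [← Complex.natCast_log, Complex.ofReal_div]
        have h : ((Real.log n : ℝ) : ℂ) ≠ 0 := by exact_mod_cast this
        field_simp
    rw [h3] at h1
    convert h1 using 1; ring
  set G : ℂ → ℂ := fun z => Complex.exp (-LSeries (cχ χ) z) * Lf z with hG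
  have hGd : ∀ z ∈ U, HasDerivAt G 0 z := by
    intro z hz
    refine HasDerivAt.congr_deriv (((hFd z hz).neg.cexp).mul (hLd z hz)) ?_
    have := hL0 z hz
    simp only [Pi.neg_apply]
    have e : Lf z * (deriv Lf z / Lf z) = deriv Lf z := mul_div_cancel₀ _ this
    linear_combination (-Complex.exp (-LSeries (cχ χ) z)) * e
  have hconst : ∀ z ∈ U, ∀ w ∈ U, G z = G w := fun z hz w hw =>
    hU.is_const_of_deriv_eq_zero hpre
      (fun z hz => (hGd z hz).differentiableAt.differentiableWithinAt)
      (fun z hz => (hGd z hz).deriv) hz hw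
  have hlim : Filter.Tendsto (fun x : ℝ => G x) Filter.atTop (nhds 1) := by
    have h1 := LSeries.tendsto_atTop (f := cχ χ)
      (lt_of_le_of_lt (cχ_abscissa χ) (EReal.coe_lt_top 1))
    have h2 := LSeries.tendsto_atTop (f := fun n : ℕ => χ (n : ZMod q))
      (lt_of_le_of_lt hLab (EReal.coe_lt_top 1))
    have h3 := (h1.neg.cexp).mul h2
    simpa [cχ, cL] using h3
  have hG1 : G s = 1 := by
    refine tendsto_nhds_unique ?_ hlim
    refine tendsto_const_nhds.congr' ?_
    filter_upwards [Filter.eventually_gt_atTop (1 : ℝ)] with x hx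
    exact hconst s hs x (by simpa [hUdef] using hx)
  rw [DirichletCharacter.LFunction_eq_LSeries χ hs]
  change _ = Lf s
  have : Complex.exp (LSeries (cχ χ) s) * G s = Lf s := by
    simp only [hG, ← mul_assoc, ← Complex.exp_add]; simp
  rw [← this, hG1, mul_one]

lemma log_exists {q : ℕ} [NeZero q] (χ : DirichletCharacter ℂ q) (hχ : χ ≠ 1)
    (hRH : dirichletRH χ) : ∃ F : ℂ → ℂ, DifferentiableOn ℂ F {z : ℂ | 1 / 2 < z.re} ∧
      (∀ s : ℂ, 1 / 2 < s.re → Complex.exp (F s) = DirichletCharacter.LFunction χ s) ∧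
      (∀ s : ℂ, 1 < s.re → F s = LSeries (cχ χ) s) := by
  have hU : IsOpen {z : ℂ | 1 / 2 < z.re} := isOpen_lt continuous_const Complex.continuous_re
  have h0 : ∀ s ∈ {z : ℂ | 1 / 2 < z.re}, DirichletCharacter.LFunction χ s ≠ 0 := by
    intro s hs h
    have hs' : 1 / 2 < s.re := hs
    rcases lt_or_ge s.re 1 with h1 | h1
    · have := hRH s (by linarith) h1 h; linarith
    · exact DirichletCharacter.LFunction_ne_zero_of_one_le_re χ (Or.inl hχ) h1 h
  obtain ⟨H, hH, hexp⟩ := holo_log hU (convex_halfSpace_re_gt _) ⟨1, by norm_num⟩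
    (DirichletCharacter.differentiable_LFunction hχ).differentiableOn h0
  set V : Set ℂ := {z : ℂ | 1 < z.re} with hVdef
  have hV : IsOpen V := isOpen_lt continuous_const Complex.continuous_re
  have hVU : V ⊆ {z : ℂ | 1 / 2 < z.re} := fun z hz => by
    have : 1 < z.re := hz
    show 1 / 2 < z.re
    linarith
  have hFdiff : DifferentiableOn ℂ (LSeries (cχ χ)) V := fun z hz =>
    (LSeries_hasDerivAt (lt_of_le_of_lt (cχ_abscissa χ)
      (by exact_mod_cast hz))).differentiableAt.differentiableWithinAt
  have key : ∀ (K : ℂ → ℂ), DifferentiableOn ℂ K V →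
      (∀ z ∈ V, Complex.exp (K z) = DirichletCharacter.LFunction χ z) →
      ∀ z ∈ V, deriv K z = deriv (DirichletCharacter.LFunction χ) z /
        DirichletCharacter.LFunction χ z := by
    intro K hK hKe z hz
    have h1 : HasDerivAt K (deriv K z) z := (hK.differentiableAt (hV.mem_nhds hz)).hasDerivAt
    have h2 := h1.cexp
    have h3 : (fun z => Complex.exp (K z)) =ᶠ[nhds z] DirichletCharacter.LFunction χ := by
      filter_upwards [hV.mem_nhds hz] with w hw using hKe w hw
    have h4 := h3.deriv_eq
    rw [h2.deriv, hKe z hz] at h4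
    rw [← h4]
    have := h0 z (hVU hz)
    field_simp
  obtain ⟨a, ha⟩ := hV.exists_eq_add_of_deriv_eq (convex_halfSpace_re_gt 1).isPreconnected
    (hH.mono hVU) hFdiff (fun z hz => by
      rw [key H (hH.mono hVU) (fun z hz => hexp z (hVU hz)) z hz,
        key _ hFdiff (fun z hz => exp_LSeries_cχ χ hz) z hz])
  have ha1 : Complex.exp a = 1 := by
    have h2 : (2 : ℂ) ∈ V := by simp [hVdef]
    have h3 := ha h2
    have h4 := hexp 2 (hVU h2)
    rw [h3, Complex.exp_add, exp_LSeries_cχ χ h2] at h4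
    have := h0 2 (hVU h2)
    field_simp at h4
    exact h4
  refine ⟨fun s => H s - a, hH.sub_const a, fun s hs => ?_, fun s hs => ?_⟩
  · rw [Complex.exp_sub, ha1, div_one, hexp s hs]
  · have := ha (show s ∈ V from hs)
    simp only [this]; ring


/-! ## Growth of the logarithm -/

/-- log of the analytic conductor -/
noncomputable def LQ (q : ℕ) (t : ℝ) : ℝ := Real.log (q * (|t| + 4))

lemma LQ_ge {q : ℕ} [NeZero q] (t : ℝ) : 1 ≤ LQ q t := by
  have hq : (1 : ℝ) ≤ q := by exact_mod_cast Nat.one_le_iff_ne_zero.2 (NeZero.ne q)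
  rw [LQ, Real.le_log_iff_exp_le (by positivity)]
  have := Real.exp_one_lt_d9
  nlinarith [abs_nonneg t]

/-- sum of inverse squares -/
noncomputable def B2 : ℝ := ∑' n : ℕ, ((n : ℝ) ^ 2)⁻¹

lemma B2_summable : Summable fun n : ℕ => ((n : ℝ) ^ 2)⁻¹ :=
  Real.summable_nat_pow_inv.2 (by norm_num)

lemma B2_nonneg : 0 ≤ B2 := tsum_nonneg fun n => by positivity

lemma term_cχ_le {q : ℕ} (χ : DirichletCharacter ℂ q) {s : ℂ} (hs : 2 ≤ s.re) (n : ℕ) :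
    ‖LSeries.term (cχ χ) s n‖ ≤ ((n : ℝ) ^ 2)⁻¹ := by
  rcases eq_or_ne n 0 with rfl | hn
  · simp
  have hn1 : (1 : ℝ) ≤ n := by exact_mod_cast Nat.one_le_iff_ne_zero.2 hn
  rw [LSeries.term_of_ne_zero hn, norm_div, Complex.norm_natCast_cpow_of_pos (Nat.pos_of_ne_zero hn)]
  rw [div_eq_mul_inv]
  calc _ ≤ 1 * ((n : ℝ) ^ s.re)⁻¹ := by
        gcongr; exact cχ_norm_le χ n
    _ ≤ _ := by
        rw [one_mul]
        gcongr
        rw [← Real.rpow_natCast]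
        exact Real.rpow_le_rpow_of_exponent_le hn1 (by exact_mod_cast hs)

lemma LSeries_cχ_bound {q : ℕ} (χ : DirichletCharacter ℂ q) {s : ℂ} (hs : 2 ≤ s.re) :
    ‖LSeries (cχ χ) s‖ ≤ B2 :=
  tsum_of_norm_bounded B2_summable.hasSum (term_cχ_le χ hs)

lemma log_norm_L_le {q : ℕ} [NeZero q] (χ : DirichletCharacter ℂ q) (hχ : χ ≠ 1) {s : ℂ} {t : ℝ}
    (h1 : 1 / 10 ≤ s.re) (h2 : s.re ≤ 4) (h3 : |s.im - t| ≤ 2) :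
    ‖DirichletCharacter.LFunction χ s‖ ≤ Real.exp (4 * LQ q t) := by
  have hq : (1 : ℝ) ≤ q := by exact_mod_cast Nat.one_le_iff_ne_zero.2 (NeZero.ne q)
  refine (L_bound χ hχ (by linarith)).trans ?_
  have h4 : ‖s‖ ≤ |t| + 6 := by
    refine (Complex.norm_le_abs_re_add_abs_im s).trans ?_
    rw [abs_of_nonneg (by linarith : 0 ≤ s.re)]
    have := abs_sub_abs_le_abs_sub s.im t
    linarith
  have h5 : Real.exp (4 * LQ q t) = (q * (|t| + 4)) ^ 4 := by
    rw [LQ, mul_comm, Real.exp_mul, Real.exp_log (by positivity)]; norm_cast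
  rw [h5, div_le_iff₀ (by linarith)]
  have h0 := abs_nonneg t
  have h6 : q * (|t| + 6) ≤ (q * (|t| + 4)) * 2 := by nlinarith
  set Y : ℝ := q * (|t| + 4)
  have hY : 4 ≤ Y := by nlinarith
  have h7 : q * ‖s‖ ≤ q * (|t| + 6) := by gcongr
  have h8 : Y * 64 ≤ Y ^ 4 := by
    have : (4 : ℝ) ^ 3 ≤ Y ^ 3 := pow_le_pow_left₀ (by norm_num) hY 3
    nlinarith
  nlinarith [pow_nonneg (by linarith : (0 : ℝ) ≤ Y) 4]

lemma F_growth : ∃ A : ℝ, 1 ≤ A ∧ ∀ {q : ℕ} [NeZero q] (χ : DirichletCharacter ℂ q), χ ≠ 1 →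
    ∀ F : ℂ → ℂ, DifferentiableOn ℂ F {z : ℂ | 1 / 2 < z.re} →
      (∀ s : ℂ, 1 / 2 < s.re → Complex.exp (F s) = DirichletCharacter.LFunction χ s) →
      (∀ s : ℂ, 1 < s.re → F s = LSeries (cχ χ) s) →
      ∀ a : ℝ, 0 < a → a ≤ 1 → ∀ s : ℂ, 1 / 2 + a ≤ s.re → ‖F s‖ ≤ A / a * LQ q s.im := by
  refine ⟨12 + 3 * B2, by linarith [B2_nonneg], ?_⟩
  intro q _ χ hχ F hF hexp hser a ha ha1 s hs
  have hB := B2_nonneg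
  have hLQ := LQ_ge (q := q) s.im
  have h32 : (0 : ℝ) < 3 / 2 := by norm_num
  rcases le_or_gt 2 s.re with h2 | h2
  · rw [hser s (by linarith)]
    refine (LSeries_cχ_bound χ h2).trans ?_
    rw [div_mul_eq_mul_div, le_div_iff₀ ha]
    nlinarith
  · set c : ℂ := ⟨2, s.im⟩ with hc
    set g : ℂ → ℂ := fun z => F (c + z) with hg
    have hmem : ∀ z ∈ Metric.ball (0 : ℂ) (3 / 2), 1 / 2 < (c + z).re := by
      intro z hz
      have h1 : ‖z‖ < 3 / 2 := by simpa using hz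
      have h3 := Complex.abs_re_le_norm z
      have h4 := neg_abs_le z.re
      simp [hc]; linarith
    have hgd : DifferentiableOn ℂ g (Metric.ball 0 (3 / 2)) := by
      intro z hz
      have hz' := hmem z hz
      have hU : IsOpen {z : ℂ | 1 / 2 < z.re} := isOpen_lt continuous_const Complex.continuous_re
      have h1 : DifferentiableAt ℂ F (c + z) := hF.differentiableAt (hU.mem_nhds hz')
      exact (h1.comp z (differentiableAt_id.const_add c)).differentiableWithinAt
    have hmaps : Set.MapsTo g (Metric.ball 0 (3 / 2)) {z | z.re ≤ 4 * LQ q s.im} := by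
      intro z hz
      have hz' := hmem z hz
      have h1 : ‖z‖ < 3 / 2 := by simpa using hz
      have h3 := Complex.abs_re_le_norm z
      have h4 := Complex.abs_im_le_norm z
      have h5 := log_norm_L_le χ hχ (s := c + z) (t := s.im) (by linarith)
        (by simp [hc]; linarith [le_abs_self z.re]) (by simp [hc]; linarith)
      rw [← hexp _ hz', Complex.norm_exp, Real.exp_le_exp] at h5
      exact h5
    have hz : s - c ∈ Metric.ball (0 : ℂ) (3 / 2) := by
      have : s - c = ((s.re - 2 : ℝ) : ℂ) := by
        apply Complex.ext <;> simp [hc]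
      rw [this, mem_ball_zero_iff, Complex.norm_real, Real.norm_eq_abs, abs_lt]
      constructor <;> linarith
    have hnorm : ‖s - c‖ = 2 - s.re := by
      have : s - c = ((s.re - 2 : ℝ) : ℂ) := by
        apply Complex.ext <;> simp [hc]
      rw [this, Complex.norm_real, Real.norm_eq_abs, abs_of_neg (by linarith)]; ring
    have key := Complex.borelCaratheodory (f := g) (M := 4 * LQ q s.im) (R := 3 / 2) (z := s - c)
      (by linarith) hgd hmaps h32 hz
    have e1 : g (s - c) = F s := by simp [hg]
    have e2 : ‖g 0‖ ≤ B2 := by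
      simp only [hg, add_zero]
      rw [hser c (by simp [hc])]
      exact LSeries_cχ_bound χ (by simp [hc])
    rw [e1, hnorm] at key
    refine key.trans ?_
    have h6 : a ≤ 3 / 2 - (2 - s.re) := by linarith
    calc 2 * (4 * LQ q s.im) * (2 - s.re) / (3 / 2 - (2 - s.re)) +
          ‖g 0‖ * (3 / 2 + (2 - s.re)) / (3 / 2 - (2 - s.re))
        = (2 * (4 * LQ q s.im) * (2 - s.re) + ‖g 0‖ * (3 / 2 + (2 - s.re))) /
          (3 / 2 - (2 - s.re)) := by rw [← add_div]
      _ ≤ (12 * LQ q s.im + 3 * B2) / a := by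
          apply div_le_div₀ (by positivity) _ ha h6
          nlinarith [norm_nonneg (g 0)]
      _ ≤ _ := by
          rw [div_mul_eq_mul_div]
          apply div_le_div_of_nonneg_right _ ha.le
          nlinarith


/-! ## Local factorization -/

lemma blaschke_induct (R r M : ℝ) (hr : 0 < r) (hrR : r < R) :
    ∀ n : ℕ, ∀ f : ℂ → ℂ, Differentiable ℂ f →
      (∀ s ∈ Metric.closedBall (0 : ℂ) R, ‖f s‖ ≤ M) → f 0 ≠ 0 → M < ‖f 0‖ * (R / r) ^ n →
      ∃ (l : List ℂ) (G : ℂ → ℂ), Differentiable ℂ G ∧ (∀ ρ ∈ l, ‖ρ‖ ≤ r ∧ f ρ = 0) ∧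
        l.length ≤ n ∧ (∀ s ∈ Metric.closedBall (0 : ℂ) R, ‖G s‖ ≤ M) ∧
        (∀ s ∈ Metric.closedBall (0 : ℂ) r, G s ≠ 0) ∧ ‖f 0‖ ≤ ‖G 0‖ ∧
        ∀ s, f s * (l.map fun ρ => ((R : ℂ) ^ 2 - (starRingEnd ℂ) ρ * s)).prod =
          G s * (l.map fun ρ => (R : ℂ) * (s - ρ)).prod := by
  intro n
  have hR : 0 < R := hr.trans hrR
  induction n with
  | zero =>
    intro f hf hM h0 hlt
    have := hM 0 (by simp [hR.le])
    simp at hlt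
    linarith
  | succ n ih =>
    intro f hf hM h0 hlt
    by_cases hz : ∃ ρ ∈ Metric.closedBall (0 : ℂ) r, f ρ = 0
    · obtain ⟨ρ, hρr, hρ⟩ := hz
      have hρr' : ‖ρ‖ ≤ r := by simpa using hρr
      have hρ0 : ρ ≠ 0 := by rintro rfl; exact h0 hρ
      have hρpos : 0 < ‖ρ‖ := norm_pos_iff.2 hρ0
      set D : ℂ → ℂ := dslope f ρ with hD
      have hDd : Differentiable ℂ D := by
        intro z
        have h1 : DifferentiableOn ℂ (dslope f ρ) Set.univ :=
          (Complex.differentiableOn_dslope Filter.univ_mem).2 hf.differentiableOn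
        exact (h1 z (Set.mem_univ z)).differentiableAt Filter.univ_mem
      have hfD : ∀ s, f s = (s - ρ) * D s := by
        intro s
        have := sub_smul_dslope f ρ s
        rw [hρ, sub_zero, smul_eq_mul] at this
        exact this.symm
      set g : ℂ → ℂ := fun s => D s * (((R : ℂ) ^ 2 - (starRingEnd ℂ) ρ * s) / R) with hg
      have hRc : (R : ℂ) ≠ 0 := by exact_mod_cast hR.ne'
      have hgd : Differentiable ℂ g := by
        refine hDd.mul ?_
        fun_prop
      have hfg : ∀ s, f s * ((R : ℂ) ^ 2 - (starRingEnd ℂ) ρ * s) = g s * ((R : ℂ) * (s - ρ)) := by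
        intro s
        rw [hfD s, hg]; field_simp
      have hsphere : ∀ s ∈ Metric.sphere (0 : ℂ) R, ‖g s‖ ≤ M := by
        intro s hs
        have hsR : ‖s‖ = R := by simpa using hs
        have h1 : ‖(R : ℂ) ^ 2 - (starRingEnd ℂ) ρ * s‖ = R * ‖s - ρ‖ := by
          have : (R : ℂ) ^ 2 - (starRingEnd ℂ) ρ * s = (starRingEnd ℂ) (s - ρ) * s := by
            rw [← hsR, ← Complex.conj_mul', map_sub]; ring
          rw [this, norm_mul, Complex.norm_conj, hsR, mul_comm]
        have h2 : ‖f s‖ ≤ M := hM s (Metric.sphere_subset_closedBall hs)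
        have h3 : ‖g s‖ = ‖f s‖ := by
          rw [hfD s, hg]
          simp only [norm_mul, norm_div, h1, Complex.norm_real, Real.norm_of_nonneg hR.le]
          field_simp
        rw [h3]; exact h2
      have hgM : ∀ s ∈ Metric.closedBall (0 : ℂ) R, ‖g s‖ ≤ M := by
        intro s hs
        refine Complex.norm_le_of_forall_mem_frontier_norm_le (U := Metric.ball (0 : ℂ) R)
          Metric.isBounded_ball hgd.diffContOnCl ?_ ?_
        · rw [frontier_ball _ hR.ne']; exact hsphere
        · rwa [closure_ball _ hR.ne']
      have hg0 : ‖f 0‖ * (R / r) ≤ ‖g 0‖ := by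
        have h1 : ‖f 0‖ * (R / ‖ρ‖) = ‖g 0‖ := by
          rw [hfD 0, hg]
          simp only [norm_mul, norm_div, mul_zero, sub_zero, norm_pow, Complex.norm_real,
            Real.norm_of_nonneg hR.le, zero_sub, norm_neg]
          field_simp
        rw [← h1]; gcongr
      have hf0pos : 0 < ‖f 0‖ := norm_pos_iff.2 h0
      have hRr : 1 ≤ R / r := (one_le_div hr).2 hrR.le
      have hg0' : g 0 ≠ 0 := by
        rw [← norm_pos_iff]; nlinarith
      have hlt' : M < ‖g 0‖ * (R / r) ^ n := by
        refine hlt.trans_le ?_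
        rw [pow_succ', ← mul_assoc]; gcongr
      obtain ⟨l, G, hGd, hl, hlen, hGM, hGne, hG0, hprod⟩ := ih g hgd hgM hg0' hlt'
      refine ⟨ρ :: l, G, hGd, ?_, by simpa using hlen, hGM, hGne, by nlinarith, ?_⟩
      · intro z hz
        rw [List.mem_cons] at hz
        rcases hz with rfl | hz
        · exact ⟨hρr', hρ⟩
        · obtain ⟨h1, h2⟩ := hl z hz
          refine ⟨h1, ?_⟩
          have h3 := hfg z
          rw [h2, zero_mul, mul_eq_zero] at h3
          rcases h3 with h3 | h3
          · exact h3
          · exfalso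
            rw [sub_eq_zero] at h3
            have h4 : R ^ 2 = ‖ρ‖ * ‖z‖ := by
              have := congrArg norm h3
              simpa [norm_mul, Complex.norm_conj, abs_of_pos hR] using this
            nlinarith [norm_nonneg z]
      · intro s
        simp only [List.map_cons, List.prod_cons]
        calc _ = (f s * ((R : ℂ) ^ 2 - (starRingEnd ℂ) ρ * s)) *
              (l.map fun ρ => ((R : ℂ) ^ 2 - (starRingEnd ℂ) ρ * s)).prod := by ring
          _ = (g s * (l.map fun ρ => ((R : ℂ) ^ 2 - (starRingEnd ℂ) ρ * s)).prod) *
              ((R : ℂ) * (s - ρ)) := by rw [hfg]; ring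
          _ = _ := by rw [hprod]; ring
    · push Not at hz
      exact ⟨[], f, hf, by simp, by simp, hM, hz, le_rfl, by simp⟩

lemma log_prod_list (l : List ℂ) (g : ℂ → ℂ) (h : ∀ ρ ∈ l, g ρ ≠ 0) :
    Real.log ‖(l.map g).prod‖ = (l.map fun ρ => Real.log ‖g ρ‖).sum := by
  induction l with
  | nil => simp
  | cons a l ih =>
    simp only [List.map_cons, List.prod_cons, List.sum_cons, norm_mul]
    rw [Real.log_mul, ih (fun ρ hρ => h ρ (by simp [hρ]))]
    · exact norm_ne_zero_iff.2 (h a (by simp))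
    · rw [norm_ne_zero_iff]
      refine List.prod_ne_zero ?_
      simp only [List.mem_map, not_exists, not_and]
      intro x hx
      exact h x (by simp [hx])

lemma log_norm_sub_le {u v : ℂ} {δ : ℝ} (hδ : 0 < δ) (hv : δ ≤ ‖v‖) (hu : u ≠ 0) :
    Real.log ‖u‖ - Real.log ‖v‖ ≤ ‖u - v‖ / δ := by
  have hv0 : 0 < ‖v‖ := hδ.trans_le hv
  have hu0 : 0 < ‖u‖ := norm_pos_iff.2 hu
  rw [← Real.log_div hu0.ne' hv0.ne']
  refine (Real.log_le_sub_one_of_pos (by positivity)).trans ?_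
  rw [div_sub_one hv0.ne']
  have := norm_sub_norm_le u v
  calc (‖u‖ - ‖v‖) / ‖v‖ ≤ ‖u - v‖ / ‖v‖ := by gcongr
    _ ≤ _ := by gcongr

lemma G_lipschitz (G : ℂ → ℂ) (hG : Differentiable ℂ G) (m : ℝ) (hm : 0 < m)
    (hM : ∀ s ∈ Metric.closedBall (0 : ℂ) (17 / 10), ‖G s‖ ≤ Real.exp m)
    (hne : ∀ s ∈ Metric.closedBall (0 : ℂ) (17 / 10), G s ≠ 0) (h0 : Real.exp (-m) ≤ ‖G 0‖)
    {s s1 : ℂ} (hs : ‖s‖ ≤ 8 / 5) (hs1 : ‖s1‖ ≤ 8 / 5) :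
    Real.log ‖G s1‖ - Real.log ‖G s‖ ≤ 4000 * m * ‖s1 - s‖ := by
  obtain ⟨H, hH, hexp⟩ := holo_log (U := Metric.ball (0 : ℂ) (17 / 10)) Metric.isOpen_ball
    (convex_ball _ _) ⟨0, by simp⟩ hG.differentiableOn
    (fun s hs => hne s (Metric.ball_subset_closedBall hs))
  have hlog : ∀ s, ‖s‖ < 17 / 10 → Real.log ‖G s‖ = (H s).re := by
    intro s hs
    rw [← hexp s (by simpa using hs), Complex.norm_exp, Real.log_exp]
  have hre : ∀ s, ‖s‖ < 17 / 10 → (H s).re ≤ m := by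
    intro s hs
    rw [← hlog s hs]
    have h1 : s ∈ Metric.closedBall (0 : ℂ) (17 / 10) := by simpa using hs.le
    rw [Real.log_le_iff_le_exp (norm_pos_iff.2 (hne s h1))]
    exact hM s h1
  have hre0 : -m ≤ (H 0).re := by
    rw [← hlog 0 (by simp), Real.le_log_iff_exp_le]
    · exact h0
    · exact (Real.exp_pos _).trans_le h0
  set K : ℂ → ℂ := fun z => H z - H 0 with hK
  have hKd : DifferentiableOn ℂ K (Metric.ball 0 (17 / 10)) := hH.sub_const _
  have hKb : ∀ z, ‖z‖ ≤ 165 / 100 → ‖K z‖ ≤ 132 * m := by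
    intro z hz
    have h1 := Complex.borelCaratheodory_zero (f := K) (M := 2 * m) (R := 17 / 10) (z := z)
      (by linarith) hKd ?_ (by norm_num) (by simp; linarith) (by simp [hK])
    · refine h1.trans ?_
      rw [div_le_iff₀ (by linarith)]
      nlinarith [norm_nonneg z]
    · intro w hw
      have := hre w (by simpa using hw)
      simp only [hK, Set.mem_ofPred_eq, Complex.sub_re]
      linarith
  have hder : ∀ z ∈ Metric.closedBall (0 : ℂ) (8 / 5), ‖deriv K z‖ ≤ 4000 * m := by
    intro z hz
    have hz' : ‖z‖ ≤ 8 / 5 := by simpa using hz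
    have h1 := Complex.norm_deriv_le_of_forall_mem_sphere_norm_le (f := K) (c := z)
      (R := 4 / 100) (C := 132 * m) (by norm_num) ?_ ?_
    · refine h1.trans ?_
      rw [div_le_iff₀ (by norm_num)]; linarith
    · refine (hKd.mono ?_).diffContOnCl
      rw [closure_ball _ (by norm_num)]
      intro w hw
      rw [mem_closedBall_iff_norm] at hw
      rw [mem_ball_zero_iff]
      have := norm_sub_norm_le w z
      linarith
    · intro w hw
      apply hKb
      rw [mem_sphere_iff_norm] at hw
      have := norm_sub_norm_le w z
      linarith
  have hlip := (convex_closedBall (0 : ℂ) (8 / 5)).norm_image_sub_le_of_norm_deriv_le (f := K)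
    (C := 4000 * m) (x := s) (y := s1) ?_ hder (by simpa using hs) (by simpa using hs1)
  · rw [hlog s (by linarith), hlog s1 (by linarith)]
    refine le_trans ?_ hlip
    refine le_trans (le_of_eq ?_) (Complex.re_le_norm _)
    simp [hK]
  · intro z hz
    have hz' : ‖z‖ ≤ 8 / 5 := by simpa using hz
    exact hKd.differentiableAt (Metric.isOpen_ball.mem_nhds (by simp; linarith))

lemma local_factor (f : ℂ → ℂ) (hf : Differentiable ℂ f) (m : ℝ) (hm : 1 ≤ m)
    (hM : ∀ s ∈ Metric.closedBall (0 : ℂ) (19 / 10), ‖f s‖ ≤ Real.exp m)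
    (h0 : Real.exp (-m) ≤ ‖f 0‖) :
    ∃ l : List ℂ, (∀ ρ ∈ l, ‖ρ‖ ≤ 17 / 10 ∧ f ρ = 0) ∧ (l.length : ℝ) ≤ 21 * m ∧
      ∀ s s1 : ℂ, ‖s‖ ≤ 8 / 5 → ‖s1‖ ≤ 8 / 5 → f s ≠ 0 → f s1 ≠ 0 →
        Real.log ‖f s1‖ - Real.log ‖f s‖ ≤
          (l.map fun ρ => Real.log ‖s1 - ρ‖ - Real.log ‖s - ρ‖).sum + 4042 * m * ‖s1 - s‖ := by
  have hf0 : 0 < ‖f 0‖ := (Real.exp_pos _).trans_le h0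
  obtain ⟨l, G, hGd, hl, hlen, hGM, hGne, hG0, hprod⟩ :=
    blaschke_induct (19 / 10) (17 / 10) (Real.exp m) (by norm_num) (by norm_num) (⌈19 * m⌉₊ + 1) f hf hM
      (norm_pos_iff.1 hf0) (by
        have h1 : Real.exp (2 / 19) ≤ 19 / 10 / (17 / 10 : ℝ) := by
          have := Real.one_sub_inv_le_log_of_pos (x := (19 / 17 : ℝ)) (by norm_num)
          have h2 := Real.exp_le_exp.2 this
          rw [Real.exp_log (by norm_num)] at h2
          norm_num at h2 ⊢
          exact h2
        have h2 : Real.exp (2 * m) < (19 / 10 / (17 / 10 : ℝ)) ^ (⌈19 * m⌉₊ + 1) := by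
          calc Real.exp (2 * m) < Real.exp ((⌈19 * m⌉₊ + 1 : ℕ) * (2 / 19)) := by
                rw [Real.exp_lt_exp]
                have := Nat.le_ceil (19 * m)
                push_cast
                linarith
            _ = Real.exp (2 / 19) ^ (⌈19 * m⌉₊ + 1) := by rw [Real.exp_nat_mul]
            _ ≤ _ := by gcongr
        calc Real.exp m = Real.exp (-m) * Real.exp (2 * m) := by rw [← Real.exp_add]; ring_nf
          _ < _ := by
            refine mul_lt_mul' h0 h2 (Real.exp_pos _).le hf0)
  have hlen' : (l.length : ℝ) ≤ 21 * m := by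
    have h1 : (l.length : ℝ) ≤ (⌈19 * m⌉₊ : ℝ) + 1 := by exact_mod_cast hlen
    have := Nat.ceil_lt_add_one (a := 19 * m) (by linarith)
    linarith
  refine ⟨l, hl, hlen', ?_⟩
  have hu : ∀ s : ℂ, ‖s‖ ≤ 8 / 5 → ∀ ρ ∈ l, 89 / 100 ≤ ‖((19 / 10 : ℝ) : ℂ) ^ 2 - (starRingEnd ℂ) ρ * s‖ := by
    intro s hs ρ hρ
    have h1 := (hl ρ hρ).1
    have h2 := norm_sub_norm_le (((19 / 10 : ℝ) : ℂ) ^ 2) ((starRingEnd ℂ) ρ * s)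
    have h3 : ‖(((19 / 10 : ℝ) : ℂ) ^ 2)‖ = 361 / 100 := by
      rw [norm_pow, Complex.norm_real]; norm_num
    rw [h3, norm_mul, Complex.norm_conj] at h2
    have h4 : ‖ρ‖ * ‖s‖ ≤ 17 / 10 * (8 / 5) := by gcongr
    linarith
  have key : ∀ s : ℂ, ‖s‖ ≤ 8 / 5 → f s ≠ 0 → Real.log ‖f s‖ =
      Real.log ‖G s‖ + (l.map fun ρ => Real.log ‖((19 / 10 : ℝ) : ℂ) * (s - ρ)‖).sum -
      (l.map fun ρ => Real.log ‖((19 / 10 : ℝ) : ℂ) ^ 2 - (starRingEnd ℂ) ρ * s‖).sum := by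
    intro s hs hfs
    have hne : ∀ ρ ∈ l, s - ρ ≠ 0 := by
      intro ρ hρ h
      rw [sub_eq_zero] at h
      exact hfs (h ▸ (hl ρ hρ).2)
    have hne1 : ∀ ρ ∈ l, ((19 / 10 : ℝ) : ℂ) * (s - ρ) ≠ 0 := fun ρ hρ =>
      mul_ne_zero (by norm_num) (hne ρ hρ)
    have hne2 : ∀ ρ ∈ l, ((19 / 10 : ℝ) : ℂ) ^ 2 - (starRingEnd ℂ) ρ * s ≠ 0 := by
      intro ρ hρ
      rw [← norm_pos_iff]
      linarith [hu s hs ρ hρ]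
    rw [← log_prod_list l (fun ρ => ((19 / 10 : ℝ) : ℂ) * (s - ρ)) hne1,
      ← log_prod_list l (fun ρ => ((19 / 10 : ℝ) : ℂ) ^ 2 - (starRingEnd ℂ) ρ * s) hne2]
    have h1 := congrArg (fun z => Real.log ‖z‖) (hprod s)
    simp only [norm_mul] at h1
    have hp1 : ‖(l.map fun ρ => ((19 / 10 : ℝ) : ℂ) ^ 2 - (starRingEnd ℂ) ρ * s).prod‖ ≠ 0 := by
      rw [norm_ne_zero_iff]
      refine List.prod_ne_zero ?_
      simp only [List.mem_map, not_exists, not_and]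
      exact hne2
    have hp2 : ‖(l.map fun ρ => ((19 / 10 : ℝ) : ℂ) * (s - ρ)).prod‖ ≠ 0 := by
      rw [norm_ne_zero_iff]
      refine List.prod_ne_zero ?_
      simp only [List.mem_map, not_exists, not_and]
      exact hne1
    have hGs : ‖G s‖ ≠ 0 := by
      rw [norm_ne_zero_iff]
      exact hGne s (by simp; linarith)
    rw [Real.log_mul (norm_ne_zero_iff.2 hfs) hp1, Real.log_mul hGs hp2] at h1
    linarith
  intro s s1 hs hs1 hfs hfs1
  rw [key s hs hfs, key s1 hs1 hfs1]
  have hG := G_lipschitz G hGd m (by linarith)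
    (fun s hs => hGM s (Metric.closedBall_subset_closedBall (by norm_num) hs)) hGne (h0.trans hG0) hs hs1
  have hsplit : ∀ s : ℂ, f s ≠ 0 → (l.map fun ρ => Real.log ‖((19 / 10 : ℝ) : ℂ) * (s - ρ)‖).sum =
      (l.map fun _ => Real.log (19 / 10)).sum + (l.map fun ρ => Real.log ‖s - ρ‖).sum := by
    intro s hfs
    rw [← List.sum_map_add]
    congr 1
    refine List.map_congr_left ?_
    intro ρ hρ
    have : s - ρ ≠ 0 := by
      intro h
      rw [sub_eq_zero] at h
      exact hfs (h ▸ (hl ρ hρ).2)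
    rw [norm_mul, Real.log_mul (by simp) (norm_ne_zero_iff.2 this), Complex.norm_real]
    norm_num
  rw [hsplit s hfs, hsplit s1 hfs1]
  have hsub : (l.map fun ρ => Real.log ‖s1 - ρ‖ - Real.log ‖s - ρ‖).sum =
      (l.map fun ρ => Real.log ‖s1 - ρ‖).sum - (l.map fun ρ => Real.log ‖s - ρ‖).sum := by
    rw [eq_sub_iff_add_eq, ← List.sum_map_add]
    simp
  have hB : (l.map fun ρ => Real.log ‖((19 / 10 : ℝ) : ℂ) ^ 2 - (starRingEnd ℂ) ρ * s‖).sum ≤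
      (l.map fun ρ => Real.log ‖((19 / 10 : ℝ) : ℂ) ^ 2 - (starRingEnd ℂ) ρ * s1‖).sum +
        42 * m * ‖s1 - s‖ := by
    have h1 : (l.map fun ρ => Real.log ‖((19 / 10 : ℝ) : ℂ) ^ 2 - (starRingEnd ℂ) ρ * s‖).sum ≤
      (l.map fun ρ => Real.log ‖((19 / 10 : ℝ) : ℂ) ^ 2 - (starRingEnd ℂ) ρ * s1‖ + 2 * ‖s1 - s‖).sum := by
      refine List.sum_le_sum ?_
      intro ρ hρ
      have h2 := hu s hs ρ hρ
      have h3 := hu s1 hs1 ρ hρ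
      have h4 := log_norm_sub_le (by norm_num) h3 (u := ((19 / 10 : ℝ) : ℂ) ^ 2 - (starRingEnd ℂ) ρ * s)
        (norm_pos_iff.1 (by linarith))
      have h5 : ‖((19 / 10 : ℝ) : ℂ) ^ 2 - (starRingEnd ℂ) ρ * s -
          (((19 / 10 : ℝ) : ℂ) ^ 2 - (starRingEnd ℂ) ρ * s1)‖ = ‖ρ‖ * ‖s1 - s‖ := by
        rw [show ((19 / 10 : ℝ) : ℂ) ^ 2 - (starRingEnd ℂ) ρ * s -
          (((19 / 10 : ℝ) : ℂ) ^ 2 - (starRingEnd ℂ) ρ * s1) = (starRingEnd ℂ) ρ * (s1 - s) by ring,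
          norm_mul, Complex.norm_conj]
      rw [h5] at h4
      have h6 : ‖ρ‖ * ‖s1 - s‖ / (89 / 100) ≤ 2 * ‖s1 - s‖ := by
        rw [div_le_iff₀ (by norm_num)]
        nlinarith [(hl ρ hρ).1, norm_nonneg (s1 - s)]
      linarith
    rw [List.sum_map_add] at h1
    simp only [List.map_const', List.sum_replicate, nsmul_eq_mul] at h1
    nlinarith [norm_nonneg (s1 - s)]
  rw [hsub]
  linarith


/-! ## Contour shift -/

lemma vert_shift (g : ℂ → ℂ) (a b : ℝ) (hab : a ≤ b)
    (hd : DifferentiableOn ℂ g {w | a ≤ w.re ∧ w.re ≤ b}) (h : ℝ → ℝ)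
    (hh : Filter.Tendsto h Filter.atTop (nhds 0))
    (hb : ∀ x y : ℝ, a ≤ x → x ≤ b → 1 ≤ |y| → ‖g (x + y * I)‖ ≤ h |y|)
    (hia : MeasureTheory.Integrable fun y : ℝ => g (a + y * I))
    (hib : MeasureTheory.Integrable fun y : ℝ => g (b + y * I)) :
    ∫ y : ℝ, g (a + y * I) = ∫ y : ℝ, g (b + y * I) := by
  have h1 := MeasureTheory.intervalIntegral_tendsto_integral hia Filter.tendsto_neg_atTop_atBot
    Filter.tendsto_id
  have h2 := MeasureTheory.intervalIntegral_tendsto_integral hib Filter.tendsto_neg_atTop_atBot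
    Filter.tendsto_id
  have h3 := h1.sub h2
  suffices hz : Filter.Tendsto (fun T : ℝ => (∫ y in (-T)..(id T), g (a + y * I)) -
      ∫ y in (-T)..(id T), g (b + y * I)) Filter.atTop (nhds 0) from
    sub_eq_zero.1 (tendsto_nhds_unique h3 hz)
  have hlim : Filter.Tendsto (fun T => 2 * (b - a) * h T) Filter.atTop (nhds 0) := by
    simpa using hh.const_mul (2 * (b - a))
  refine squeeze_zero_norm' ?_ hlim
  filter_upwards [Filter.eventually_ge_atTop 1] with T hT
  have hc := Complex.integral_boundary_rect_eq_zero_of_differentiableOn g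
    (a + (-T : ℝ) * I) (b + (T : ℝ) * I) (hd.mono (by
      intro w hw
      rw [Complex.mem_reProdIm] at hw
      simp [Set.uIcc_of_le hab] at hw
      exact hw.1))
  simp only [add_re, ofReal_re, mul_re, I_re, mul_zero, ofReal_im, I_im, mul_one, add_zero,
    add_im, mul_im, zero_add, sub_self, smul_eq_mul] at hc
  have hn : ∀ y : ℝ, |y| = T → ‖∫ x in a..b, g (x + y * I)‖ ≤ h T * (b - a) := by
    intro y hy
    have := intervalIntegral.norm_integral_le_of_norm_le_const (a := a) (b := b) (C := h T)
      (f := fun x : ℝ => g (x + y * I)) (by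
        intro x hx
        rw [Set.uIoc_of_le hab] at hx
        rw [← hy]
        exact hb x y hx.1.le hx.2 (hy ▸ hT))
    rwa [abs_of_nonneg (by linarith)] at this
  have n1 := hn (-T) (by rw [abs_neg, abs_of_nonneg (by linarith)])
  have n2 := hn T (by rw [abs_of_nonneg (by linarith)])
  simp only [id]
  set A := ∫ x in a..b, g (x + (-T : ℝ) * I)
  set B := ∫ x in a..b, g (x + (T : ℝ) * I)
  set D := ∫ y in (-T)..T, g (a + y * I)
  set E := ∫ y in (-T)..T, g (b + y * I)
  have : I * (D - E) = A - B := by linear_combination -hc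
  calc ‖D - E‖ = ‖I * (D - E)‖ := by simp
    _ = ‖A - B‖ := by rw [this]
    _ ≤ ‖A‖ + ‖B‖ := norm_sub_le _ _
    _ ≤ 2 * (b - a) * h T := by linarith

/-! ## The kernel -/

noncomputable def csinc : ℂ → ℂ := dslope Complex.sin 0

lemma csinc_differentiable : Differentiable ℂ csinc := by
  intro z
  have h1 : DifferentiableOn ℂ (dslope Complex.sin 0) Set.univ :=
    (Complex.differentiableOn_dslope Filter.univ_mem).2 Complex.differentiable_sin.differentiableOn
  exact (h1 z (Set.mem_univ z)).differentiableAt Filter.univ_mem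

lemma csinc_of_ne {w : ℂ} (hw : w ≠ 0) : csinc w = Complex.sin w / w := by
  unfold csinc
  rw [dslope_of_ne _ hw, slope_def_field]
  simp

lemma csinc_real (u : ℝ) : csinc u = (Real.sinc u : ℝ) := by
  by_cases hu : u = 0
  · subst hu
    unfold csinc
    simp
  · rw [csinc_of_ne (by exact_mod_cast hu), Real.sinc_of_ne_zero hu]
    push_cast; rfl

lemma csinc_norm_le {w : ℂ} (hw : w ≠ 0) : ‖csinc w‖ ≤ Real.exp |w.im| / ‖w‖ := by
  rw [csinc_of_ne hw, norm_div]
  gcongr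
  have h2 : ‖Complex.sin w‖ ≤ (‖cexp (-w * I)‖ + ‖cexp (w * I)‖) / 2 := by
    rw [Complex.sin]
    simp only [norm_div, norm_mul, norm_I, mul_one]
    rw [Complex.norm_ofNat]
    gcongr
    exact norm_sub_le _ _
  refine h2.trans ?_
  rw [Complex.norm_exp, Complex.norm_exp]
  have e1 : (-w * I).re = w.im := by simp
  have e2 : (w * I).re = -w.im := by simp
  rw [e1, e2]
  have := Real.exp_le_exp.2 (le_abs_self w.im)
  have := Real.exp_le_exp.2 (neg_le_abs w.im)
  linarith

lemma sinc6_le (u : ℝ) : Real.sinc u ^ 6 ≤ 8 / (1 + u ^ 2) ^ 3 := by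
  rw [le_div_iff₀ (by positivity)]
  have h1 : Real.sinc u ^ 2 * (1 + u ^ 2) ≤ 2 := by
    have a1 : Real.sinc u ^ 2 ≤ 1 := by
      rw [sq_le_one_iff_abs_le_one]; exact Real.abs_sinc_le_one u
    have a2 : Real.sinc u ^ 2 * u ^ 2 ≤ 1 := by
      by_cases hu : u = 0
      · simp [hu]
      · rw [Real.sinc_of_ne_zero hu, div_pow, div_mul_cancel₀ _ (by positivity)]
        exact Real.sin_sq_le_one u
    linarith
  calc Real.sinc u ^ 6 * (1 + u ^ 2) ^ 3 = (Real.sinc u ^ 2 * (1 + u ^ 2)) ^ 3 := by ring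
    _ ≤ 2 ^ 3 := by gcongr
    _ = 8 := by norm_num

lemma inv_cube_le (u : ℝ) : 8 / (1 + u ^ 2) ^ 3 ≤ 8 * (1 + u ^ 2)⁻¹ := by
  rw [div_le_iff₀ (by positivity)]
  have : 1 ≤ 1 + u ^ 2 := by nlinarith
  have h2 : (1 + u^2)⁻¹ * (1 + u^2)^3 = (1+u^2)^2 := by field_simp
  nlinarith

lemma sinc6_integrable : MeasureTheory.Integrable fun u : ℝ => Real.sinc u ^ 6 := by
  refine MeasureTheory.Integrable.mono' (integrable_inv_one_add_sq.const_mul 8) ?_ ?_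
  · exact (Real.continuous_sinc.pow 6).aestronglyMeasurable
  · refine Filter.Eventually.of_forall fun u => ?_
    rw [Real.norm_of_nonneg (by positivity)]
    exact (sinc6_le u).trans (inv_cube_le u)

noncomputable def κ0 : ℝ := (∫ u : ℝ, Real.sinc u ^ 6)⁻¹

lemma sinc6_pos : 0 < ∫ u : ℝ, Real.sinc u ^ 6 := by
  rw [MeasureTheory.integral_pos_iff_support_of_nonneg (fun u => by positivity) sinc6_integrable]
  refine IsOpen.measure_pos _ ?_ ⟨0, by simp⟩
  exact (Real.continuous_sinc.pow 6).isOpen_support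

lemma κ0_pos : 0 < κ0 := inv_pos.2 sinc6_pos

noncomputable def KS (u : ℝ) : ℝ := κ0 * Real.sinc u ^ 6

lemma KS_nonneg (u : ℝ) : 0 ≤ KS u := by
  have := κ0_pos
  unfold KS; positivity

lemma KS_cont : Continuous KS := continuous_const.mul (Real.continuous_sinc.pow 6)

lemma KS_neg (u : ℝ) : KS (-u) = KS u := by simp [KS]

lemma KS_integrable : MeasureTheory.Integrable KS := sinc6_integrable.const_mul _

lemma KS_integral : ∫ u, KS u = 1 := by
  unfold KS
  rw [MeasureTheory.integral_const_mul, κ0, inv_mul_cancel₀ sinc6_pos.ne']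

lemma KS_le (u : ℝ) : KS u * (1 + u ^ 2) ^ 2 ≤ 8 * κ0 * (1 + u ^ 2)⁻¹ := by
  have h1 := sinc6_le u
  have := κ0_pos
  unfold KS
  calc κ0 * Real.sinc u ^ 6 * (1 + u ^ 2) ^ 2 ≤ κ0 * (8 / (1 + u ^ 2) ^ 3) * (1 + u ^ 2) ^ 2 := by gcongr
    _ = _ := by field_simp

lemma KS4_integrable : MeasureTheory.Integrable fun u : ℝ => KS u * (1 + u ^ 2) ^ 2 := by
  refine MeasureTheory.Integrable.mono' (integrable_inv_one_add_sq.const_mul (8 * κ0)) ?_ ?_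
  · exact (KS_cont.mul (by fun_prop)).aestronglyMeasurable
  · refine Filter.Eventually.of_forall fun u => ?_
    rw [Real.norm_of_nonneg (mul_nonneg (KS_nonneg u) (by positivity))]
    exact KS_le u

noncomputable def M4 : ℝ := ∫ u : ℝ, KS u * (1 + u ^ 2) ^ 2

lemma M4_ge : 1 ≤ M4 := by
  rw [← KS_integral]
  refine MeasureTheory.integral_mono KS_integrable KS4_integrable fun u => ?_
  have := KS_nonneg u
  have h1 : 1 ≤ (1 + u ^ 2) ^ 2 := by nlinarith [sq_nonneg u]
  show KS u ≤ KS u * (1 + u ^ 2) ^ 2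
  nlinarith

/-- domination by the weight `(1+u²)²` -/
lemma KS_mul_integrable {E : Type*} [NormedAddCommGroup E] [NormedSpace ℝ E] {g : ℝ → E} {B : ℝ}
    (hg : MeasureTheory.AEStronglyMeasurable g) (hb : ∀ u, ‖g u‖ ≤ B * (1 + u ^ 2) ^ 2) :
    MeasureTheory.Integrable fun u => KS u • g u := by
  refine MeasureTheory.Integrable.mono' (KS4_integrable.const_mul B) ?_ ?_
  · exact KS_cont.aestronglyMeasurable.smul hg
  · refine Filter.Eventually.of_forall fun u => ?_
    rw [norm_smul, Real.norm_of_nonneg (KS_nonneg u)]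
    calc KS u * ‖g u‖ ≤ KS u * (B * (1 + u ^ 2) ^ 2) := by
          gcongr
          · exact KS_nonneg u
          · exact hb u
      _ = _ := by ring

/-! ## The smoothed Dirichlet polynomial identity -/

noncomputable def PX {q : ℕ} (χ : DirichletCharacter ℂ q) (X : ℕ) (s : ℂ) : ℂ :=
  ∑ n ∈ Icc 1 X, cχ χ n * (n : ℂ) ^ (-s)

lemma PX_diff {q : ℕ} (χ : DirichletCharacter ℂ q) (X : ℕ) : Differentiable ℂ (PX χ X) := by
  unfold PX
  refine Differentiable.fun_sum fun n hn => ?_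
  have hn0 : (n : ℂ) ≠ 0 := by
    simp only [Finset.mem_Icc] at hn
    exact_mod_cast (show n ≠ 0 by omega)
  refine (differentiable_const _).mul ?_
  intro s
  exact (differentiableAt_id.neg).const_cpow (Or.inl hn0)

lemma PX_bound {q : ℕ} (χ : DirichletCharacter ℂ q) (X : ℕ) {s : ℂ} (hs : 0 ≤ s.re) :
    ‖PX χ X s‖ ≤ X := by
  unfold PX
  calc _ ≤ ∑ n ∈ Icc 1 X, ‖cχ χ n * (n : ℂ) ^ (-s)‖ := norm_sum_le _ _
    _ ≤ ∑ n ∈ Icc 1 X, (1 : ℝ) := by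
      refine Finset.sum_le_sum fun n hn => ?_
      simp only [Finset.mem_Icc] at hn
      rw [norm_mul, Complex.norm_natCast_cpow_of_pos (by omega)]
      have h1 : (1 : ℝ) ≤ n := by exact_mod_cast hn.1
      have h2 : (n : ℝ) ^ (-s).re ≤ 1 := Real.rpow_le_one_of_one_le_of_nonpos h1 (by simpa using hs)
      have h3 := cχ_norm_le χ n
      calc _ ≤ (1 : ℝ) * 1 := by gcongr
        _ = 1 := one_mul 1
    _ = X := by simp

lemma tail_term {q : ℕ} (χ : DirichletCharacter ℂ q) (X N : ℕ) (hN : X + 1 ≤ N) {s : ℂ} (hs : 2 ≤ s.re) :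
    ‖LSeries.term (cχ χ) s N‖ ≤ ((N : ℝ) ^ 2)⁻¹ * (X + 1 : ℝ) ^ (2 - s.re) := by
  have hX : (0 : ℝ) < X + 1 := by positivity
  have hn : N ≠ 0 := by omega
  have hnr : (X + 1 : ℝ) ≤ N := by exact_mod_cast hN
  have hpos : (0 : ℝ) < N := hX.trans_le hnr
  rw [LSeries.term_of_ne_zero hn, norm_div, Complex.norm_natCast_cpow_of_pos (Nat.pos_of_ne_zero hn)]
  have h1 : ‖cχ χ N‖ / (N : ℝ) ^ s.re ≤ 1 / (N : ℝ) ^ s.re :=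
    div_le_div_of_nonneg_right (cχ_norm_le χ _) (by positivity)
  have h2 : 1 / (N : ℝ) ^ s.re = ((N : ℝ) ^ 2)⁻¹ * (N : ℝ) ^ (2 - s.re) := by
    rw [Real.rpow_sub hpos, Real.rpow_ofNat]
    field_simp
  rw [h2] at h1
  exact h1.trans (mul_le_mul_of_nonneg_left
          (Real.rpow_le_rpow_of_nonpos hX hnr (by linarith)) (by positivity))

lemma PX_eq {q : ℕ} (χ : DirichletCharacter ℂ q) (X : ℕ) (s : ℂ) :
    PX χ X s = ∑ n ∈ range (X + 1), LSeries.term (cχ χ) s n := by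
  unfold PX
  induction X with
  | zero => simp
  | succ X ih =>
    rw [Finset.sum_Icc_succ_top (by omega), Finset.sum_range_succ, ih,
      LSeries.term_of_ne_zero (by omega), Complex.cpow_neg, div_eq_mul_inv]

lemma tail_bound {q : ℕ} (χ : DirichletCharacter ℂ q) (X : ℕ) {s : ℂ} (hs : 2 ≤ s.re) :
    ‖LSeries (cχ χ) s - PX χ X s‖ ≤ B2 * (X + 1 : ℝ) ^ (2 - s.re) := by
  have hsum := cχ_summable χ (s := s) (by linarith)
  have h1 : PX χ X s = ∑ n ∈ range (X + 1), LSeries.term (cχ χ) s n := by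
    exact PX_eq χ X s
  have hX : (0 : ℝ) < X + 1 := by positivity
  have hle : ∀ n : ℕ, ‖LSeries.term (cχ χ) s (n + (X + 1))‖ ≤
      (((n + (X + 1) : ℕ) : ℝ) ^ 2)⁻¹ * (X + 1 : ℝ) ^ (2 - s.re) :=
    fun n => tail_term χ X (n + (X + 1)) (by omega) hs
  have hs1 : Summable fun n : ℕ => (((n + (X + 1) : ℕ) : ℝ) ^ 2)⁻¹ :=
    (summable_nat_add_iff (f := fun n : ℕ => ((n : ℝ) ^ 2)⁻¹) (X + 1)).2 B2_summable
  have hfin : ‖∑' n : ℕ, LSeries.term (cχ χ) s (n + (X + 1))‖ ≤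
      (∑' n : ℕ, (((n + (X + 1) : ℕ) : ℝ) ^ 2)⁻¹) * (X + 1 : ℝ) ^ (2 - s.re) := by
    rw [← tsum_mul_right]
    exact tsum_of_norm_bounded (hs1.mul_right _).hasSum hle
  have hB : (∑' n : ℕ, (((n + (X + 1) : ℕ) : ℝ) ^ 2)⁻¹) ≤ B2 := by
    have h3 := B2_summable.sum_add_tsum_nat_add (X + 1)
    have h4 : 0 ≤ ∑ i ∈ range (X + 1), ((i : ℝ) ^ 2)⁻¹ := Finset.sum_nonneg fun i _ => by positivity
    have h6 : B2 = ∑ i ∈ range (X + 1), ((i : ℝ) ^ 2)⁻¹ + ∑' n : ℕ, (((n + (X + 1) : ℕ) : ℝ) ^ 2)⁻¹ := h3.symm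
    rw [h6]
    exact le_add_of_nonneg_left h4
  have h5 : LSeries (cχ χ) s - PX χ X s = ∑' n : ℕ, LSeries.term (cχ χ) s (n + (X + 1)) := by
    have h2 := hsum.sum_add_tsum_nat_add (X + 1)
    rw [← h1] at h2
    rw [LSeries, ← h2, add_sub_cancel_left]
  rw [h5]
  exact hfin.trans (mul_le_mul_of_nonneg_right hB (by positivity))


lemma LQ_shift {q : ℕ} [NeZero q] (t v : ℝ) : LQ q (t + v) ≤ LQ q t * (1 + |v|) := by
  have h1 := LQ_ge (q := q) t
  have hq : (1 : ℝ) ≤ q := by exact_mod_cast Nat.one_le_iff_ne_zero.2 (NeZero.ne q)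
  have h2 : LQ q (t + v) ≤ LQ q t + |v| := by
    have h3 : Real.log (1 + |v|) ≤ |v| := by
      have := Real.log_le_sub_one_of_pos (x := 1 + |v|) (by positivity)
      linarith
    have h4 : LQ q (t + v) ≤ LQ q t + Real.log (1 + |v|) := by
      unfold LQ
      rw [← Real.log_mul (by positivity) (by positivity)]
      apply Real.log_le_log (by positivity)
      rw [mul_assoc]
      gcongr
      have := abs_add_le t v
      nlinarith [abs_nonneg t, abs_nonneg v]
    linarith
  nlinarith [abs_nonneg v]

lemma smooth_zero (G : ℂ → ℂ) (ℓ a C1 C2 t : ℝ) (X : ℕ) (hℓ : 1 ≤ ℓ) (ha : 0 < a) (hX : Real.exp (6 * ℓ) ≤ X + 1)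
    (hG : DifferentiableOn ℂ G {z : ℂ | 1 / 2 < z.re}) (hC1 : 0 ≤ C1) (hC2 : 0 ≤ C2)
    (hb : ∀ s : ℂ, 1 / 2 + a ≤ s.re → ‖G s‖ ≤ C1 * (1 + |s.im - t|))
    (hb2 : ∀ s : ℂ, 2 ≤ s.re → ‖G s‖ ≤ C2 * (X + 1 : ℝ) ^ (2 - s.re)) :
    (MeasureTheory.Integrable fun u : ℝ => KS u • G (1 / 2 + a + (t + u / ℓ) * I)) ∧
    ∫ u : ℝ, KS u • G (1 / 2 + a + (t + u / ℓ) * I) = 0 := by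
  set s0 : ℂ := 1 / 2 + a + t * I with hs0
  have hℓ0 : (0 : ℝ) < ℓ := by linarith
  have hX1 : (1 : ℝ) ≤ X + 1 := by linarith [(Nat.cast_nonneg X : (0 : ℝ) ≤ X)]
  set g : ℂ → ℂ := fun w => κ0 * csinc (-I * w) ^ 6 * G (s0 + w / ℓ) with hg
  have hre : ∀ w : ℂ, (s0 + w / ℓ).re = 1 / 2 + a + w.re / ℓ := by
    intro w; simp [hs0]
  have him : ∀ w : ℂ, (s0 + w / ℓ).im - t = w.im / ℓ := by
    intro w; simp [hs0]
  have hgd : DifferentiableOn ℂ g {w : ℂ | 0 ≤ w.re} := by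
    refine DifferentiableOn.mul ?_ ?_
    · refine Differentiable.differentiableOn ?_
      refine (differentiable_const _).mul (Differentiable.pow ?_ 6)
      exact csinc_differentiable.comp (differentiable_id.const_mul _)
    · refine hG.comp (by fun_prop) ?_
      intro w hw
      have hw' : 0 ≤ w.re := hw
      show 1 / 2 < (s0 + w / ℓ).re
      rw [hre]
      have : 0 ≤ w.re / ℓ := by positivity
      linarith
  have hGb : ∀ w : ℂ, 0 ≤ w.re → ‖G (s0 + w / ℓ)‖ ≤ C1 * (1 + |w.im|) := by
    intro w hw
    refine (hb _ ?_).trans ?_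
    · rw [hre]
      have : 0 ≤ w.re / ℓ := by positivity
      linarith
    · rw [him, abs_div, abs_of_pos hℓ0]
      gcongr
      exact div_le_self (abs_nonneg _) hℓ
  have hκ := κ0_pos
  have hg_line : ∀ y : ℝ, g ((0 : ℝ) + y * I) = KS y • G (1 / 2 + a + (t + y / ℓ) * I) := by
    intro y
    have e1 : -I * ((0 : ℝ) + y * I) = y := by
      rw [Complex.ofReal_zero, zero_add]
      linear_combination -(y : ℂ) * I_mul_I
    have e2 : s0 + ((0 : ℝ) + y * I) / ℓ = 1 / 2 + a + (t + y / ℓ) * I := by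
      rw [hs0, Complex.ofReal_zero]; ring
    simp only [hg]
    rw [e1, e2, csinc_real, KS, Complex.real_smul]
    push_cast
    ring
  have hcs : ∀ x y : ℝ, 0 ≤ x → (x + y * I : ℂ) ≠ 0 →
      ‖csinc (-I * (x + y * I))‖ ≤ Real.exp x / ‖(x + y * I : ℂ)‖ := by
    intro x y hx hne
    have := csinc_norm_le (w := -I * (x + y * I)) (mul_ne_zero (by simp) hne)
    rw [norm_mul, norm_neg, norm_I, one_mul] at this
    have e : (-I * (x + y * I : ℂ)).im = -x := by simp
    rwa [e, abs_neg, abs_of_nonneg hx] at this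
  have hint0 : MeasureTheory.Integrable fun y : ℝ => g ((0 : ℝ) + y * I) := by
    simp_rw [hg_line]
    refine KS_mul_integrable (B := 2 * C1) ?_ ?_
    · refine Continuous.aestronglyMeasurable ?_
      rw [continuous_iff_continuousAt]
      intro u
      have h1 : ContinuousAt G (1 / 2 + a + (t + u / ℓ) * I) := by
        refine (hG.differentiableAt ?_).continuousAt
        refine (isOpen_lt continuous_const Complex.continuous_re).mem_nhds ?_
        simp [ha]
      refine ContinuousAt.comp (f := fun u : ℝ => (1 / 2 + a + (t + u / ℓ) * I : ℂ)) h1 ?_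
      fun_prop
    · intro u
      have h1 := hGb (u * I) (by simp)
      have e2 : s0 + (u * I) / ℓ = 1 / 2 + a + (t + u / ℓ) * I := by
        rw [hs0]; ring
      rw [e2] at h1
      simp only [mul_im, ofReal_re, I_im, mul_one, ofReal_im, I_re, mul_zero, add_zero] at h1
      refine h1.trans ?_
      have h2 : 1 + |u| ≤ 2 * (1 + u ^ 2) ^ 2 := by
        have : |u| ≤ 1 + u ^ 2 := by nlinarith [sq_abs u, sq_nonneg (|u| - 1)]
        nlinarith [sq_nonneg u]
      nlinarith
  refine ⟨by simpa only [hg_line] using hint0, ?_⟩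
  simp_rw [← hg_line]
  -- bound by shifting
  set C3 : ℝ := κ0 * C2 * (X + 1 : ℝ) ^ 2 with hC3
  have hC3n : 0 ≤ C3 := by positivity
  have hR : ∀ R : ℝ, 2 * ℓ ≤ R → ∀ y : ℝ, ‖g (R + y * I)‖ ≤ C3 / R ^ 2 * (1 + y ^ 2)⁻¹ := by
    intro R hR y
    have hR1 : 1 ≤ R := by linarith
    have hnsq : ‖(R + y * I : ℂ)‖ ^ 2 = R ^ 2 + y ^ 2 := by
      rw [Complex.sq_norm, Complex.normSq_add_mul_I]
    have hne : (R + y * I : ℂ) ≠ 0 := by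
      intro h
      rw [h] at hnsq
      simp at hnsq
      nlinarith [sq_nonneg y]
    have h1 := hcs R y (by linarith) hne
    have hwre : ((R + y * I : ℂ)).re = R := by simp
    have h2 : ‖G (s0 + (R + y * I) / ℓ)‖ ≤ C2 * ((X + 1 : ℝ) ^ 2 * Real.exp (-(6 * R))) := by
      have h5 : 2 ≤ R / ℓ := by rw [le_div_iff₀ hℓ0]; exact hR
      refine (hb2 _ ?_).trans ?_
      · rw [hre, hwre]; linarith
      · rw [hre, hwre]
        gcongr
        calc (X + 1 : ℝ) ^ (2 - (1 / 2 + a + R / ℓ)) ≤ (X + 1 : ℝ) ^ ((2 : ℝ) + -(R / ℓ)) := by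
              apply Real.rpow_le_rpow_of_exponent_le hX1; linarith
          _ = (X + 1 : ℝ) ^ 2 * (X + 1 : ℝ) ^ (-(R / ℓ)) := by
              rw [Real.rpow_add (by linarith), Real.rpow_ofNat]
          _ ≤ _ := by
              refine mul_le_mul_of_nonneg_left ?_ (by positivity)
              calc (X + 1 : ℝ) ^ (-(R / ℓ)) ≤ (Real.exp (6 * ℓ)) ^ (-(R / ℓ)) :=
                    Real.rpow_le_rpow_of_nonpos (Real.exp_pos _) hX (by linarith)
                _ = _ := by
                    rw [← Real.exp_mul]; congr 1; field_simp
    have h3 : ‖csinc (-I * (R + y * I))‖ ^ 6 ≤ Real.exp (6 * R) * (1 / R ^ 2 * (1 + y ^ 2)⁻¹) := by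
      calc ‖csinc (-I * (R + y * I))‖ ^ 6 ≤ (Real.exp R / ‖(R + y * I : ℂ)‖) ^ 6 := by gcongr
        _ = Real.exp (6 * R) * (1 / (‖(R + y * I : ℂ)‖ ^ 2) ^ 3) := by
            rw [div_pow, ← Real.exp_nat_mul]
            push_cast
            ring
        _ ≤ _ := by
            rw [hnsq]
            refine mul_le_mul_of_nonneg_left ?_ (Real.exp_pos _).le
            rw [← div_eq_mul_inv, div_div]
            apply one_div_le_one_div_of_le (by positivity)
            have a1 : 1 ≤ R ^ 2 := by nlinarith
            have a2 : 1 ≤ R ^ 2 + y ^ 2 := by nlinarith [sq_nonneg y]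
            calc R ^ 2 * (1 + y ^ 2) ≤ (R ^ 2 + y ^ 2) * (R ^ 2 + y ^ 2) := by gcongr; nlinarith [sq_nonneg y]
              _ ≤ (R ^ 2 + y ^ 2) ^ 3 := by nlinarith [mul_nonneg (by positivity : 0 ≤ R ^ 2 + y ^ 2) (by positivity : 0 ≤ R ^ 2 + y ^ 2)]
    simp only [hg, norm_mul, norm_pow, Complex.norm_real, Real.norm_of_nonneg hκ.le]
    have h3' : (0 : ℝ) ≤ Real.exp (6 * R) * (1 / R ^ 2 * (1 + y ^ 2)⁻¹) := by positivity
    calc _ ≤ κ0 * (Real.exp (6 * R) * (1 / R ^ 2 * (1 + y ^ 2)⁻¹)) *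
          (C2 * ((X + 1 : ℝ) ^ 2 * Real.exp (-(6 * R)))) := by gcongr
      _ = (Real.exp (6 * R) * Real.exp (-(6 * R))) * (C3 / R ^ 2 * (1 + y ^ 2)⁻¹) := by rw [hC3]; ring
      _ = _ := by rw [← Real.exp_add]; simp
  have hlim : ∀ R : ℝ, 2 * ℓ ≤ R → ‖∫ y : ℝ, g ((0 : ℝ) + y * I)‖ ≤ C3 * π / R := by
    intro R hRℓ
    have hR1 : 1 ≤ R := by linarith
    have hdom : MeasureTheory.Integrable fun y : ℝ => C3 / R ^ 2 * (1 + y ^ 2)⁻¹ :=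
      integrable_inv_one_add_sq.const_mul _
    have hintR : MeasureTheory.Integrable fun y : ℝ => g (R + y * I) := by
      refine hdom.mono' ?_ (Filter.Eventually.of_forall (hR R hRℓ))
      refine Continuous.aestronglyMeasurable ?_
      refine hgd.continuousOn.comp_continuous (by fun_prop) ?_
      intro y
      show 0 ≤ ((R + y * I : ℂ)).re
      simp; linarith
    have := vert_shift g 0 R (by linarith) (hgd.mono fun w hw => hw.1)
      (fun T => κ0 * Real.exp R ^ 6 * (2 * C1) * T⁻¹)
      (by
        have h7 := (tendsto_inv_atTop_zero (𝕜 := ℝ)).const_mul (κ0 * Real.exp R ^ 6 * (2 * C1))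
        rwa [mul_zero] at h7) ?_ hint0 hintR
    · rw [this]
      calc _ ≤ ∫ y : ℝ, C3 / R ^ 2 * (1 + y ^ 2)⁻¹ :=
            MeasureTheory.norm_integral_le_of_norm_le hdom (Filter.Eventually.of_forall (hR R hRℓ))
        _ = C3 / R ^ 2 * π := by rw [MeasureTheory.integral_const_mul, integral_univ_inv_one_add_sq]
        _ ≤ _ := by
            rw [div_mul_eq_mul_div]
            gcongr
            nlinarith
    · intro x y hx0 hxR hy
      have hnorm : |y| ≤ ‖(x + y * I : ℂ)‖ := by
        have := Complex.abs_im_le_norm (x + y * I : ℂ)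
        simpa using this
      have hne : (x + y * I : ℂ) ≠ 0 := by
        rw [← norm_pos_iff]; linarith
      have h1 := hcs x y hx0 hne
      have h2 := hGb (x + y * I) (by simpa using hx0)
      have e : (x + y * I : ℂ).im = y := by simp
      rw [e] at h2
      simp only [hg, norm_mul, norm_pow, Complex.norm_real, Real.norm_of_nonneg hκ.le]
      have hypos : 0 < |y| := by linarith
      have h4 : Real.exp x / ‖(x + y * I : ℂ)‖ ≤ Real.exp R / |y| := by gcongr
      have h5 := h1.trans h4
      calc _ ≤ κ0 * (Real.exp R / |y|) ^ 6 * (C1 * (1 + |y|)) := by gcongr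
        _ ≤ κ0 * (Real.exp R / |y|) ^ 6 * (C1 * (2 * |y|)) := by gcongr; linarith
        _ = κ0 * Real.exp R ^ 6 * (2 * C1) * (|y|⁻¹ ^ 5) := by field_simp
        _ ≤ _ := by
          gcongr
          have : |y|⁻¹ ≤ 1 := inv_le_one_of_one_le₀ hy
          exact pow_le_of_le_one (by positivity) this (by norm_num)
  have hz : ‖∫ y : ℝ, g ((0 : ℝ) + y * I)‖ ≤ 0 := by
    refine ge_of_tendsto (f := fun R : ℝ => C3 * π / R) (x := Filter.atTop) ?_ ?_
    · exact tendsto_const_nhds.div_atTop Filter.tendsto_id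
    · filter_upwards [Filter.eventually_ge_atTop (2 * ℓ)] with R hR using hlim R hR
  simpa using hz


lemma zero_bound (a δ y v : ℝ) (ha : 0 < a) (hδ : 0 < δ) (hδa : δ ≤ a / 2) :
    1 / 2 * Real.log (δ ^ 2 + y ^ 2) - 1 / 2 * Real.log (a ^ 2 + (y + v) ^ 2) ≤
      1 / (2 * (a ^ 2 + y ^ 2)) * (-2 * y * v + (8 * v ^ 2 + 2 * v ^ 4 / a ^ 2 - 3 / 4 * a ^ 2)) := by
  set D := a ^ 2 + y ^ 2 with hD
  set E := a ^ 2 + (y + v) ^ 2 with hE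
  have hDp : 0 < D := by positivity
  have hEp : 0 < E := by positivity
  have hdp : 0 < δ ^ 2 + y ^ 2 := by positivity
  have h1 : 1 - D / E ≤ Real.log E - Real.log D := by
    rw [← Real.log_div hEp.ne' hDp.ne']
    have := Real.one_sub_inv_le_log_of_pos (x := E / D) (by positivity)
    rwa [inv_div] at this
  have h2 : 1 - (δ ^ 2 + y ^ 2) / D ≤ Real.log D - Real.log (δ ^ 2 + y ^ 2) := by
    rw [← Real.log_div hDp.ne' hdp.ne']
    have := Real.one_sub_inv_le_log_of_pos (x := D / (δ ^ 2 + y ^ 2)) (by positivity)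
    rwa [inv_div] at this
  have h3 : 3 / 4 * a ^ 2 / D ≤ 1 - (δ ^ 2 + y ^ 2) / D := by
    rw [one_sub_div hDp.ne']
    gcongr
    nlinarith
  have h4 : (2 * y * v - v ^ 2 * (8 + 2 * v ^ 2 / a ^ 2)) / D ≤ 1 - D / E := by
    have e1 : (2 * y + v) ^ 2 ≤ (8 + 2 * v ^ 2 / a ^ 2) * E := by
      have : 2 * v ^ 2 ≤ 2 * v ^ 2 / a ^ 2 * E := by
        rw [div_mul_eq_mul_div, le_div_iff₀ (by positivity)]
        have : a ^ 2 ≤ E := by rw [hE]; nlinarith [sq_nonneg (y + v)]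
        gcongr
      nlinarith [sq_nonneg (2 * (y + v) + v), sq_nonneg a]
    have e2 : 1 - D / E = (2 * y * v + v ^ 2) / D - v ^ 2 * (2 * y + v) ^ 2 / (D * E) := by
      have : E = D + (2 * y * v + v ^ 2) := by rw [hE, hD]; ring
      rw [one_sub_div hEp.ne', div_sub_div _ _ hDp.ne' (by positivity), div_eq_div_iff hEp.ne' (by positivity)]
      rw [this]; ring
    rw [e2]
    have e3 : v ^ 2 * (2 * y + v) ^ 2 / (D * E) ≤ v ^ 2 * (8 + 2 * v ^ 2 / a ^ 2) / D := by
      rw [div_le_div_iff₀ (by positivity) hDp]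
      have : v ^ 2 * D * (2 * y + v) ^ 2 ≤ v ^ 2 * D * ((8 + 2 * v ^ 2 / a ^ 2) * E) := by gcongr
      nlinarith
    have e4 : (2 * y * v) / D ≤ (2 * y * v + v ^ 2) / D := by gcongr; nlinarith [sq_nonneg v]
    rw [sub_div]; linarith
  have h5 : 1 / (2 * D) * (-2 * y * v + (8 * v ^ 2 + 2 * v ^ 4 / a ^ 2 - 3 / 4 * a ^ 2)) =
      - (1 / 2) * ((2 * y * v - v ^ 2 * (8 + 2 * v ^ 2 / a ^ 2)) / D) - 1 / 2 * (3 / 4 * a ^ 2 / D) := by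
    field_simp
    ring
  rw [h5]
  linarith

lemma log_norm_mk (x y : ℝ) (z : ℂ) (hz : z = x + y * I) :
    Real.log ‖z‖ = 1 / 2 * Real.log (x ^ 2 + y ^ 2) := by
  have : ‖z‖ ^ 2 = x ^ 2 + y ^ 2 := by
    rw [hz, Complex.sq_norm, Complex.normSq_add_mul_I]
  rw [← this, Real.log_pow]
  push_cast; ring

lemma list_sum_lin (l : List ℂ) (w y : ℂ → ℝ) (v K : ℝ) :
    (l.map fun ρ => w ρ * (-2 * y ρ * v + K)).sum =
      -((l.map fun ρ => 2 * w ρ * y ρ).sum) * v + (l.map w).sum * K := by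
  induction l with
  | nil => simp
  | cons a l ih => simp only [List.map_cons, List.sum_cons, ih]; ring

lemma local_bound {q : ℕ} [NeZero q] (χ : DirichletCharacter ℂ q) (hχ : χ ≠ 1) (hRH : dirichletRH χ)
    (t a δ : ℝ) (ha : 0 < a) (ha1 : a ≤ 1) (hδ : 0 < δ) (hδa : δ ≤ a / 2) :
    ∃ P0 P1 : ℝ, 0 ≤ P0 ∧ ∀ v : ℝ, |v| ≤ 1 / 2 →
      Real.log ‖DirichletCharacter.LFunction χ (1 / 2 + δ + t * I)‖ -
        Real.log ‖DirichletCharacter.LFunction χ (1 / 2 + a + (t + v) * I)‖ ≤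
      -P1 * v + P0 * (8 * v ^ 2 + 2 * v ^ 4 / a ^ 2 - 3 / 4 * a ^ 2) +
        4042 * ((4 + B2) * LQ q t) * (a + |v|) := by
  have hLQ := LQ_ge (q := q) t
  have hB := B2_nonneg
  set m : ℝ := (4 + B2) * LQ q t with hm
  have hm1 : 1 ≤ m := by nlinarith
  set c0 : ℂ := 2 + t * I with hc0
  set f : ℂ → ℂ := fun z => DirichletCharacter.LFunction χ (c0 + z) with hf
  have hfd : Differentiable ℂ f :=
    (DirichletCharacter.differentiable_LFunction hχ).comp (differentiable_id.const_add c0)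
  have hnz : ∀ s : ℂ, 1 / 2 < s.re → DirichletCharacter.LFunction χ s ≠ 0 := by
    obtain ⟨F, _, hF, _⟩ := log_exists χ hχ hRH
    intro s hs
    rw [← hF s hs]; exact Complex.exp_ne_zero _
  have hM1 : ∀ z ∈ Metric.closedBall (0 : ℂ) (19 / 10), ‖f z‖ ≤ Real.exp m := by
    intro z hz
    have hz' : ‖z‖ ≤ 19 / 10 := by simpa using hz
    have h1 := (Complex.abs_re_le_norm z).trans hz'
    have h2 := (Complex.abs_im_le_norm z).trans hz'
    rw [abs_le] at h1
    refine (log_norm_L_le χ hχ (s := c0 + z) (t := t) ?_ ?_ ?_).trans ?_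
    · simp [hc0]; linarith
    · simp [hc0]; linarith
    · simp [hc0]; linarith
    · rw [Real.exp_le_exp, hm]; nlinarith
  have hM2 : Real.exp (-m) ≤ ‖f 0‖ := by
    have h1 := LSeries_cχ_bound χ (s := c0) (by simp [hc0])
    have h2 := exp_LSeries_cχ χ (s := c0) (by simp [hc0])
    simp only [hf, add_zero]
    rw [← h2, Complex.norm_exp, Real.exp_le_exp]
    have h3 := (abs_le.1 ((Complex.abs_re_le_norm (LSeries (cχ χ) c0)).trans h1)).1
    nlinarith
  obtain ⟨l, hl, -, hlog⟩ := local_factor f hfd m hm1 hM1 hM2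
  have hρ : ∀ ρ ∈ l, ρ = -(3 / 2 : ℝ) + ρ.im * I := by
    intro ρ hρl
    obtain ⟨h1, h2⟩ := hl ρ hρl
    have h3 := Complex.abs_re_le_norm ρ
    have h4 : -(17 / 10) ≤ ρ.re := by linarith [neg_abs_le ρ.re]
    have h5 : (c0 + ρ).re = 2 + ρ.re := by simp [hc0]
    have h6 : (c0 + ρ).re = 1 / 2 := by
      by_contra hne
      rcases lt_or_ge (c0 + ρ).re 1 with h7 | h7
      · exact hne (hRH _ (by rw [h5]; linarith) h7 h2)
      · exact hnz _ (by linarith) h2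
    have h7 : ρ.re = -(3 / 2) := by linarith
    apply Complex.ext
    · simp [h7]
    · simp
  refine ⟨(l.map fun ρ => 1 / (2 * (a ^ 2 + (-ρ.im) ^ 2))).sum,
    (l.map fun ρ => 2 * (1 / (2 * (a ^ 2 + (-ρ.im) ^ 2))) * (-ρ.im)).sum, ?_, ?_⟩
  · apply List.sum_nonneg
    intro x hx
    rw [List.mem_map] at hx
    obtain ⟨ρ, _, rfl⟩ := hx
    positivity
  · intro v hv
    set s : ℂ := ((-(3 / 2) + a : ℝ) : ℂ) + v * I with hs
    set s1 : ℂ := ((-(3 / 2) + δ : ℝ) : ℂ) with hs1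
    have es : 1 / 2 + a + (t + v) * I = c0 + s := by
      rw [hc0, hs]; push_cast; ring
    have es1 : 1 / 2 + δ + t * I = c0 + s1 := by
      rw [hc0, hs1]; push_cast; ring
    have hsn : ‖s‖ ≤ 8 / 5 := by
      have : ‖s‖ ^ 2 = (-(3 / 2) + a) ^ 2 + v ^ 2 := by
        rw [hs, Complex.sq_norm, Complex.normSq_add_mul_I]
      have h1 : v ^ 2 ≤ (1 / 2) ^ 2 := sq_le_sq.2 (by rwa [abs_of_nonneg (by norm_num : (0 : ℝ) ≤ 1 / 2)])
      nlinarith [norm_nonneg s]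
    have hs1n : ‖s1‖ ≤ 8 / 5 := by
      rw [hs1, Complex.norm_real, Real.norm_eq_abs, abs_le]
      constructor <;> linarith
    have h1 := hlog s s1 hsn hs1n (hnz _ (by rw [← es]; simp [ha])) (hnz _ (by rw [← es1]; simp [hδ]))
    rw [es, es1]
    refine h1.trans ?_
    refine add_le_add ?_ ?_
    · rw [← list_sum_lin l (fun ρ => 1 / (2 * (a ^ 2 + (-ρ.im) ^ 2))) (fun ρ => -ρ.im) v]
      refine List.sum_le_sum ?_
      intro ρ hρl
      rw [log_norm_mk δ (-ρ.im) (s1 - ρ), log_norm_mk a (-ρ.im + v) (s - ρ)]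
      · exact zero_bound a δ (-ρ.im) v ha hδ hδa
      · rw [hs]; nth_rewrite 1 [hρ ρ hρl]; push_cast; ring
      · rw [hs1]; nth_rewrite 1 [hρ ρ hρl]; push_cast; ring
    · gcongr
      have : s1 - s = ((δ - a : ℝ) : ℂ) - v * I := by rw [hs, hs1]; push_cast; ring
      rw [this]
      refine (norm_sub_le _ _).trans ?_
      rw [Complex.norm_real, norm_mul, Complex.norm_real, norm_I, mul_one, Real.norm_eq_abs, Real.norm_eq_abs]
      gcongr
      rw [abs_le]; constructor <;> linarith


lemma KS_odd_integral (r : ℝ) :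
    (MeasureTheory.Integrable fun u : ℝ => KS u * (if |u| ≤ r then u else 0)) ∧
    ∫ u : ℝ, KS u * (if |u| ≤ r then u else 0) = 0 := by
  constructor
  · refine KS_mul_integrable (E := ℝ) (g := fun u => if |u| ≤ r then u else 0) (B := 1) ?_ ?_
    · refine (Measurable.ite ?_ measurable_id measurable_const).aestronglyMeasurable
      exact measurableSet_le measurable_norm measurable_const
    · intro u
      have h1 : |u| ≤ 1 + u ^ 2 := by nlinarith [sq_abs u, sq_nonneg (|u| - 1)]
      have h2 : 1 + u ^ 2 ≤ (1 + u ^ 2) ^ 2 := by nlinarith [sq_nonneg u]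
      split_ifs
      · rw [Real.norm_eq_abs]; linarith
      · simp; positivity
  · have h := MeasureTheory.integral_neg_eq_self (fun u : ℝ => KS u * (if |u| ≤ r then u else 0)) MeasureTheory.volume
    simp only [KS_neg, abs_neg] at h
    have h2 : (fun u : ℝ => KS u * (if |u| ≤ r then -u else 0)) =
        fun u : ℝ => -(KS u * (if |u| ≤ r then u else 0)) := by
      funext u; split_ifs <;> simp
    rw [h2, MeasureTheory.integral_neg] at h
    linarith

noncomputable def lam0 : ℝ := Real.sqrt (40 * M4)

lemma lam0_sq : lam0 ^ 2 = 40 * M4 := Real.sq_sqrt (by linarith [M4_ge])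

lemma lam0_ge : 1 ≤ lam0 := by
  have h1 := lam0_sq
  have h2 := M4_ge
  have h3 : 0 ≤ lam0 := Real.sqrt_nonneg _
  nlinarith

/-- coefficients of the smoothed polynomial -/
noncomputable def bco (ℓ t : ℝ) (n : ℕ) : ℂ :=
  ∫ u : ℝ, KS u • ((n : ℂ) ^ (-(1 / 2 + (lam0 / ℓ : ℝ) + (t + u / ℓ) * I)))

lemma bco_int (ℓ t : ℝ) (hℓ : 1 ≤ ℓ) (n : ℕ) (hn : 1 ≤ n) :
    (MeasureTheory.Integrable fun u : ℝ => KS u • ((n : ℂ) ^ (-(1 / 2 + (lam0 / ℓ : ℝ) + (t + u / ℓ) * I)))) ∧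
    ‖bco ℓ t n‖ ≤ (n : ℝ) ^ (-(1 / 2) : ℝ) := by
  have hn0 : (n : ℂ) ≠ 0 := by exact_mod_cast (show n ≠ 0 by omega)
  have hn1 : (1 : ℝ) ≤ n := by exact_mod_cast hn
  have hl := lam0_ge
  have hnorm : ∀ u : ℝ, ‖(n : ℂ) ^ (-(1 / 2 + (lam0 / ℓ : ℝ) + (t + u / ℓ) * I))‖ ≤ (n : ℝ) ^ (-(1 / 2) : ℝ) := by
    intro u
    rw [Complex.norm_natCast_cpow_of_pos (by omega)]
    apply Real.rpow_le_rpow_of_exponent_le hn1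
    have : 0 ≤ lam0 / ℓ := by positivity
    simp
    linarith
  have hcont : Continuous fun u : ℝ => (n : ℂ) ^ (-(1 / 2 + (lam0 / ℓ : ℝ) + (t + u / ℓ) * I)) := by
    refine Continuous.const_cpow ?_ (Or.inl hn0)
    fun_prop
  constructor
  · refine KS_mul_integrable (B := (n : ℝ) ^ (-(1 / 2) : ℝ)) hcont.aestronglyMeasurable ?_
    intro u
    refine (hnorm u).trans ?_
    have : 1 ≤ (1 + u ^ 2) ^ 2 := by nlinarith [sq_nonneg u]
    have h3 : 0 ≤ (n : ℝ) ^ (-(1 / 2) : ℝ) := by positivity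
    nlinarith
  · unfold bco
    calc _ ≤ ∫ u : ℝ, KS u * (n : ℝ) ^ (-(1 / 2) : ℝ) := by
          refine MeasureTheory.norm_integral_le_of_norm_le (KS_integrable.mul_const _) ?_
          refine Filter.Eventually.of_forall fun u => ?_
          rw [norm_smul, Real.norm_of_nonneg (KS_nonneg u)]
          exact mul_le_mul_of_nonneg_left (hnorm u) (KS_nonneg u)
      _ = _ := by rw [MeasureTheory.integral_mul_const, KS_integral, one_mul]

set_option maxHeartbeats 2000000 in
theorem KEY : ∃ A ℓ0 : ℝ, 1 ≤ A ∧ 1 ≤ ℓ0 ∧ ∀ ℓ : ℝ, ℓ0 ≤ ℓ → ∀ t : ℝ,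
    ∀ {q : ℕ} [NeZero q] (χ : DirichletCharacter ℂ q), χ ≠ 1 → dirichletRH χ →
      ∀ δ : ℝ, 0 < δ → δ ≤ lam0 / ℓ / 2 →
        Real.log ‖DirichletCharacter.LFunction χ (1 / 2 + δ + t * I)‖ ≤
          (∑ n ∈ Icc 1 ⌊Real.exp (6 * ℓ)⌋₊, cL n * bco ℓ t n * χ n).re + A * LQ q t / ℓ := by
  obtain ⟨A, hA1, hA⟩ := F_growth
  have hl := lam0_ge
  have hl2 := lam0_sq
  have hM := M4_ge
  have hB := B2_nonneg
  set A3 : ℝ := 4042 * (4 + B2) * (2 * lam0) + 8 * (4 + A) with hA3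
  have hA31 : 1 ≤ A3 := by nlinarith
  refine ⟨A3 * M4, 2 * lam0 + 12 * M4, by nlinarith, by linarith, ?_⟩
  intro ℓ hℓ t q _ χ hχ hRH δ hδ hδa
  have hℓ1 : 1 ≤ ℓ := by linarith
  have hℓ0 : 0 < ℓ := by linarith
  obtain ⟨F, hFd, hFexp, hFser⟩ := log_exists χ hχ hRH
  have hgr := hA χ hχ F hFd hFexp hFser
  have hLQ := LQ_ge (q := q) t
  set a : ℝ := lam0 / ℓ with ha
  have ha0 : 0 < a := by positivity
  have ha1 : a ≤ 1 := by rw [ha, div_le_one hℓ0]; linarith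
  set X : ℕ := ⌊Real.exp (6 * ℓ)⌋₊ with hX
  set sv : ℝ → ℂ := fun u => 1 / 2 + a + (t + u / ℓ) * I with hsv
  have hsre : ∀ u, (sv u).re = 1 / 2 + a := by intro u; simp [hsv]
  have hsim : ∀ u, (sv u).im = t + u / ℓ := by
    intro u; simp [hsv]
  -- identity
  have hFgr : ∀ s : ℂ, 1 / 2 + a ≤ s.re → ‖F s‖ ≤ A / a * LQ q t * (1 + |s.im - t|) := by
    intro s hs
    refine (hgr a ha0 ha1 s hs).trans ?_
    have := LQ_shift (q := q) t (s.im - t)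
    rw [add_sub_cancel] at this
    rw [mul_assoc]
    gcongr
  obtain ⟨hGi, hG0⟩ := smooth_zero (fun s => F s - PX χ X s) ℓ a (A / a * LQ q t + X) B2 t X hℓ1 ha0
    (Nat.lt_floor_add_one _).le (hFd.sub (PX_diff χ X).differentiableOn) (by positivity) hB (by
      intro s hs
      refine (norm_sub_le _ _).trans ?_
      have h1 := hFgr s hs
      have h2 := PX_bound χ X (s := s) (by linarith)
      nlinarith [abs_nonneg (s.im - t), (Nat.cast_nonneg X : (0 : ℝ) ≤ X)]) (by
      intro s hs
      show ‖F s - PX χ X s‖ ≤ _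
      rw [hFser s (by linarith)]
      exact tail_bound χ X hs)
  have hPXeq : ∀ u : ℝ, KS u • PX χ X (sv u) = ∑ n ∈ Icc 1 X, cχ χ n * (KS u • (n : ℂ) ^ (-(sv u))) := by
    intro u
    rw [PX, Finset.smul_sum]
    refine Finset.sum_congr rfl fun n _ => ?_
    rw [mul_smul_comm]
  have hPi : MeasureTheory.Integrable fun u : ℝ => KS u • PX χ X (sv u) := by
    simp_rw [hPXeq]
    refine MeasureTheory.integrable_finsetSum _ fun n hn => ?_
    exact (bco_int ℓ t hℓ1 n (Finset.mem_Icc.1 hn).1).1.const_mul _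
  have hPval : ∫ u : ℝ, KS u • PX χ X (sv u) = ∑ n ∈ Icc 1 X, cL n * bco ℓ t n * χ n := by
    simp_rw [hPXeq]
    rw [MeasureTheory.integral_finsetSum]
    · refine Finset.sum_congr rfl fun n _ => ?_
      rw [MeasureTheory.integral_const_mul, cχ, bco]
      ring
    · intro n hn
      exact (bco_int ℓ t hℓ1 n (Finset.mem_Icc.1 hn).1).1.const_mul _
  have hFi : MeasureTheory.Integrable fun u : ℝ => KS u • F (sv u) := by
    refine (hGi.add hPi).congr (Filter.Eventually.of_forall fun u => ?_)
    simp only [Pi.add_apply, hsv, ← smul_add, sub_add_cancel]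
  have hFval : ∫ u : ℝ, KS u • F (sv u) = ∑ n ∈ Icc 1 X, cL n * bco ℓ t n * χ n := by
    rw [← hPval, ← zero_add (∫ u : ℝ, KS u • PX χ X (sv u)), ← hG0, ← MeasureTheory.integral_add hGi hPi]
    refine MeasureTheory.integral_congr_ae (Filter.Eventually.of_forall fun u => ?_)
    simp only [hsv, ← smul_add, sub_add_cancel]
  have hFre : ∫ u : ℝ, KS u * (F (sv u)).re = (∑ n ∈ Icc 1 X, cL n * bco ℓ t n * χ n).re := by
    rw [← hFval]
    have := integral_re (𝕜 := ℂ) hFi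
    simpa using this
  have hFrei : MeasureTheory.Integrable fun u : ℝ => KS u * (F (sv u)).re := by
    have := hFi.re
    simpa using this
  rw [← hFre]
  set Lg := Real.log ‖DirichletCharacter.LFunction χ (1 / 2 + δ + t * I)‖ with hLg
  obtain ⟨P0, P1, hP0, hloc⟩ := local_bound χ hχ hRH t a δ ha0 ha1 hδ hδa
  have hReF : ∀ u, Real.log ‖DirichletCharacter.LFunction χ (sv u)‖ = (F (sv u)).re := by
    intro u
    rw [← hFexp (sv u) (by rw [hsre]; linarith), Complex.norm_exp, Real.log_exp]
  set β : ℝ := P0 / ℓ ^ 2 * (10 + 3 * lam0 ^ 2 / ℓ ^ 2) + A3 * LQ q t / ℓ with hβ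
  set γ : ℝ := -(3 / 4 * lam0 ^ 2 * P0 / ℓ ^ 2) with hγ
  obtain ⟨hoi, ho0⟩ := KS_odd_integral (ℓ / 2)
  have hpt : ∀ u : ℝ, Lg - (F (sv u)).re ≤
      -(P1 / ℓ) * (if |u| ≤ ℓ / 2 then u else 0) + (β * (1 + u ^ 2) ^ 2 + γ) := by
    intro u
    have hw1 : 1 + |u| ≤ 2 * (1 + u ^ 2) := by nlinarith [sq_abs u, sq_nonneg (|u| - 1)]
    have hw2 : 1 + u ^ 2 ≤ (1 + u ^ 2) ^ 2 := by nlinarith [sq_nonneg u]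
    set w := (1 + u ^ 2) ^ 2 with hw
    split_ifs with hu
    · have h1 := hloc (u / ℓ) (by rw [abs_div, abs_of_pos hℓ0, div_le_iff₀ hℓ0]; linarith)
      have e : (1 / 2 + a + (t + (u / ℓ : ℝ)) * I : ℂ) = sv u := by rw [hsv]; push_cast; ring
      rw [e, hReF] at h1
      refine h1.trans ?_
      have h2 : 8 * (u / ℓ) ^ 2 + 2 * (u / ℓ) ^ 4 / a ^ 2 - 3 / 4 * a ^ 2 ≤
          (w * (10 + 3 * lam0 ^ 2 / ℓ ^ 2) - 3 / 4 * lam0 ^ 2) / ℓ ^ 2 := by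
        have : 8 * (u / ℓ) ^ 2 + 2 * (u / ℓ) ^ 4 / a ^ 2 - 3 / 4 * a ^ 2 =
            (8 * u ^ 2 + 2 * u ^ 4 / lam0 ^ 2 - 3 / 4 * lam0 ^ 2) / ℓ ^ 2 := by
          rw [ha]; field_simp
        rw [this]
        gcongr
        have h3 : 2 * u ^ 4 / lam0 ^ 2 ≤ 2 * u ^ 4 := div_le_self (by positivity) (by nlinarith)
        have h4 : 0 ≤ w * (3 * lam0 ^ 2 / ℓ ^ 2) := by positivity
        have h5 : 8 * u ^ 2 + 2 * u ^ 4 ≤ 10 * w := by rw [hw]; nlinarith [sq_nonneg u, sq_nonneg (u ^ 2)]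
        linarith
      have h3 : a + |u / ℓ| ≤ 2 * lam0 * w / ℓ := by
        rw [abs_div, abs_of_pos hℓ0, ha, ← add_div]
        gcongr
        nlinarith [abs_nonneg u]
      have h4 : P0 * (8 * (u / ℓ) ^ 2 + 2 * (u / ℓ) ^ 4 / a ^ 2 - 3 / 4 * a ^ 2) ≤
          P0 * ((w * (10 + 3 * lam0 ^ 2 / ℓ ^ 2) - 3 / 4 * lam0 ^ 2) / ℓ ^ 2) := by gcongr
      have h5 : 4042 * ((4 + B2) * LQ q t) * (a + |u / ℓ|) ≤
          4042 * ((4 + B2) * LQ q t) * (2 * lam0 * w / ℓ) := by gcongr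
      have h6 : 4042 * ((4 + B2) * LQ q t) * (2 * lam0 * w / ℓ) ≤ A3 * LQ q t / ℓ * w := by
        have : 4042 * ((4 + B2) * LQ q t) * (2 * lam0 * w / ℓ) = (4042 * (4 + B2) * (2 * lam0)) * LQ q t / ℓ * w := by ring
        rw [this]
        gcongr
        linarith
      have h7 : -P1 * (u / ℓ) = -(P1 / ℓ) * u := by ring
      have h8 : β * w + γ = P0 * ((w * (10 + 3 * lam0 ^ 2 / ℓ ^ 2) - 3 / 4 * lam0 ^ 2) / ℓ ^ 2) + A3 * LQ q t / ℓ * w := by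
        rw [hβ, hγ]; ring
      linarith
    · push Not at hu
      have hu2 : ℓ ^ 2 ≤ 4 * u ^ 2 := by nlinarith [sq_abs u]
      have hLg4 : Lg ≤ 4 * LQ q t := by
        have h1 := log_norm_L_le χ hχ (s := 1 / 2 + δ + t * I) (t := t) (by simp; linarith)
          (by simp; linarith) (by simp)
        have hne : DirichletCharacter.LFunction χ (1 / 2 + δ + t * I) ≠ 0 := by
          rw [← hFexp _ (by simp [hδ])]; exact Complex.exp_ne_zero _
        rw [hLg, Real.log_le_iff_le_exp (norm_pos_iff.2 hne)]
        exact h1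
      have hF1 : -(F (sv u)).re ≤ A * ℓ * LQ q t * (1 + |u|) := by
        have h1 := hFgr (sv u) (by rw [hsre])
        rw [hsim, add_sub_cancel_left, abs_div, abs_of_pos hℓ0] at h1
        have h2 := (abs_le.1 ((Complex.abs_re_le_norm _).trans h1)).1
        have h3 : A / a * LQ q t * (1 + |u| / ℓ) ≤ A * ℓ * LQ q t * (1 + |u|) := by
          have : A / a ≤ A * ℓ := by
            rw [ha, div_div_eq_mul_div]
            exact div_le_self (by positivity) hl
          gcongr
          exact div_le_self (abs_nonneg u) hℓ1
        linarith
      have h4 : Lg - (F (sv u)).re ≤ (4 + A) * LQ q t * (ℓ * (1 + |u|)) := by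
        have : 4 * LQ q t ≤ 4 * LQ q t * (ℓ * (1 + |u|)) := by
          have : 1 ≤ ℓ * (1 + |u|) := by nlinarith [abs_nonneg u]
          nlinarith
        nlinarith
      have h5 : ℓ * (1 + |u|) ≤ 8 * w / ℓ := by
        rw [le_div_iff₀ hℓ0]
        have : ℓ ^ 2 * (1 + |u|) ≤ (4 * u ^ 2) * (2 * (1 + u ^ 2)) := by gcongr
        have : u ^ 2 * (1 + u ^ 2) ≤ w := by rw [hw]; nlinarith [sq_nonneg u]
        nlinarith
      have h6 : (4 + A) * LQ q t * (ℓ * (1 + |u|)) ≤ (4 + A) * LQ q t * (8 * w / ℓ) := by gcongr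
      have h7 : (4 + A) * LQ q t * (8 * w / ℓ) ≤ A3 * LQ q t / ℓ * w := by
        have : (4 + A) * LQ q t * (8 * w / ℓ) = (8 * (4 + A)) * LQ q t / ℓ * w := by ring
        rw [this]
        gcongr
        have : 0 ≤ 4042 * (4 + B2) * (2 * lam0) := by positivity
        linarith
      have h8 : 0 ≤ P0 / ℓ ^ 2 * (10 + 3 * lam0 ^ 2 / ℓ ^ 2) * w + γ := by
        have : P0 / ℓ ^ 2 * (10 + 3 * lam0 ^ 2 / ℓ ^ 2) * w + γ =
            P0 / ℓ ^ 2 * (10 * w + 3 * lam0 ^ 2 * (w / ℓ ^ 2 - 1 / 4)) := by rw [hγ]; ring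
        rw [this]
        have : 1 / 4 ≤ w / ℓ ^ 2 := by
          rw [le_div_iff₀ (by positivity)]
          nlinarith [sq_nonneg u]
        have : 0 ≤ w / ℓ ^ 2 - 1 / 4 := by linarith
        positivity
      rw [mul_zero, zero_add, hβ, add_mul]
      linarith
  have hsi : MeasureTheory.Integrable fun u : ℝ => β * (KS u * (1 + u ^ 2) ^ 2) + γ * KS u :=
    (KS4_integrable.const_mul _).add (KS_integrable.const_mul _)
  have hintg := MeasureTheory.integral_mono (f := fun u => Lg * KS u - KS u * (F (sv u)).re)
    (g := fun u => -(P1 / ℓ) * (KS u * (if |u| ≤ ℓ / 2 then u else 0)) +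
      (β * (KS u * (1 + u ^ 2) ^ 2) + γ * KS u)) ((KS_integrable.const_mul _).sub hFrei)
    ((hoi.const_mul _).add hsi) (by
      intro u
      have h1 := mul_le_mul_of_nonneg_left (hpt u) (KS_nonneg u)
      simp only
      nlinarith)
  rw [MeasureTheory.integral_sub (KS_integrable.const_mul _) hFrei, MeasureTheory.integral_const_mul,
    MeasureTheory.integral_add (hoi.const_mul _) hsi,
    MeasureTheory.integral_add (KS4_integrable.const_mul _) (KS_integrable.const_mul _),
    MeasureTheory.integral_const_mul, MeasureTheory.integral_const_mul, MeasureTheory.integral_const_mul,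
    KS_integral, ho0] at hintg
  change Lg * 1 - _ ≤ -(P1 / ℓ) * 0 + (β * M4 + γ * 1) at hintg
  have hfin : β * M4 + γ ≤ A3 * M4 * LQ q t / ℓ := by
    have e : β * M4 + γ = P0 / ℓ ^ 2 * (10 * M4 + 3 * lam0 ^ 2 * (M4 / ℓ ^ 2) - 3 / 4 * lam0 ^ 2) +
        A3 * M4 * LQ q t / ℓ := by rw [hβ, hγ]; ring
    rw [e]
    have h1 : M4 / ℓ ^ 2 ≤ 1 / 12 := by
      rw [div_le_iff₀ (by positivity)]
      nlinarith
    have h2 : 10 * M4 + 3 * lam0 ^ 2 * (M4 / ℓ ^ 2) - 3 / 4 * lam0 ^ 2 ≤ 0 := by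
      have : 3 * lam0 ^ 2 * (M4 / ℓ ^ 2) ≤ 3 * lam0 ^ 2 * (1 / 12) := by gcongr
      nlinarith
    have h3 : P0 / ℓ ^ 2 * (10 * M4 + 3 * lam0 ^ 2 * (M4 / ℓ ^ 2) - 3 / 4 * lam0 ^ 2) ≤ 0 :=
      mul_nonpos_of_nonneg_of_nonpos (by positivity) h2
    linarith
  linarith


def Pr (n : ℕ) : Finset ℕ := (Finset.Icc 1 n).filter Nat.Prime

lemma mem_Pr {n p : ℕ} : p ∈ Pr n ↔ p ≤ n ∧ p.Prime := by
  simp only [Pr, mem_filter, mem_Icc]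
  exact ⟨fun h => ⟨h.1.2, h.2⟩, fun h => ⟨⟨h.2.one_le, h.1⟩, h.2⟩⟩

lemma Pr_succ (n : ℕ) : Pr (n+1) = if (n+1).Prime then insert (n+1) (Pr n) else Pr n := by
  ext p
  split_ifs with h
  · simp only [mem_insert, mem_Pr]
    constructor
    · rintro ⟨h1, h2⟩
      rcases Nat.lt_or_ge p (n+1) with h3 | h3
      · right; exact ⟨by omega, h2⟩
      · left; omega
    · rintro (rfl | h1)
      · exact ⟨le_rfl, h⟩
      · exact ⟨by omega, h1.2⟩
  · simp only [mem_Pr]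
    constructor
    · rintro ⟨h1, h2⟩
      refine ⟨?_, h2⟩
      by_contra h3
      have : p = n+1 := by omega
      exact h (this ▸ h2)
    · rintro h1
      exact ⟨by omega, h1.2⟩

lemma mertens1 (n : ℕ) (hn : 1 ≤ n) : ∑ p ∈ Pr n, Real.log p / p ≤ Real.log n + Real.log 4 := by
  have h1 : ∑ p ∈ Pr n, Real.log p * ((n / p : ℕ) : ℝ) ≤ n * Real.log n := by
    have h2 : Real.log (n.factorial) ≤ n * Real.log n := by
      rw [← Real.log_pow]
      apply Real.log_le_log (by positivity)
      exact_mod_cast Nat.factorial_le_pow n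
    refine le_trans ?_ h2
    rw [Real.log_nat_eq_sum_factorization, Finsupp.sum]
    have hsub : Pr n ⊆ n.factorial.factorization.support := by
      intro p hp
      rw [mem_Pr] at hp
      rw [Nat.support_factorization, Nat.mem_primeFactors]
      exact ⟨hp.2, (Nat.Prime.dvd_factorial hp.2).2 hp.1, Nat.factorial_ne_zero _⟩
    refine le_trans (Finset.sum_le_sum (g := fun p => ((n.factorial.factorization p : ℕ):ℝ) * Real.log p) ?_) (Finset.sum_le_sum_of_subset_of_nonneg hsub ?_)
    · intro p hp
      rw [mem_Pr] at hp
      rw [mul_comm]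
      apply mul_le_mul_of_nonneg_right _ (Real.log_natCast_nonneg p)
      rw [Nat.factorization_factorial hp.2 (Nat.lt_succ_self (Nat.log p n))]
      have : (n / p) = n / p^1 := by simp
      rw [this]
      norm_cast
      apply Finset.single_le_sum (f := fun i => n / p^i) (fun _ _ => Nat.zero_le _)
      rw [Finset.mem_Ico]
      have := Nat.log_pos hp.2.one_lt hp.1
      omega
    · intro i _ _
      exact mul_nonneg (by positivity) (Real.log_natCast_nonneg i)
  have h3 : ∑ p ∈ Pr n, Real.log p ≤ Real.log 4 * n := by
    have := Chebyshev.theta_le_log4_mul_x (x := (n:ℝ)) (by positivity)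
    rw [Chebyshev.theta_eq_sum_Icc] at this
    refine le_trans (Finset.sum_le_sum_of_subset_of_nonneg ?_ ?_) this
    · intro p hp
      rw [mem_Pr] at hp
      simp [hp.1, hp.2]
    · intro i _ _
      exact Real.log_natCast_nonneg i
  have hn0 : (0:ℝ) < n := by exact_mod_cast hn
  have h4 : n * ∑ p ∈ Pr n, Real.log p / p ≤ ∑ p ∈ Pr n, Real.log p * ((n / p : ℕ) : ℝ) + ∑ p ∈ Pr n, Real.log p := by
    rw [Finset.mul_sum, ← Finset.sum_add_distrib]
    apply Finset.sum_le_sum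
    intro p hp
    rw [mem_Pr] at hp
    have hp0 : (0:ℝ) < p := by exact_mod_cast hp.2.pos
    have : (n:ℝ) / p ≤ ((n / p : ℕ) : ℝ) + 1 := by
      rw [← Nat.floor_div_eq_div (K := ℝ)]
      exact (Nat.lt_floor_add_one _).le
    calc n * (Real.log p / p) = Real.log p * (n / p) := by ring
      _ ≤ Real.log p * (((n / p : ℕ) : ℝ) + 1) := mul_le_mul_of_nonneg_left this (Real.log_natCast_nonneg p)
      _ = _ := by ring
  have h5 : n * ∑ p ∈ Pr n, Real.log p / p ≤ n * (Real.log n + Real.log 4) := by nlinarith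
  exact le_of_mul_le_mul_left h5 hn0

theorem mertens2 : ∃ C : ℝ, 0 ≤ C ∧ ∀ n : ℕ, 2 ≤ n → ∑ p ∈ Pr n, (1:ℝ) / p ≤ Real.log (Real.log n) + C := by
  set A : ℕ → ℝ := fun n => ∑ p ∈ Pr n, Real.log p / p with hA
  set E : ℕ → ℝ := fun n => A n - Real.log n - Real.log 4 with hE
  obtain ⟨C', hC'⟩ : ∃ C' : ℝ, ∑ p ∈ Pr 2, (1:ℝ) / p ≤ Real.log (Real.log (2:ℕ)) + C' + E 2 / Real.log (2:ℕ) :=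
    ⟨∑ p ∈ Pr 2, (1:ℝ) / p - Real.log (Real.log (2:ℕ)) - E 2 / Real.log (2:ℕ), by linarith⟩
  have hE0 : ∀ n : ℕ, 1 ≤ n → E n ≤ 0 := by
    intro n hn
    have := mertens1 n hn
    simp only [hE, hA]; linarith
  have key : ∀ n : ℕ, 2 ≤ n → ∑ p ∈ Pr n, (1:ℝ) / p ≤ Real.log (Real.log n) + C' + E n / Real.log n := by
    intro n hn
    induction n, hn using Nat.le_induction with
    | base => exact hC'
    | succ n hn ih =>
      have hn2 : (2:ℝ) ≤ n := by exact_mod_cast hn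
      have hl : 0 < Real.log n := Real.log_pos (by linarith)
      have hl1 : 0 < Real.log ((n+1:ℕ):ℝ) := Real.log_pos (by push_cast; linarith)
      have hlm : Real.log n ≤ Real.log ((n+1:ℕ):ℝ) := Real.log_le_log (by linarith) (by push_cast; linarith)
      set l := Real.log n
      set l' := Real.log ((n+1:ℕ):ℝ)
      have h1 : (l' - l)/l' ≤ Real.log l' - Real.log l := by
        have := Real.one_sub_inv_le_log_of_pos (x := l'/l) (by positivity)
        rw [Real.log_div hl1.ne' hl.ne'] at this
        refine le_trans (le_of_eq ?_) this
        field_simp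
      have h2 : E n / l ≤ E n / l' := by
        have h3 := hE0 n (by omega)
        rw [div_le_div_iff₀ hl hl1]
        nlinarith
      have h3 : ∃ a : ℝ, ∑ p ∈ Pr (n+1), (1:ℝ) / p = ∑ p ∈ Pr n, (1:ℝ) / p + a / l' ∧ A (n+1) = A n + a := by
        rw [hA]
        simp only [Pr_succ]
        split_ifs with hp
        · have hnot : n+1 ∉ Pr n := by rw [mem_Pr]; omega
          refine ⟨l' / ((n+1:ℕ):ℝ), ?_, ?_⟩
          · rw [Finset.sum_insert hnot, add_comm]
            congr 1
            field_simp
          · rw [Finset.sum_insert hnot, add_comm]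
        · exact ⟨0, by simp, by simp⟩
      obtain ⟨a, ha1, ha2⟩ := h3
      rw [ha1]
      have h4 : E (n+1) = E n + a - (l' - l) := by
        simp only [hE]; rw [ha2]; ring
      rw [h4]
      have : (E n + a - (l' - l))/l' = E n / l' + a / l' - (l'-l)/l' := by ring
      rw [this]
      linarith
  refine ⟨max C' 0, le_max_right _ _, fun n hn => ?_⟩
  have h1 := key n hn
  have hn2 : (2:ℝ) ≤ n := by exact_mod_cast hn
  have hl : 0 < Real.log n := Real.log_pos (by linarith)
  have h2 : E n / Real.log n ≤ 0 := div_nonpos_of_nonpos_of_nonneg (hE0 n (by omega)) hl.le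
  have := le_max_left C' 0
  linarith


set_option maxHeartbeats 1000000 in
theorem decomp : ∃ C3 : ℝ, 0 ≤ C3 ∧ ∀ (N : ℕ) (b : ℕ → ℂ),
    (∀ n : ℕ, 1 ≤ n → ‖b n‖ ≤ (n:ℝ)^(-(1/2):ℝ)) → ∀ {q : ℕ} [NeZero q] (χ : DirichletCharacter ℂ q),
    ‖∑ n ∈ Finset.Icc 1 N, cL n * b n * χ n - (∑ p ∈ Pr N, b p * χ p +
      ∑ p ∈ Pr (Nat.sqrt N), ((1/2:ℂ) * b (p^2)) * χ p ^ 2)‖ ≤ C3 := by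
  set r : ℝ := (2:ℝ)^(-(1/2):ℝ) with hr
  have hr0 : 0 < r := by positivity
  have hr1 : r < 1 := Real.rpow_lt_one_of_one_lt_of_neg (by norm_num) (by norm_num)
  have hs1 : Summable fun k : ℕ => r^k := summable_geometric_of_lt_one hr0.le hr1
  have hs2 : Summable fun n : ℕ => (n:ℝ)^(-(3/2):ℝ) := Real.summable_nat_rpow.2 (by norm_num)
  refine ⟨(∑' k : ℕ, r^k) * ∑' n : ℕ, (n:ℝ)^(-(3/2):ℝ), mul_nonneg (tsum_nonneg fun k => by positivity) (tsum_nonneg fun k => by positivity), ?_⟩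
  intro N b hb q _ χ
  set f : ℕ → ℂ := fun n => cL n * b n * χ n with hf
  have hcl : ∀ p k : ℕ, p.Prime → 1 ≤ k → cL (p^k) = 1/k := by
    intro p k hp hk
    unfold cL
    rw [ArithmeticFunction.vonMangoldt_apply_pow (by omega), ArithmeticFunction.vonMangoldt_apply_prime hp]
    push_cast
    rw [Real.log_pow]
    have := Real.log_pos (x := p) (by exact_mod_cast hp.one_lt)
    field_simp
  set M := max 2 ⌊Real.log (N:ℝ) / Real.log 2⌋₊ with hM
  have h0 : ∑ n ∈ Finset.Icc 1 N, f n = ∑ n ∈ Ioc 0 ⌊(N:ℝ)⌋₊ with IsPrimePow n, f n := by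
    rw [Finset.sum_filter, Nat.floor_natCast]
    have : Finset.Icc 1 N = Ioc 0 N := by ext; simp [Nat.succ_le_iff]
    rw [this]
    refine Finset.sum_congr rfl fun n hn => ?_
    split_ifs with h
    · rfl
    · simp only [hf, cL]
      rw [ArithmeticFunction.vonMangoldt_eq_zero_iff.2 h]; simp
  have h1 := Chebyshev.sum_PrimePow_eq_sum_sum' f (x := (N:ℝ)) (by positivity) (N := M) (le_max_right _ _)
  rw [← h0] at h1
  change ‖∑ n ∈ Finset.Icc 1 N, f n - _‖ ≤ _
  rw [h1]
  have h2 : Finset.Icc 1 M = insert 1 (insert 2 (Finset.Icc 3 M)) := by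
    ext k; simp only [mem_Icc, mem_insert]
    have : 2 ≤ M := le_max_left _ _
    omega
  rw [h2, Finset.sum_insert (by simp), Finset.sum_insert (by simp)]
  have e1 : ∑ p ∈ Ioc 0 ⌊(N:ℝ) ^ ((1 : ℝ) / (1:ℕ))⌋₊ with p.Prime, f (p^1) = ∑ p ∈ Pr N, b p * χ p := by
    have : (Ioc 0 ⌊(N:ℝ) ^ ((1 : ℝ) / (1:ℕ))⌋₊).filter Nat.Prime = Pr N := by
      ext p; simp [mem_Pr]
      intro h _; exact h.pos
    rw [this]
    refine Finset.sum_congr rfl fun p hp => ?_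
    rw [mem_Pr] at hp
    simp only [hf]; rw [hcl p 1 hp.2 le_rfl]; simp
  have e2 : ∑ p ∈ Ioc 0 ⌊(N:ℝ) ^ ((1 : ℝ) / (2:ℕ))⌋₊ with p.Prime, f (p^2) = ∑ p ∈ Pr (Nat.sqrt N), ((1/2:ℂ) * b (p^2)) * χ p ^ 2 := by
    have : (Ioc 0 ⌊(N:ℝ) ^ ((1 : ℝ) / (2:ℕ))⌋₊).filter Nat.Prime = Pr (Nat.sqrt N) := by
      ext p; simp only [mem_filter, mem_Ioc, mem_Pr]
      push_cast
      rw [← Real.sqrt_eq_rpow, Real.nat_floor_real_sqrt_eq_nat_sqrt]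
      exact ⟨fun h => ⟨h.1.2, h.2⟩, fun h => ⟨⟨h.2.pos, h.1⟩, h.2⟩⟩
    rw [this]
    refine Finset.sum_congr rfl fun p hp => ?_
    rw [mem_Pr] at hp
    simp only [hf]; rw [hcl p 2 hp.2 (by norm_num)]; push_cast; rw [map_pow]
  rw [e1, e2]
  have e3 : ∀ A B R : ℂ, A + (B + R) - (A + B) = R := by intros; ring
  rw [e3]
  have hterm : ∀ k ∈ Finset.Icc 3 M, ‖∑ p ∈ Ioc 0 ⌊(N:ℝ) ^ ((1 : ℝ) / k)⌋₊ with p.Prime, f (p^k)‖ ≤ r^(k-3) * ∑' n : ℕ, (n:ℝ)^(-(3/2):ℝ) := by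
    intro k hk
    rw [mem_Icc] at hk
    refine (norm_sum_le _ _).trans ?_
    refine le_trans (Finset.sum_le_sum (g := fun p : ℕ => r^(k-3) * (p:ℝ)^(-(3/2):ℝ)) ?_) ?_
    · intro p hp
      rw [mem_filter] at hp
      have hp2 : (2:ℝ) ≤ p := by exact_mod_cast hp.2.two_le
      have hp0 : (0:ℝ) < p := by linarith
      simp only [hf]
      rw [norm_mul, norm_mul, hcl p k hp.2 (by omega)]
      have hb1 := hb (p^k) (Nat.one_le_pow _ _ hp.2.pos)
      have hc1 : ‖((1/(k:ℝ) : ℝ):ℂ)‖ ≤ 1 := by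
        rw [Complex.norm_real, Real.norm_of_nonneg (by positivity)]
        rw [div_le_one (by exact_mod_cast (by omega))]
        exact_mod_cast (by omega)
      have hx1 := χ.norm_le_one ((p^k : ℕ) : ZMod q)
      have : (((p^k:ℕ):ℝ))^(-(1/2):ℝ) ≤ r^(k-3) * (p:ℝ)^(-(3/2):ℝ) := by
        have e4 : (((p^k:ℕ):ℝ))^(-(1/2):ℝ) = ((p:ℝ)^(-(1/2):ℝ))^(k-3) * (p:ℝ)^(-(3/2):ℝ) := by
          push_cast
          rw [← Real.rpow_natCast, ← Real.rpow_natCast, ← Real.rpow_mul hp0.le, ← Real.rpow_mul hp0.le, ← Real.rpow_add hp0]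
          congr 1
          rw [Nat.cast_sub hk.1]; push_cast; ring
        rw [e4]
        apply mul_le_mul_of_nonneg_right _ (by positivity)
        apply pow_le_pow_left₀ (by positivity)
        exact Real.rpow_le_rpow_of_nonpos (by norm_num) hp2 (by norm_num)
      calc _ ≤ 1 * (((p^k:ℕ):ℝ))^(-(1/2):ℝ) * 1 := by
            apply mul_le_mul _ hx1 (norm_nonneg _) (by positivity)
            exact mul_le_mul hc1 hb1 (norm_nonneg _) (by norm_num)
        _ ≤ _ := by simpa using this
    · rw [← Finset.mul_sum]
      apply mul_le_mul_of_nonneg_left _ (by positivity)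
      exact hs2.sum_le_tsum _ (fun i _ => by positivity)
  refine (norm_sum_le _ _).trans ((Finset.sum_le_sum hterm).trans ?_)
  rw [← Finset.sum_mul]
  apply mul_le_mul_of_nonneg_right _ (tsum_nonneg fun k => by positivity)
  have : ∑ k ∈ Finset.Icc 3 M, r^(k-3) = ∑ j ∈ (Finset.Icc 3 M).image (fun k => k - 3), r^j := by
    rw [Finset.sum_image]
    intro a ha b hb hab
    simp only [coe_Icc, Set.mem_Icc] at ha hb
    simp only at hab
    omega
  rw [this]
  exact hs1.sum_le_tsum _ (fun i _ => by positivity)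

/-- sum over primes of reciprocal squares is bounded -/
lemma sum_inv_sq (n : ℕ) : ∑ p ∈ Pr n, (1:ℝ) / (p:ℝ)^2 ≤ 2 := by
  have h : ∀ n : ℕ, ∑ p ∈ Finset.Icc 1 (n+1), (1:ℝ)/(p:ℝ)^2 ≤ 2 - 1/((n:ℝ)+1) := by
    intro n
    induction n with
    | zero => simp; norm_num
    | succ n ih =>
      rw [Finset.sum_Icc_succ_top (by omega)]
      push_cast at ih ⊢
      have : (1:ℝ)/((n:ℝ)+1+1)^2 ≤ 1/((n:ℝ)+1) - 1/((n:ℝ)+1+1) := by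
        rw [div_sub_div _ _ (by positivity) (by positivity), div_le_div_iff₀ (by positivity) (by positivity)]
        nlinarith
      linarith
  calc ∑ p ∈ Pr n, (1:ℝ) / (p:ℝ)^2 ≤ ∑ p ∈ Finset.Icc 1 (n+1), (1:ℝ)/(p:ℝ)^2 := by
        apply Finset.sum_le_sum_of_subset_of_nonneg
        · intro p hp; rw [mem_Pr] at hp; rw [mem_Icc]; exact ⟨hp.2.one_le, by omega⟩
        · intros; positivity
    _ ≤ _ := (h n).trans (by have : (0:ℝ) ≤ 1/((n:ℝ)+1) := by positivity
                             linarith)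


/-- counting lemma from high moments -/
lemma count_le {q : ℕ} [NeZero q] (X : Finset (DirichletCharacter ℂ q)) (S : Finset ℕ) (hS : ∀ p ∈ S, p.Prime)
    (e : ℕ) (he : 1 ≤ e) (b : ℕ → ℂ) (Z J : ℕ) (hZ1 : 1 ≤ Z) (hZ : ∀ p ∈ S, p^e ≤ Z) (hJ : Z^J ≤ q)
    (V H : ℝ) (hV : ∑ p ∈ S, ‖b p‖^2 ≤ V) (hH : 0 < H) :
    (((X.filter (fun χ => H ≤ ‖∑ p ∈ S, b p * χ (p:ZMod q)^e‖)).card : ℕ) : ℝ) ≤ (q.totient:ℝ) * (J * V / H^2)^J := by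
  have h1 := A2_mom X S hS e he b Z J hZ1 hZ hJ
  set Y := X.filter (fun χ => H ≤ ‖∑ p ∈ S, b p * χ (p:ZMod q)^e‖) with hY
  have h2 : (Y.card : ℝ) * H^(2*J) ≤ ∑ χ ∈ X, ‖∑ p ∈ S, b p * χ (p:ZMod q)^e‖^(2*J) := by
    rw [← nsmul_eq_mul]
    refine le_trans (Finset.card_nsmul_le_sum Y (fun χ => ‖∑ p ∈ S, b p * χ (p:ZMod q)^e‖^(2*J)) _ ?_) ?_
    · intro χ hχ
      exact pow_le_pow_left₀ hH.le (mem_filter.1 hχ).2 _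
    · exact Finset.sum_le_sum_of_subset_of_nonneg (filter_subset _ _) (fun _ _ _ => by positivity)
  have hs0 : 0 ≤ ∑ p ∈ S, ‖b p‖^2 := Finset.sum_nonneg fun _ _ => by positivity
  have h3 : (J.factorial:ℝ) * (∑ p ∈ S, ‖b p‖^2)^J ≤ (J*V)^J := by
    rw [mul_pow]
    apply mul_le_mul _ (pow_le_pow_left₀ hs0 hV _) (by positivity) (by positivity)
    exact_mod_cast Nat.factorial_le_pow J
  have hHp : 0 < H^(2*J) := by positivity
  rw [div_pow, ← pow_mul, mul_div_assoc', le_div_iff₀ hHp]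
  exact h2.trans (h1.trans (mul_le_mul_of_nonneg_left h3 (by positivity)))

theorem Ubound : ∃ A3 C3 ℓ0 : ℝ, 1 ≤ A3 ∧ 0 ≤ C3 ∧ 1 ≤ ℓ0 ∧
    (∀ (q : ℕ) [NeZero q], 3 ≤ q → ∀ t : ℝ, |t| ≤ (q:ℝ)^2 → ∀ K : ℕ, 1 ≤ K → ℓ0 ≤ Real.log q / (6*K) →
      ∃ b : ℕ → ℂ, (∀ n : ℕ, 1 ≤ n → ‖b n‖ ≤ (n:ℝ)^(-(1/2):ℝ)) ∧
      ∀ χ : DirichletCharacter ℂ q, χ ≠ 1 → dirichletRH χ →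
        Real.log ‖DirichletCharacter.LFunction χ (1/2 + ((1/Real.log q:ℝ):ℂ) + t*I)‖ ≤
          (∑ p ∈ Pr ⌊Real.exp (Real.log q / K)⌋₊, b p * χ p).re
          + ‖∑ p ∈ Pr (Nat.sqrt ⌊Real.exp (Real.log q / K)⌋₊), ((1/2:ℂ) * b (p^2)) * χ p ^ 2‖ + C3 + A3 * K) ∧
    (∀ (q : ℕ) [NeZero q], 3 ≤ q → ∀ t : ℝ, |t| ≤ (q:ℝ)^2 → 2*ℓ0 ≤ Real.log q →
      ∀ χ : DirichletCharacter ℂ q, χ ≠ 1 → dirichletRH χ →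
        Real.log ‖DirichletCharacter.LFunction χ (1/2 + ((1/Real.log q:ℝ):ℂ) + t*I)‖ ≤
          Real.exp (6*ℓ0) + A3/(6*ℓ0) * Real.log q) ∧
    (∃ D : ℝ, 0 ≤ D ∧ ∀ (q : ℕ) [NeZero q], 3 ≤ q → ∀ t : ℝ, D ≤ Real.log q →
      ∀ χ : DirichletCharacter ℂ q, χ ≠ 1 → dirichletRH χ →
        Real.log ‖DirichletCharacter.LFunction χ (1/2 + ((1/Real.log q:ℝ):ℂ) + t*I)‖ ≤ D + LQ q t / 4) := by
  obtain ⟨A, ℓ0, hA, hℓ0, hkey⟩ := KEY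
  obtain ⟨C3, hC3, hdec⟩ := decomp
  have hLQ : ∀ (q : ℕ) [NeZero q], 3 ≤ q → ∀ t : ℝ, |t| ≤ (q:ℝ)^2 → LQ q t ≤ 4 * Real.log q := by
    intro q _ hq t ht
    have hq3 : (3:ℝ) ≤ q := by exact_mod_cast hq
    unfold LQ
    have : 4 * Real.log q = Real.log ((q:ℝ)^4) := by rw [Real.log_pow]; norm_num
    rw [this]
    apply Real.log_le_log (by positivity)
    have h1 : |t| + 4 ≤ (q:ℝ)^3 := by nlinarith [sq_nonneg ((q:ℝ))]
    calc (q:ℝ) * (|t|+4) ≤ q * (q:ℝ)^3 := by gcongr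
      _ = _ := by ring
  have hcrude : ∀ ℓ, 1 ≤ ℓ → ∀ t : ℝ, ∀ {q : ℕ} [NeZero q] (χ : DirichletCharacter ℂ q),
      (∑ n ∈ Finset.Icc 1 ⌊Real.exp (6*ℓ)⌋₊, cL n * bco ℓ t n * χ n).re ≤ Real.exp (6*ℓ) := by
    intro ℓ hℓ t q _ χ
    refine (Complex.re_le_norm _).trans ((norm_sum_le _ _).trans ?_)
    calc _ ≤ ∑ n ∈ Finset.Icc 1 ⌊Real.exp (6*ℓ)⌋₊, (1:ℝ) := by
          apply Finset.sum_le_sum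
          intro n hn
          rw [mem_Icc] at hn
          rw [norm_mul, norm_mul]
          have h1 := (bco_int ℓ t hℓ n hn.1).2
          have h2 : (n:ℝ)^(-(1/2):ℝ) ≤ 1 := Real.rpow_le_one_of_one_le_of_nonpos (by exact_mod_cast hn.1) (by norm_num)
          have h3 := χ.norm_le_one (n : ZMod q)
          have h4 : ‖((cL n : ℝ):ℂ)‖ ≤ 1 := by
            rw [Complex.norm_real, Real.norm_of_nonneg (cL_nonneg n)]; exact cL_le_one n
          have : ‖((cL n : ℝ):ℂ)‖ * ‖bco ℓ t n‖ ≤ 1 := mul_le_one₀ h4 (norm_nonneg _) (h1.trans h2)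
          exact mul_le_one₀ this (norm_nonneg _) h3
      _ = (⌊Real.exp (6*ℓ)⌋₊ : ℝ) := by simp
      _ ≤ _ := Nat.floor_le (by positivity)
  have hl0 := lam0_ge
  refine ⟨24*A, C3, ℓ0, by linarith, hC3, hℓ0, ?_, ?_, ?_⟩
  · intro q _ hq t ht K hK hℓ
    have hq3 : (3:ℝ) ≤ q := by exact_mod_cast hq
    have hlq : 0 < Real.log q := Real.log_pos (by linarith)
    have hK1 : (1:ℝ) ≤ K := by exact_mod_cast hK
    set ℓ := Real.log q / (6*K) with hℓd
    have hℓ1 : 1 ≤ ℓ := hℓ0.trans hℓ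
    refine ⟨bco ℓ t, fun n hn => (bco_int ℓ t hℓ1 n hn).2, fun χ hχ hR => ?_⟩
    have h1 := hkey ℓ hℓ t χ hχ hR (1/Real.log q) (by positivity) (by
      have : lam0 / ℓ / 2 = lam0 * 3 * K / Real.log q := by rw [hℓd]; field_simp; norm_num
      rw [this]
      gcongr
      nlinarith)
    have e1 : 6*ℓ = Real.log q / K := by rw [hℓd]; field_simp
    rw [e1] at h1
    have h2 := hdec ⌊Real.exp (Real.log q / K)⌋₊ (bco ℓ t) (fun n hn => (bco_int ℓ t hℓ1 n hn).2) χ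
    have h3 : A * LQ q t / ℓ ≤ 24 * A * K := by
      rw [div_le_iff₀ (by linarith)]
      have : 24 * A * K * ℓ = A * (4 * Real.log q) := by rw [hℓd]; field_simp; norm_num
      rw [this]
      exact mul_le_mul_of_nonneg_left (hLQ q hq t ht) (by linarith)
    have h4 := (Complex.re_le_norm _).trans h2
    rw [Complex.sub_re, Complex.add_re] at h4
    have h5 := Complex.re_le_norm (∑ p ∈ Pr (Nat.sqrt ⌊Real.exp (Real.log q / K)⌋₊), ((1/2:ℂ) * bco ℓ t (p^2)) * χ p ^ 2)
    linarith
  · intro q _ hq t ht hℓq χ hχ hR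
    have hlq : 0 < Real.log q := by linarith
    have h1 := hkey ℓ0 le_rfl t χ hχ hR (1/Real.log q) (by positivity) (by
      rw [div_div, div_le_div_iff₀ hlq (by linarith)]
      nlinarith)
    have h2 := hcrude ℓ0 hℓ0 t χ
    have h3 : A * LQ q t / ℓ0 ≤ 24 * A / (6*ℓ0) * Real.log q := by
      have : 24 * A / (6*ℓ0) * Real.log q = A * (4 * Real.log q) / ℓ0 := by field_simp; norm_num
      rw [this]
      apply div_le_div_of_nonneg_right _ (by linarith)
      exact mul_le_mul_of_nonneg_left (hLQ q hq t ht) (by linarith)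
    linarith
  · set ℓ := max ℓ0 (4*A) with hℓd
    have hℓ0' : ℓ0 ≤ ℓ := le_max_left _ _
    have hℓA : 4*A ≤ ℓ := le_max_right _ _
    refine ⟨Real.exp (6*ℓ), by positivity, ?_⟩
    intro q _ hq t hℓq χ hχ hR
    have he : 2 * ℓ ≤ Real.exp (6*ℓ) := by linarith [Real.add_one_le_exp (6*ℓ)]
    have hlq : 0 < Real.log q := by linarith
    have h1 := hkey ℓ hℓ0' t χ hχ hR (1/Real.log q) (by positivity) (by
      rw [div_div, div_le_div_iff₀ hlq (by linarith)]
      nlinarith)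
    have h2 := hcrude ℓ (by linarith) t χ
    have h3 : A * LQ q t / ℓ ≤ LQ q t / 4 := by
      have hL := LQ_ge (q := q) t
      rw [div_le_div_iff₀ (by linarith) (by norm_num)]
      nlinarith
    linarith

lemma Pr_mono {a b : ℕ} (h : a ≤ b) : Pr a ⊆ Pr b := by
  intro p hp; rw [mem_Pr] at *; exact ⟨by omega, hp.2⟩

theorem primesum : ∃ C : ℝ, 0 ≤ C ∧ ∀ q n : ℕ, 3 ≤ q → n ≤ q → ∑ p ∈ Pr n, (1:ℝ) / p ≤ Real.log (Real.log q) + C := by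
  obtain ⟨C, hC, h⟩ := mertens2
  refine ⟨C, hC, fun q n hq hn => (Finset.sum_le_sum_of_subset_of_nonneg (Pr_mono hn) (fun _ _ _ => by positivity)).trans (h q (by omega))⟩

lemma b_sq_le (b : ℕ → ℂ) (hb : ∀ n : ℕ, 1 ≤ n → ‖b n‖ ≤ (n:ℝ)^(-(1/2):ℝ)) (n : ℕ) (hn : 1 ≤ n) : ‖b n‖^2 ≤ 1/n := by
  have hn0 : (0:ℝ) < n := by exact_mod_cast hn
  calc ‖b n‖^2 ≤ ((n:ℝ)^(-(1/2):ℝ))^2 := pow_le_pow_left₀ (norm_nonneg _) (hb n hn) _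
    _ = 1/n := by
      rw [← Real.rpow_natCast, ← Real.rpow_mul hn0.le]
      norm_num
      exact Real.rpow_neg_one _

lemma floor_pow_le (q K : ℕ) (hq : 1 ≤ q) (hK : 1 ≤ K) : ⌊Real.exp (Real.log q / K)⌋₊ ^ K ≤ q := by
  have hK0 : (K:ℝ) ≠ 0 := by exact_mod_cast (by omega : K ≠ 0)
  have : ((⌊Real.exp (Real.log q / K)⌋₊ : ℝ))^K ≤ q := by
    calc _ ≤ (Real.exp (Real.log q / K))^K := pow_le_pow_left₀ (by positivity) (Nat.floor_le (by positivity)) _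
      _ = q := by
        rw [← Real.exp_nat_mul, mul_div_cancel₀ _ hK0, Real.exp_log (by exact_mod_cast hq)]
  exact_mod_cast this

lemma floor_exp_ge_one (q K : ℕ) (hq : 1 ≤ q) : 1 ≤ ⌊Real.exp (Real.log q / K)⌋₊ := by
  rw [Nat.one_le_floor_iff]
  apply Real.one_le_exp
  have := Real.log_natCast_nonneg q
  positivity

lemma floor_exp_le (q K : ℕ) (hq : 1 ≤ q) (hK : 1 ≤ K) : ⌊Real.exp (Real.log q / K)⌋₊ ≤ q :=
  (Nat.le_self_pow (by omega) _).trans (floor_pow_le q K hq hK)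

lemma card_le_phi {q : ℕ} [NeZero q] (X : Finset (DirichletCharacter ℂ q)) : (X.card : ℝ) ≤ q.totient := by
  have := A1 X ({1} : Finset ℕ) (fun i => i) (fun _ => 1) (by
    intro i hi; rw [mem_singleton] at hi; subst hi; exact ⟨le_rfl, NeZero.one_le⟩) (by simp)
  simpa using this


lemma ev_loglog (c : ℝ) : ∀ᶠ q : ℕ in Filter.atTop, c ≤ Real.log (Real.log q) :=
  (Real.tendsto_log_atTop.comp (Real.tendsto_log_atTop.comp tendsto_natCast_atTop_atTop)).eventually_ge_atTop c

lemma ev_log (c : ℝ) : ∀ᶠ q : ℕ in Filter.atTop, c ≤ Real.log q :=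
  (Real.tendsto_log_atTop.comp tendsto_natCast_atTop_atTop).eventually_ge_atTop c

set_option maxHeartbeats 2000000 in
theorem crude (μ : ℝ) (hμ : 0 < μ) : ∃ B Cc : ℝ, 0 ≤ B ∧ 0 ≤ Cc ∧ ∃ q0 : ℕ, ∀ (q : ℕ) [NeZero q], q0 ≤ q →
    ∀ t : ℝ, |t| ≤ (q:ℝ)^2 → ∀ X : Finset (DirichletCharacter ℂ q), (∀ χ ∈ X, χ ≠ 1 ∧ dirichletRH χ) →
    ∑ χ ∈ X, ‖DirichletCharacter.LFunction χ (1/2 + ((1/Real.log q:ℝ):ℂ) + t*I)‖^μ ≤ q.totient * (Cc * Real.log q ^ B) := by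
  obtain ⟨A3, C3, ℓ0, hA3, hC3, hℓ0, hU, hU0, -⟩ := Ubound
  obtain ⟨Cm, hCm, hps⟩ := primesum
  set c := 3 * A3 with hc
  set s := 2 * c * (μ + 1) with hs
  set D := 18 * Real.exp s with hD
  have hs0 : 0 ≤ s := by positivity
  have hD18 : 18 ≤ D := by have := Real.one_le_exp hs0; linarith
  set G := ∑' j : ℕ, (Real.exp (-1))^j with hG
  have hsumG : Summable fun j : ℕ => (Real.exp (-1))^j :=
    summable_geometric_of_lt_one (by positivity) (by rw [Real.exp_lt_one_iff]; norm_num)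
  have hG0 : 0 ≤ G := tsum_nonneg fun j => by positivity
  obtain ⟨q0, hq0⟩ := Filter.eventually_atTop.1 (((ev_loglog (max (max C3 Cm) (max c 1))).and (ev_log (3*ℓ0*Real.exp (6*ℓ0)))).and (Filter.eventually_ge_atTop 3))
  refine ⟨μ * D, Real.exp (2*μ) + Real.exp μ * G, by positivity, by positivity, q0, ?_⟩
  intro q _ hq t ht X hX
  obtain ⟨⟨hLL, hlq⟩, hq3⟩ := hq0 q hq
  set LL := Real.log (Real.log q) with hLLd
  have hLC3 : C3 ≤ LL := ((le_max_left _ _).trans (le_max_left _ _)).trans hLL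
  have hLCm : Cm ≤ LL := ((le_max_right _ _).trans (le_max_left _ _)).trans hLL
  have hLc : c ≤ LL := ((le_max_left _ _).trans (le_max_right _ _)).trans hLL
  have hL1 : 1 ≤ LL := ((le_max_right _ _).trans (le_max_right _ _)).trans hLL
  have hee : 1 ≤ Real.exp (6*ℓ0) := Real.one_le_exp (by positivity)
  have hlq3 : 3 * ℓ0 ≤ Real.log q := le_trans (by nlinarith) hlq
  have hlq0 : 0 < Real.log q := by linarith
  have hlogq : Real.log q = Real.exp LL := by rw [hLLd, Real.exp_log hlq0]
  set W : DirichletCharacter ℂ q → ℝ := fun χ => Real.log ‖DirichletCharacter.LFunction χ (1/2 + ((1/Real.log q:ℝ):ℂ) + t*I)‖ with hW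
  have hcount : ∀ j : ℕ, D * LL ≤ j → (((X.filter (fun χ => (j:ℝ) ≤ W χ)).card : ℕ):ℝ) ≤ q.totient * Real.exp (-(μ+1)*j) := by
    intro j hj
    set K := ⌊(j:ℝ)/c⌋₊ with hK
    have hc3 : 3 ≤ c := by linarith
    have hj18 : 18 * LL ≤ j := le_trans (by nlinarith) hj
    have hjc : c ≤ j := by linarith
    have hjc1 : 1 ≤ (j:ℝ)/c := by rw [le_div_iff₀ (by linarith)]; linarith
    have hK1 : 1 ≤ K := by rw [hK, Nat.one_le_floor_iff]; exact hjc1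
    have hK1r : (1:ℝ) ≤ K := by exact_mod_cast hK1
    have hKle : (K:ℝ) ≤ j/c := Nat.floor_le (by positivity)
    have hKge : (j:ℝ)/c ≤ 2 * K := by
      have := Nat.lt_floor_add_one ((j:ℝ)/c)
      rw [← hK] at this; linarith
    have hKc : K * c ≤ j := by rwa [le_div_iff₀ (by linarith)] at hKle
    have hKge' : (j:ℝ) ≤ 2 * K * c := by rwa [div_le_iff₀ (by linarith)] at hKge
    have hj0 : (0:ℝ) < j := by linarith
    rcases le_or_gt ℓ0 (Real.log q / (6*K)) with hcase | hcase
    · obtain ⟨b, hb, hbU⟩ := hU q hq3 t ht K hK1 hcase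
      set N := ⌊Real.exp (Real.log q / K)⌋₊ with hN
      have hN1 : 1 ≤ N := floor_exp_ge_one q K (by omega)
      have hNK : N^K ≤ q := floor_pow_le q K (by omega) hK1
      have hNq : N ≤ q := floor_exp_le q K (by omega) hK1
      have hV : ∑ p ∈ Pr N, ‖b p‖^2 ≤ 2 * LL := by
        refine (Finset.sum_le_sum (fun p hp => b_sq_le b hb p (mem_Pr.1 hp).2.one_le)).trans ?_
        have := hps q N hq3 hNq
        linarith
      have hP2 : ∀ χ : DirichletCharacter ℂ q, ‖∑ p ∈ Pr (Nat.sqrt N), ((1/2:ℂ) * b (p^2)) * χ p ^ 2‖ ≤ 2 * LL := by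
        intro χ
        refine (norm_sum_le _ _).trans ?_
        have h1 : ∑ p ∈ Pr (Nat.sqrt N), ‖((1/2:ℂ) * b (p^2)) * χ p ^ 2‖ ≤ ∑ p ∈ Pr (Nat.sqrt N), (1:ℝ)/p := by
          apply Finset.sum_le_sum
          intro p hp
          have hp1 := (mem_Pr.1 hp).2.one_le
          have hp0 : (0:ℝ) < p := by exact_mod_cast hp1
          have h2 := hb (p^2) (Nat.one_le_pow _ _ hp1)
          have h3 : (((p^2:ℕ):ℝ))^(-(1/2):ℝ) = 1/p := by
            push_cast
            rw [← Real.rpow_natCast, ← Real.rpow_mul hp0.le]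
            norm_num
            exact Real.rpow_neg_one _
          rw [h3] at h2
          rw [norm_mul, norm_mul, norm_pow]
          have h4 : ‖χ (p:ZMod q)‖^2 ≤ 1 := pow_le_one₀ (norm_nonneg _) (χ.norm_le_one _)
          have h5 : ‖(1/2:ℂ)‖ ≤ 1 := by norm_num
          calc ‖(1/2:ℂ)‖ * ‖b (p^2)‖ * ‖χ (p:ZMod q)‖^2 ≤ 1 * (1/p) * 1 := by gcongr
            _ = _ := by ring
        refine h1.trans ?_
        have := hps q (Nat.sqrt N) hq3 ((Nat.sqrt_le_self N).trans hNq)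
        linarith
      have hcl := count_le X (Pr N) (fun p hp => (mem_Pr.1 hp).2) 1 le_rfl b N K hN1 (fun p hp => by simpa using (mem_Pr.1 hp).1) hNK (2*LL) ((j:ℝ)/3) hV (by positivity)
      simp only [pow_one] at hcl
      have hsub : X.filter (fun χ => (j:ℝ) ≤ W χ) ⊆ X.filter (fun χ => (j:ℝ)/3 ≤ ‖∑ p ∈ Pr N, b p * χ (p:ZMod q)‖) := by
        intro χ hχ
        rw [mem_filter] at hχ ⊢
        refine ⟨hχ.1, ?_⟩
        have h1 := hbU χ (hX χ hχ.1).1 (hX χ hχ.1).2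
        have h2 := hχ.2
        simp only [hW] at h2
        have h3 := hP2 χ
        have h4 := Complex.re_le_norm (∑ p ∈ Pr N, b p * χ (p:ZMod q))
        have h5 : A3 * K ≤ j/3 := by linarith
        linarith
      have hcard : (((X.filter (fun χ => (j:ℝ) ≤ W χ)).card : ℕ):ℝ) ≤ (((X.filter (fun χ => (j:ℝ)/3 ≤ ‖∑ p ∈ Pr N, b p * χ (p:ZMod q)‖)).card : ℕ):ℝ) := by
        exact_mod_cast Finset.card_le_card hsub
      refine hcard.trans (hcl.trans ?_)
      apply mul_le_mul_of_nonneg_left _ (by positivity)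
      have hbase : K * (2*LL) / ((j:ℝ)/3)^2 ≤ Real.exp (-s) := by
        rw [div_le_iff₀ (by positivity), Real.exp_neg]
        have hes := Real.exp_pos s
        have : (Real.exp s)⁻¹ * ((j:ℝ)/3)^2 = (Real.exp s)⁻¹ * (j * j / 9) := by ring
        rw [this, inv_mul_eq_div, le_div_iff₀ hes]
        have hKj : (K:ℝ) ≤ j := by nlinarith
        have h6 : LL * 18 * Real.exp s ≤ j := by rw [hD] at hj; linarith
        have h7 : (K:ℝ) * (LL * 18 * Real.exp s) ≤ j * j := by
          apply mul_le_mul hKj h6 (by positivity) (by positivity)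
        linarith
      calc (K * (2*LL) / ((j:ℝ)/3)^2)^K ≤ (Real.exp (-s))^K := pow_le_pow_left₀ (by positivity) hbase _
        _ = Real.exp (-(s*K)) := by rw [← Real.exp_nat_mul]; congr 1; ring
        _ ≤ _ := by
          apply Real.exp_le_exp.2
          rw [hs]
          nlinarith
    · have hempty : X.filter (fun χ => (j:ℝ) ≤ W χ) = ∅ := by
        rw [Finset.filter_eq_empty_iff]
        intro χ hχ
        rw [not_le]
        have h1 := hU0 q hq3 t ht (by linarith) χ (hX χ hχ).1 (hX χ hχ).2
        refine lt_of_le_of_lt h1 ?_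
        rw [div_lt_iff₀ (by positivity)] at hcase
        have h2 : A3 / (6*ℓ0) * Real.log q ≤ j/3 - 0 ∧ Real.exp (6*ℓ0) < j * (2/3) := by
          have h3 : Real.log q < j * (6 * ℓ0) / c := by
            rw [lt_div_iff₀ (by linarith)]
            nlinarith
          rw [lt_div_iff₀ (by linarith)] at h3
          constructor
          · rw [div_mul_eq_mul_div, div_le_iff₀ (by positivity)]
            nlinarith
          · have h4 : 3 * ℓ0 * Real.exp (6*ℓ0) * 3 ≤ Real.log q * c := by
              apply mul_le_mul hlq hc3 (by norm_num) hlq0.le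
            have h5 : ℓ0 * (9 * Real.exp (6*ℓ0)) < ℓ0 * (j * 6) := by linarith
            have := lt_of_mul_lt_mul_left h5 (by linarith)
            linarith
        linarith [h2.1, h2.2]
      rw [hempty]; simp; positivity
  -- pointwise
  set j0 := ⌈D*LL⌉₊ with hj0
  set J1 := j0 + ∑ χ ∈ X, ⌈|W χ|⌉₊ with hJ1
  have hpt : ∀ χ ∈ X, ‖DirichletCharacter.LFunction χ (1/2 + ((1/Real.log q:ℝ):ℂ) + t*I)‖^μ ≤
      Real.exp (μ*(j0+1)) + ∑ j ∈ Finset.Icc j0 J1, (if (j:ℝ) ≤ W χ then Real.exp (μ*(j+1)) else 0) := by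
    intro χ hχ
    have h1 : ‖DirichletCharacter.LFunction χ (1/2 + ((1/Real.log q:ℝ):ℂ) + t*I)‖^μ ≤ Real.exp (μ * W χ) := by
      rw [mul_comm μ, Real.exp_mul]
      exact Real.rpow_le_rpow (norm_nonneg _) (Real.le_exp_log _) hμ.le
    refine h1.trans ?_
    have hnn : 0 ≤ ∑ j ∈ Finset.Icc j0 J1, (if (j:ℝ) ≤ W χ then Real.exp (μ*(j+1)) else 0) :=
      Finset.sum_nonneg fun j _ => by split_ifs <;> positivity
    rcases le_or_gt (W χ) (j0+1) with h2 | h2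
    · have : Real.exp (μ * W χ) ≤ Real.exp (μ*(j0+1)) := Real.exp_le_exp.2 (mul_le_mul_of_nonneg_left h2 hμ.le)
      linarith
    · have hW0 : 0 ≤ W χ := by have : (0:ℝ) ≤ j0 := by positivity
                               linarith
      have h3 : ⌊W χ⌋₊ ∈ Finset.Icc j0 J1 := by
        rw [mem_Icc]
        constructor
        · apply Nat.le_floor; linarith
        · have h4 : ⌈|W χ|⌉₊ ≤ ∑ χ ∈ X, ⌈|W χ|⌉₊ := Finset.single_le_sum (f := fun χ => ⌈|W χ|⌉₊) (fun _ _ => Nat.zero_le _) hχ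
          have h5 : ⌊W χ⌋₊ ≤ ⌈|W χ|⌉₊ := by rw [abs_of_nonneg hW0]; exact Nat.floor_le_ceil _
          omega
      have h4 := Finset.single_le_sum (f := fun j : ℕ => (if (j:ℝ) ≤ W χ then Real.exp (μ*(j+1)) else 0)) (fun j _ => by
        show 0 ≤ (if (j:ℝ) ≤ W χ then Real.exp (μ*(j+1)) else 0)
        split_ifs <;> positivity) h3
      simp only [Nat.floor_le hW0, if_true] at h4
      have h5 : Real.exp (μ * W χ) ≤ Real.exp (μ * ((⌊W χ⌋₊:ℝ)+1)) :=
        Real.exp_le_exp.2 (mul_le_mul_of_nonneg_left (Nat.lt_floor_add_one _).le hμ.le)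
      have := Real.exp_pos (μ*(j0+1))
      linarith
  refine (Finset.sum_le_sum hpt).trans ?_
  rw [Finset.sum_add_distrib, Finset.sum_comm]
  have hp1 : ∑ χ ∈ X, Real.exp (μ*(j0+1)) ≤ q.totient * (Real.exp (2*μ) * Real.log q ^ (μ*D)) := by
    rw [Finset.sum_const, nsmul_eq_mul]
    apply mul_le_mul (card_le_phi X) _ (by positivity) (by positivity)
    rw [hlogq, ← Real.exp_mul, ← Real.exp_add]
    apply Real.exp_le_exp.2
    have : (j0:ℝ) ≤ D*LL + 1 := (Nat.ceil_lt_add_one (by positivity)).le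
    nlinarith
  have hp2 : ∑ j ∈ Finset.Icc j0 J1, ∑ χ ∈ X, (if (j:ℝ) ≤ W χ then Real.exp (μ*(j+1)) else 0) ≤ q.totient * (Real.exp μ * G) := by
    calc _ ≤ ∑ j ∈ Finset.Icc j0 J1, q.totient * (Real.exp μ * (Real.exp (-1))^j) := by
          apply Finset.sum_le_sum
          intro j hj
          rw [mem_Icc] at hj
          have hjD : D * LL ≤ j := (Nat.le_ceil _).trans (by exact_mod_cast hj.1)
          rw [← Finset.sum_filter, Finset.sum_const, nsmul_eq_mul]
          calc _ ≤ (q.totient * Real.exp (-(μ+1)*j)) * Real.exp (μ*(j+1)) :=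
                mul_le_mul_of_nonneg_right (hcount j hjD) (by positivity)
            _ = _ := by
              rw [mul_assoc, ← Real.exp_add, ← Real.exp_nat_mul, ← Real.exp_add]
              congr 2; ring
      _ = q.totient * (Real.exp μ * ∑ j ∈ Finset.Icc j0 J1, (Real.exp (-1))^j) := by
          rw [← Finset.mul_sum, ← Finset.mul_sum]
      _ ≤ _ := by
          gcongr
          exact hsumG.sum_le_tsum _ (fun j _ => by positivity)
  refine (add_le_add hp1 hp2).trans ?_
  rw [← mul_add]
  apply mul_le_mul_of_nonneg_left _ (by positivity)
  rw [add_mul]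
  have h1 : 1 ≤ Real.log q ^ (μ*D) := Real.one_le_rpow (by linarith) (by positivity)
  have h2 : Real.exp μ * G ≤ Real.exp μ * G * Real.log q ^ (μ*D) := le_mul_of_one_le_right (by positivity) h1
  linarith


lemma exp_tail (r : ℝ) (hr : 0 ≤ r) (n : ℕ) :
    Real.exp r - ∑ m ∈ range n, r^m/m.factorial ≤ Real.exp (-n) * Real.exp (Real.exp 1 * r) := by
  have h1 : ∀ x : ℝ, HasSum (fun m : ℕ => x^m/m.factorial) (Real.exp x) := by
    intro x
    have := NormedSpace.expSeries_div_hasSum_exp (𝔸 := ℝ) x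
    rwa [← Real.exp_eq_exp_ℝ] at this
  have h2 := ((h1 r).summable.sum_add_tsum_nat_add n)
  rw [(h1 r).tsum_eq] at h2
  have h3 := ((h1 (Real.exp 1 * r)).summable.sum_add_tsum_nat_add n)
  rw [(h1 (Real.exp 1 * r)).tsum_eq] at h3
  have h4 : ∑' m : ℕ, r^(m+n)/(m+n).factorial ≤ ∑' m : ℕ, Real.exp (-n) * ((Real.exp 1 * r)^(m+n)/(m+n).factorial) := by
    apply Summable.tsum_le_tsum
    · intro m
      rw [mul_pow, ← Real.exp_nat_mul, mul_div_assoc, ← mul_assoc, ← Real.exp_add]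
      apply le_mul_of_one_le_left (by positivity)
      apply Real.one_le_exp
      push_cast; linarith [(Nat.cast_nonneg m : (0:ℝ) ≤ m)]
    · exact (summable_nat_add_iff (f := fun m : ℕ => r^m/m.factorial) n).2 (h1 r).summable
    · exact ((summable_nat_add_iff (f := fun m : ℕ => (Real.exp 1 * r)^m/m.factorial) n).2 (h1 _).summable).mul_left _
  rw [tsum_mul_left] at h4
  have h5 : 0 ≤ ∑ m ∈ range n, (Real.exp 1 * r)^m/m.factorial := Finset.sum_nonneg fun _ _ => by positivity
  have h6 : ∑' m : ℕ, (Real.exp 1 * r)^(m+n)/(m+n).factorial ≤ Real.exp (Real.exp 1 * r) := by linarith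
  have h7 := mul_le_mul_of_nonneg_left h6 (Real.exp_pos (-(n:ℝ))).le
  linarith

lemma expQ (z : ℂ) (J : ℕ) (hz : ‖z‖ ≤ J/20) : ‖Complex.exp z‖ ≤ 2 * ‖∑ j ∈ range (J+1), z^j/j.factorial‖ := by
  have h1 := Complex.norm_exp_sub_sum_le_exp_norm_sub_sum z (J+1)
  have h2 := exp_tail ‖z‖ (norm_nonneg _) (J+1)
  have h3 : Real.exp (-((J+1:ℕ):ℝ)) * Real.exp (Real.exp 1 * ‖z‖) ≤ ‖Complex.exp z‖ / 2 := by
    have h4 : Real.exp (-‖z‖) ≤ ‖Complex.exp z‖ := by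
      rw [Complex.norm_exp]
      apply Real.exp_le_exp.2
      have := Complex.abs_re_le_norm z
      exact (abs_le.1 this).1
    have h5 : Real.exp (-((J+1:ℕ):ℝ)) * Real.exp (Real.exp 1 * ‖z‖) ≤ Real.exp (-1) * Real.exp (-‖z‖) := by
      rw [← Real.exp_add, ← Real.exp_add]
      apply Real.exp_le_exp.2
      push_cast
      have := Real.exp_one_lt_d9
      have h0 := norm_nonneg z
      nlinarith
    have h6 : Real.exp (-1) ≤ 1/2 := by
      rw [Real.exp_neg, inv_eq_one_div, div_le_div_iff₀ (by positivity) (by norm_num)]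
      have := Real.exp_one_gt_d9
      linarith
    have := mul_le_mul h6 h4 (by positivity) (by norm_num)
    linarith
  have h7 := norm_sub_norm_le (Complex.exp z) (∑ j ∈ range (J+1), z^j/j.factorial)
  linarith

set_option maxHeartbeats 4000000 in
theorem sharp (m : ℝ) (hm : 0 < m) : ∃ Cc : ℝ, 0 ≤ Cc ∧ ∃ q0 : ℕ, ∀ (q : ℕ) [NeZero q], q0 ≤ q →
    ∀ t : ℝ, |t| ≤ (q:ℝ)^2 → ∀ X : Finset (DirichletCharacter ℂ q), (∀ χ ∈ X, χ ≠ 1 ∧ dirichletRH χ) →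
    ∑ χ ∈ X, ‖DirichletCharacter.LFunction χ (1/2 + ((1/Real.log q:ℝ):ℂ) + t*I)‖^(2*m) ≤
      q.totient * (Cc * Real.log q ^ (m^2+1)) := by
  obtain ⟨A3, C3, ℓ0, hA3, hC3, hℓ0, hU, -, -⟩ := Ubound
  obtain ⟨Cm, hCm, hps⟩ := primesum
  obtain ⟨B, Cc1, hB, hCc1, q1, hcrude⟩ := crude (4*m) (by positivity)
  set η := 1/(8*m) with hη
  set ε := 1/(4*m*A3) with hε
  have hη0 : 0 < η := by positivity
  have hε0 : 0 < ε := by positivity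
  set s := B/ε with hs
  have hs0 : 0 ≤ s := by positivity
  set D := ⌈800*m^2*Real.exp s/ε⌉₊ + 1 with hD
  have hDge : 800*m^2*Real.exp s/ε ≤ D := by
    rw [hD]; push_cast
    linarith [Nat.le_ceil (800*m^2*Real.exp s/ε)]
  have hD1 : 1 ≤ D := by omega
  have hD1r : (1:ℝ) ≤ D := by exact_mod_cast hD1
  obtain ⟨q0, hq0⟩ := Filter.eventually_atTop.1 (((ev_loglog (max (max (1/ε) Cm) (max (6*D*ε*Real.exp s/η^2) (max (24*ℓ0*ε) 1)))).and (Filter.eventually_ge_atTop q1)).and ((Filter.eventually_ge_atTop 3).and (ev_log 1)))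
  refine ⟨4*Real.exp (2*m*(C3+A3) + m^2*Cm) + (3*Cc1+1), by positivity, q0, ?_⟩
  intro q _ hq t ht X hX
  obtain ⟨⟨hLL, hq1⟩, hq3, hlq1⟩ := hq0 q hq
  set LL := Real.log (Real.log q) with hLLd
  have hLε : 1/ε ≤ LL := ((le_max_left _ _).trans (le_max_left _ _)).trans hLL
  have hLCm : Cm ≤ LL := ((le_max_right _ _).trans (le_max_left _ _)).trans hLL
  have hLs : 6*D*ε*Real.exp s/η^2 ≤ LL := ((le_max_left _ _).trans (le_max_right _ _)).trans hLL
  have hLl : 24*ℓ0*ε ≤ LL := (((le_max_left _ _).trans (le_max_right _ _)).trans (le_max_right _ _)).trans hLL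
  have hL1 : 1 ≤ LL := (((le_max_right _ _).trans (le_max_right _ _)).trans (le_max_right _ _)).trans hLL
  have hlq0 : 0 < Real.log q := by linarith
  have hlogq : Real.log q = Real.exp LL := by rw [hLLd, Real.exp_log hlq0]
  have hεL : 1 ≤ ε * LL := by rwa [div_le_iff₀ hε0, mul_comm] at hLε
  set K1 := ⌈ε*LL⌉₊ with hK1
  have hK1ge : ε * LL ≤ K1 := Nat.le_ceil _
  have hK1le : (K1:ℝ) ≤ ε*LL + 1 := (Nat.ceil_lt_add_one (by positivity)).le
  have hK1le2 : (K1:ℝ) ≤ 2*(ε*LL) := by linarith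
  have hK1r : (1:ℝ) ≤ K1 := by linarith
  have hK11 : 1 ≤ K1 := by exact_mod_cast hK1r
  have hbig : 12*ℓ0*(ε*LL) ≤ Real.log q := by
    have h1 := Real.quadratic_le_exp_of_nonneg (x := LL) (by linarith)
    rw [hlogq]
    nlinarith
  have hK1q : (K1:ℝ) ≤ Real.log q := by nlinarith
  have hℓK : ℓ0 ≤ Real.log q / (6*K1) := by
    rw [le_div_iff₀ (by positivity)]
    nlinarith
  obtain ⟨b, hb, hbU⟩ := hU q hq3 t ht K1 hK11 hℓK
  set N1 := ⌊Real.exp (Real.log q / K1)⌋₊ with hN1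
  set Kz := D * K1 with hKz
  have hKzr : (Kz:ℝ) = D * K1 := by rw [hKz]; push_cast; ring
  have hKz1 : 1 ≤ Kz := Nat.mul_pos hD1 hK11
  have hKzK : K1 ≤ Kz := Nat.le_mul_of_pos_left K1 hD1
  set Nz := ⌊Real.exp (Real.log q / Kz)⌋₊ with hNz
  have hN11 : 1 ≤ N1 := floor_exp_ge_one q K1 (by omega)
  have hNz1 : 1 ≤ Nz := floor_exp_ge_one q Kz (by omega)
  have hN1K : N1^K1 ≤ q := floor_pow_le q K1 (by omega) hK11
  have hNzK : Nz^Kz ≤ q := floor_pow_le q Kz (by omega) hKz1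
  have hNzq : Nz ≤ q := floor_exp_le q Kz (by omega) hKz1
  have hNzN1 : Nz ≤ N1 := by
    apply Nat.floor_le_floor
    apply Real.exp_le_exp.2
    apply div_le_div_of_nonneg_left hlq0.le (by positivity)
    exact_mod_cast hKzK
  have hVz : ∑ p ∈ Pr Nz, ‖b p‖^2 ≤ LL + Cm :=
    (Finset.sum_le_sum (fun p hp => b_sq_le b hb p (mem_Pr.1 hp).2.one_le)).trans (hps q Nz hq3 hNzq)
  have hVm : ∑ p ∈ Pr N1 \ Pr Nz, ‖b p‖^2 ≤ 3 * D := by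
    have h1 : ∀ p ∈ Pr N1 \ Pr Nz, ‖b p‖^2 ≤ (Kz/Real.log q) * (Real.log p / p) := by
      intro p hp
      rw [mem_sdiff, mem_Pr, mem_Pr] at hp
      have hpp := hp.1.2
      have hpz : Nz < p := by
        by_contra h; exact hp.2 ⟨by omega, hpp⟩
      have hp0 : (0:ℝ) < p := by exact_mod_cast hpp.pos
      have h2 : Real.log q / Kz ≤ Real.log p := by
        rw [Real.le_log_iff_exp_le hp0]
        exact (Nat.lt_of_floor_lt hpz).le
      refine (b_sq_le b hb p hpp.one_le).trans ?_
      rw [← mul_div_assoc]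
      apply div_le_div_of_nonneg_right _ hp0.le
      have hKz0 : (0:ℝ) < Kz := by exact_mod_cast hKz1
      rw [div_le_iff₀ hKz0] at h2
      rw [div_mul_eq_mul_div, le_div_iff₀ hlq0]
      linarith
    refine (Finset.sum_le_sum h1).trans ?_
    rw [← Finset.mul_sum]
    have h2 : ∑ p ∈ Pr N1 \ Pr Nz, Real.log p / p ≤ Real.log q / K1 + Real.log 4 := by
      refine (Finset.sum_le_sum_of_subset_of_nonneg sdiff_subset ?_).trans ((mertens1 N1 hN11).trans ?_)
      · intro p _ _; exact div_nonneg (Real.log_natCast_nonneg p) (by positivity)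
      · gcongr
        rw [Real.log_le_iff_le_exp (by exact_mod_cast hN11)]
        exact Nat.floor_le (by positivity)
    have h4 : Real.log 4 ≤ 2 := by
      have : Real.log 4 = 2 * Real.log 2 := by
        rw [show (4:ℝ) = 2^2 by norm_num, Real.log_pow]; norm_num
      have := Real.log_two_lt_d9
      linarith
    calc (Kz/Real.log q) * ∑ p ∈ Pr N1 \ Pr Nz, Real.log p / p ≤ (Kz/Real.log q) * (Real.log q / K1 + Real.log 4) :=
          mul_le_mul_of_nonneg_left h2 (by positivity)
      _ = D + D * (K1 / Real.log q) * Real.log 4 := by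
          rw [hKzr]; field_simp
      _ ≤ D + D * 1 * 2 := by
          have : K1 / Real.log q ≤ 1 := by rw [div_le_one hlq0]; exact hK1q
          gcongr
      _ = 3 * D := by ring
  have hV2 : ∑ p ∈ Pr (Nat.sqrt N1), ‖(1/2:ℂ) * b (p^2)‖^2 ≤ 3 * D := by
    have h1 : ∀ p ∈ Pr (Nat.sqrt N1), ‖(1/2:ℂ) * b (p^2)‖^2 ≤ 1/(p:ℝ)^2 := by
      intro p hp
      have := b_sq_le b hb (p^2) (Nat.one_le_pow _ _ (mem_Pr.1 hp).2.pos)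
      push_cast at this
      rw [norm_mul, mul_pow]
      have h2 : ‖(1/2:ℂ)‖^2 ≤ 1 := by norm_num
      calc _ ≤ 1 * (1/(p:ℝ)^2) := by gcongr
        _ = _ := one_mul _
    refine (Finset.sum_le_sum h1).trans ((sum_inv_sq _).trans ?_)
    linarith
  set Pz : DirichletCharacter ℂ q → ℂ := fun χ => ∑ p ∈ Pr Nz, b p * χ (p:ZMod q)^1 with hPz
  set Pm : DirichletCharacter ℂ q → ℂ := fun χ => ∑ p ∈ Pr N1 \ Pr Nz, b p * χ (p:ZMod q)^1 with hPm
  set P2 : DirichletCharacter ℂ q → ℂ := fun χ => ∑ p ∈ Pr (Nat.sqrt N1), ((1/2:ℂ) * b (p^2)) * χ (p:ZMod q)^2 with hP2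
  set Lf : DirichletCharacter ℂ q → ℝ := fun χ => ‖DirichletCharacter.LFunction χ (1/2 + ((1/Real.log q:ℝ):ℂ) + t*I)‖ with hLf
  change ∑ χ ∈ X, Lf χ ^ (2*m) ≤ _
  have hpow : ∀ (K : ℕ) (x : ℝ), 0 ≤ x → x ≤ Real.exp (-s) → K1 ≤ K → x^K ≤ Real.exp (-(B*LL)) := by
    intro K x hx0 hx hK
    calc x^K ≤ (Real.exp (-s))^K := pow_le_pow_left₀ hx0 hx _
      _ = Real.exp (-(s*K)) := by rw [← Real.exp_nat_mul]; congr 1; ring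
      _ ≤ _ := by
        apply Real.exp_le_exp.2
        have h1 : ε*LL ≤ K := hK1ge.trans (by exact_mod_cast hK)
        have h2 : B * LL = s * (ε * LL) := by rw [hs]; field_simp
        rw [h2]
        have := mul_le_mul_of_nonneg_left h1 hs0
        linarith
  have hbase : K1 * (3*(D:ℝ)) / (η*LL)^2 ≤ Real.exp (-s) := by
    rw [Real.exp_neg, div_le_iff₀ (by positivity), inv_mul_eq_div, le_div_iff₀ (Real.exp_pos s)]
    rw [div_le_iff₀ (by positivity)] at hLs
    calc K1 * (3*(D:ℝ)) * Real.exp s ≤ (2*(ε*LL)) * (3*(D:ℝ)) * Real.exp s := by gcongr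
      _ = (6*D*ε*Real.exp s) * LL := by ring
      _ ≤ (LL * η^2) * LL := by gcongr
      _ = _ := by ring
  -- counts
  have hc1 := count_le X (Pr Nz) (fun p hp => (mem_Pr.1 hp).2) 1 le_rfl b Nz Kz hNz1 (fun p hp => by simpa using (mem_Pr.1 hp).1) hNzK (2*LL) (Kz/(20*m)) (by linarith) (by positivity)
  have hc2 := count_le X (Pr N1 \ Pr Nz) (fun p hp => (mem_Pr.1 (mem_sdiff.1 hp).1).2) 1 le_rfl b N1 K1 hN11 (fun p hp => by simpa using (mem_Pr.1 (mem_sdiff.1 hp).1).1) hN1K (3*D) (η*LL) hVm (by positivity)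
  have hc3 := count_le X (Pr (Nat.sqrt N1)) (fun p hp => (mem_Pr.1 hp).2) 2 (by norm_num) (fun p => (1/2:ℂ) * b (p^2)) N1 K1 hN11 (fun p hp => by
    have := (mem_Pr.1 hp).1
    calc p^2 ≤ (Nat.sqrt N1)^2 := Nat.pow_le_pow_left this 2
      _ ≤ N1 := Nat.sqrt_le' N1) hN1K (3*D) (η*LL) hV2 (by positivity)
  have hbz : Kz * (2*LL) / (Kz/(20*m))^2 ≤ Real.exp (-s) := by
    have hKz0 : (0:ℝ) < Kz := by exact_mod_cast hKz1
    have e1 : Kz * (2*LL) / (Kz/(20*m))^2 = 800*m^2*LL/Kz := by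
      field_simp; norm_num
    rw [e1, Real.exp_neg, div_le_iff₀ hKz0, inv_mul_eq_div, le_div_iff₀ (Real.exp_pos s), hKzr]
    rw [div_le_iff₀ hε0] at hDge
    calc 800*m^2*LL * Real.exp s = (800*m^2*Real.exp s) * LL := by ring
      _ ≤ (D * ε) * LL := by gcongr
      _ = D * (ε * LL) := by ring
      _ ≤ D * K1 := by gcongr
  have hd1 := hc1.trans (mul_le_mul_of_nonneg_left (hpow Kz _ (by positivity) hbz hKzK) (by positivity))
  have hd2 := hc2.trans (mul_le_mul_of_nonneg_left (hpow K1 _ (by positivity) hbase le_rfl) (by positivity))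
  have hd3 := hc3.trans (mul_le_mul_of_nonneg_left (hpow K1 _ (by positivity) hbase le_rfl) (by positivity))
  set X1 := X.filter (fun χ => Kz/(20*m) ≤ ‖Pz χ‖) with hX1
  set X2 := X.filter (fun χ => η*LL ≤ ‖Pm χ‖) with hX2
  set X3 := X.filter (fun χ => η*LL ≤ ‖P2 χ‖) with hX3
  classical
  set Bad := X1 ∪ X2 ∪ X3 with hBad
  have hBadX : Bad ⊆ X := by
    intro χ hχ
    simp only [hBad, hX1, hX2, hX3, mem_union, mem_filter] at hχ
    tauto
  have hBadcard : (Bad.card : ℝ) ≤ 3 * (q.totient * Real.exp (-(B*LL))) := by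
    have h1 : Bad.card ≤ X1.card + X2.card + X3.card :=
      (Finset.card_union_le _ _).trans (Nat.add_le_add_right (Finset.card_union_le _ _) _)
    have h2 : (Bad.card : ℝ) ≤ X1.card + X2.card + X3.card := by exact_mod_cast h1
    have e1 : (X1.card:ℝ) ≤ q.totient * Real.exp (-(B*LL)) := hd1
    have e2 : (X2.card:ℝ) ≤ q.totient * Real.exp (-(B*LL)) := hd2
    have e3 : (X3.card:ℝ) ≤ q.totient * Real.exp (-(B*LL)) := hd3
    linarith
  have hphi : (0:ℝ) ≤ q.totient := by positivity
  have hbadsum : ∑ χ ∈ Bad, Lf χ ^ (2*m) ≤ q.totient * (3*Cc1+1) := by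
    have h1 := Finset.sum_mul_sq_le_sq_mul_sq Bad (fun _ => (1:ℝ)) (fun χ => Lf χ ^ (2*m))
    simp only [one_mul, one_pow, Finset.sum_const, nsmul_eq_mul, mul_one] at h1
    have h2 : ∑ χ ∈ Bad, (Lf χ ^ (2*m))^2 ≤ q.totient * (Cc1 * Real.log q ^ B) := by
      refine le_trans (Finset.sum_le_sum_of_subset_of_nonneg hBadX (fun _ _ _ => by positivity)) ?_
      refine le_trans (le_of_eq ?_) (hcrude q hq1 t ht X hX)
      refine Finset.sum_congr rfl fun χ _ => ?_
      rw [← Real.rpow_natCast, ← Real.rpow_mul (norm_nonneg _)]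
      congr 1; push_cast; ring
    have h3 : (∑ χ ∈ Bad, Lf χ ^ (2*m))^2 ≤ (q.totient * (3*Cc1+1))^2 := by
      refine h1.trans ?_
      calc _ ≤ (3 * (q.totient * Real.exp (-(B*LL)))) * (q.totient * (Cc1 * Real.log q ^ B)) := by
            apply mul_le_mul hBadcard h2 (Finset.sum_nonneg fun _ _ => by positivity) (by positivity)
        _ = (q.totient:ℝ)^2 * (3*Cc1) * (Real.exp (-(B*LL)) * Real.log q ^ B) := by ring
        _ = (q.totient:ℝ)^2 * (3*Cc1) := by
            rw [hlogq, ← Real.exp_mul, ← Real.exp_add]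
            have : -(B*LL) + LL*B = 0 := by ring
            rw [this, Real.exp_zero, mul_one]
        _ ≤ _ := by
            rw [mul_pow]
            apply mul_le_mul_of_nonneg_left _ (by positivity)
            nlinarith
    exact (le_abs_self _).trans (abs_le_of_sq_le_sq h3 (by positivity))
  have hgood : ∀ χ ∈ X \ Bad, Lf χ ^ (2*m) ≤ 4 * Real.exp (LL + 2*m*(C3+A3)) *
      ‖∑ j ∈ range (Kz+1), (∑ p ∈ Pr Nz, ((m:ℂ) * b p) * χ (p:ZMod q))^j / j.factorial‖^2 := by
    intro χ hχ
    rw [mem_sdiff] at hχ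
    have hn : ‖Pz χ‖ < Kz/(20*m) ∧ ‖Pm χ‖ < η*LL ∧ ‖P2 χ‖ < η*LL := by
      have := hχ.2
      simp only [hBad, hX1, hX2, hX3, mem_union, mem_filter, not_or, not_and, not_le] at this
      exact ⟨this.1.1 hχ.1, this.1.2 hχ.1, this.2 hχ.1⟩
    have h1 := hbU χ (hX χ hχ.1).1 (hX χ hχ.1).2
    have hsplit : ∑ p ∈ Pr N1, b p * χ p = Pm χ + Pz χ := by
      simp only [hPm, hPz, pow_one]
      exact (Finset.sum_sdiff (Pr_mono hNzN1)).symm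
    rw [hsplit, Complex.add_re] at h1
    have h2 := Complex.re_le_norm (Pm χ)
    have h3 : Real.log (Lf χ) ≤ (Pz χ).re + (2*η*LL + C3 + A3 * K1) := by
      have h4 := hn.2.2
      have h5 := hn.2.1
      simp only [hP2] at h4
      simp only [hLf]
      linarith
    have h4 : Lf χ ^ (2*m) ≤ Real.exp (2*m*Real.log (Lf χ)) := by
      rw [mul_comm (2*m), Real.exp_mul]
      exact Real.rpow_le_rpow (norm_nonneg _) (Real.le_exp_log _) (by positivity)
    have h5 : 2*m*Real.log (Lf χ) ≤ 2 * (m*(Pz χ).re) + (LL + 2*m*(C3+A3)) := by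
      have h6 : 2*m*(2*η*LL) = LL/2 := by rw [hη]; field_simp; norm_num
      have h7 : 2*m*(A3*(ε*LL)) = LL/2 := by rw [hε]; field_simp; norm_num
      have h8 : 2*m*(A3*K1) ≤ 2*m*(A3*(ε*LL+1)) := by gcongr
      have h9 := mul_le_mul_of_nonneg_left h3 (by positivity : 0 ≤ 2*m)
      nlinarith
    have h6 := expQ ((m:ℂ) * Pz χ) Kz (by
      rw [norm_mul, Complex.norm_real, Real.norm_of_nonneg hm.le]
      have := hn.1.le
      rw [le_div_iff₀ (by positivity)] at this
      linarith)
    have h7 : (m:ℂ) * Pz χ = ∑ p ∈ Pr Nz, ((m:ℂ) * b p) * χ (p:ZMod q) := by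
      simp only [hPz, pow_one, Finset.mul_sum]
      refine Finset.sum_congr rfl fun p _ => by ring
    rw [← h7]
    have h8 : Real.exp (2 * (m*(Pz χ).re)) = ‖Complex.exp ((m:ℂ) * Pz χ)‖^2 := by
      rw [Complex.norm_exp, ← Real.exp_nat_mul]
      congr 1
      simp
    calc Lf χ ^ (2*m) ≤ Real.exp (2*m*Real.log (Lf χ)) := h4
      _ ≤ Real.exp (2 * (m*(Pz χ).re) + (LL + 2*m*(C3+A3))) := Real.exp_le_exp.2 h5
      _ = ‖Complex.exp ((m:ℂ) * Pz χ)‖^2 * Real.exp (LL + 2*m*(C3+A3)) := by rw [Real.exp_add, h8]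
      _ ≤ (2 * ‖∑ j ∈ range (Kz+1), ((m:ℂ) * Pz χ)^j/j.factorial‖)^2 * Real.exp (LL + 2*m*(C3+A3)) := by gcongr
      _ = _ := by ring
  have hgoodsum : ∑ χ ∈ X \ Bad, Lf χ ^ (2*m) ≤ q.totient * (4*Real.exp (2*m*(C3+A3) + m^2*Cm) * Real.log q ^ (m^2+1)) := by
    refine (Finset.sum_le_sum hgood).trans ?_
    rw [← Finset.mul_sum]
    have h1 := A2_exp (X \ Bad) (Pr Nz) (fun p hp => (mem_Pr.1 hp).2) (fun p => (m:ℂ) * b p) Nz Kz hNz1 (fun p hp => (mem_Pr.1 hp).1) hNzK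
    have h2 : ∑ p ∈ Pr Nz, ‖(m:ℂ) * b p‖^2 ≤ m^2 * (LL + Cm) := by
      have : ∀ p ∈ Pr Nz, ‖(m:ℂ) * b p‖^2 = m^2 * ‖b p‖^2 := by
        intro p _
        rw [norm_mul, mul_pow, Complex.norm_real, Real.norm_of_nonneg hm.le]
      rw [Finset.sum_congr rfl this, ← Finset.mul_sum]
      exact mul_le_mul_of_nonneg_left hVz (by positivity)
    calc _ ≤ 4 * Real.exp (LL + 2*m*(C3+A3)) * (q.totient * Real.exp (m^2*(LL+Cm))) := by
          apply mul_le_mul_of_nonneg_left _ (by positivity)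
          exact h1.trans (by gcongr)
      _ = q.totient * (4 * (Real.exp (LL + 2*m*(C3+A3)) * Real.exp (m^2*(LL+Cm)))) := by ring
      _ = _ := by
          rw [hlogq, ← Real.exp_mul, ← Real.exp_add, mul_assoc 4 (Real.exp _) (Real.exp _), ← Real.exp_add]
          congr 3; ring
  have htot : ∑ χ ∈ X, Lf χ ^ (2*m) = ∑ χ ∈ X \ Bad, Lf χ ^ (2*m) + ∑ χ ∈ Bad, Lf χ ^ (2*m) :=
    (Finset.sum_sdiff hBadX).symm
  rw [htot]
  refine (add_le_add hgoodsum hbadsum).trans ?_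
  rw [← mul_add]
  apply mul_le_mul_of_nonneg_left _ hphi
  rw [add_mul]
  have h1 : 1 ≤ Real.log q ^ (m^2+1) := Real.one_le_rpow hlq1 (by positivity)
  have h2 : 3*Cc1+1 ≤ (3*Cc1+1) * Real.log q ^ (m^2+1) := le_mul_of_one_le_right (by positivity) h1
  linarith


lemma ker_bound (σ y : ℝ) (hσ : 1/2 ≤ σ) :
    ‖(1:ℂ) / (((σ:ℂ) + y * I) * ((σ:ℂ) + y * I + 1))‖ ≤ 4 * (1 + y^2)⁻¹ := by
  have h1 : ‖(σ:ℂ) + y * I‖ = Real.sqrt (σ^2 + y^2) := by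
    rw [Complex.norm_add_mul_I]
  have h2 : ‖(σ:ℂ) + y * I + 1‖ = Real.sqrt ((σ+1)^2 + y^2) := by
    rw [← Complex.norm_add_mul_I]; congr 1; push_cast; ring
  have h3 : (1 + y^2)/4 ≤ Real.sqrt (σ^2 + y^2) * Real.sqrt ((σ+1)^2 + y^2) := by
    have ha : Real.sqrt (σ^2 + y^2) ≤ Real.sqrt ((σ+1)^2 + y^2) := Real.sqrt_le_sqrt (by nlinarith)
    have hb : Real.sqrt (σ^2 + y^2) * Real.sqrt (σ^2 + y^2) = σ^2+y^2 := Real.mul_self_sqrt (by positivity)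
    have := Real.sqrt_nonneg (σ^2 + y^2)
    nlinarith
  rw [norm_div, norm_mul, h1, h2, norm_one]
  have h4 : 0 < (1 + y^2)/4 := by positivity
  calc _ ≤ 1 / ((1 + y^2)/4) := one_div_le_one_div_of_le h4 h3
    _ = _ := by field_simp

lemma ker_cont (σ : ℝ) (hσ : 1/2 ≤ σ) :
    Continuous fun y : ℝ => (1:ℂ) / (((σ:ℂ) + y * I) * ((σ:ℂ) + y * I + 1)) := by
  refine continuous_const.div (by fun_prop) fun y h => ?_
  rcases mul_eq_zero.1 h with h | h
  · have := congrArg Complex.re h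
    simp at this; linarith
  · have := congrArg Complex.re h
    simp at this; linarith

lemma ker_int (σ : ℝ) (hσ : 1/2 ≤ σ) :
    MeasureTheory.Integrable fun y : ℝ => (1:ℂ) / (((σ:ℂ) + y * I) * ((σ:ℂ) + y * I + 1)) :=
  (integrable_inv_one_add_sq.const_mul 4).mono' (ker_cont σ hσ).aestronglyMeasurable
    (Filter.Eventually.of_forall fun y => ker_bound σ y hσ)

lemma perron_kernel (x : ℝ) (hx : 0 < x) :
    ((1 / (2 * π) : ℝ) : ℂ) * ∫ y : ℝ, (x:ℂ)^(-((2:ℝ) + y * I) : ℂ) * (1 / ((((2:ℝ):ℂ) + y * I) * (((2:ℝ):ℂ) + y * I + 1)))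
      = ((max (1 - x) 0 : ℝ) : ℂ) := by
  set f : ℝ → ℂ := fun t => Set.indicator (Set.Ioc (0:ℝ) 1) (fun _ => 1 : ℝ → ℂ) t
    - Set.indicator (Set.Ioc (0:ℝ) 1) (fun t => (t:ℂ) ^ (1:ℂ) : ℝ → ℂ) t with hf
  have hM : ∀ s : ℂ, 0 < s.re → HasMellin f s (1/s - 1/(s+1)) := by
    intro s hs
    have h1 := hasMellin_one_Ioc hs
    have h2 := hasMellin_cpow_Ioc 1 (s := s) (by simp; linarith)
    have := hasMellin_sub h1.1 h2.1
    rwa [h1.2, h2.2] at this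
  have hfv : ∀ t : ℝ, 0 < t → f t = ((max (1 - t) 0 : ℝ) : ℂ) := by
    intro t ht
    simp only [hf, Set.indicator_apply, Set.mem_Ioc, ht, true_and]
    split_ifs with h
    · rw [max_eq_left (by linarith)]; simp
    · rw [max_eq_right (by linarith)]; simp
  have hmel : ∀ y : ℝ, mellin f (((2:ℝ):ℂ) + y * I) = 1 / ((((2:ℝ):ℂ) + y * I) * (((2:ℝ):ℂ) + y * I + 1)) := by
    intro y
    have h0 : (((2:ℝ):ℂ) + y * I) ≠ 0 := fun h => by
      have := congrArg Complex.re h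
      norm_num at this
    have h1 : (((2:ℝ):ℂ) + y * I + 1) ≠ 0 := fun h => by
      have := congrArg Complex.re h
      norm_num at this
    rw [(hM _ (by simp)).2]
    field_simp
    ring
  have hfx : ContinuousAt f x := by
    have h1 : ContinuousAt (fun t : ℝ => ((max (1 - t) 0 : ℝ) : ℂ)) x := by fun_prop
    refine h1.congr ?_
    filter_upwards [lt_mem_nhds hx] with t ht using (hfv t ht).symm
  have hV : VerticalIntegrable (mellin f) 2 := by
    unfold VerticalIntegrable
    simp_rw [hmel]
    exact ker_int 2 (by norm_num)
  have h := mellinInv_mellin_eq 2 f hx (hM _ (by simp)).1 hV hfx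
  rw [hfv x hx] at h
  rw [← h, mellinInv]
  simp_rw [hmel]
  simp only [smul_eq_mul]
  rw [Complex.real_smul]

lemma perron2 {q : ℕ} [NeZero q] (χ : DirichletCharacter ℂ q) (u : ℝ) (hu : 0 < u) :
    ∑ n ∈ Icc 1 ⌊u⌋₊, χ n * ((u - n : ℝ) : ℂ) = ((1 / (2 * π) : ℝ) : ℂ) *
      ∫ y : ℝ, DirichletCharacter.LFunction χ (((2:ℝ):ℂ) + y * I) * (u:ℂ)^(((2:ℝ):ℂ) + y * I + 1) *
        (1 / ((((2:ℝ):ℂ) + y * I) * (((2:ℝ):ℂ) + y * I + 1))) := by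
  set K : ℝ → ℂ := fun y => 1 / ((((2:ℝ):ℂ) + y * I) * (((2:ℝ):ℂ) + y * I + 1)) with hK
  have huC : (u:ℂ) ≠ 0 := by exact_mod_cast hu.ne'
  set F : ℕ → ℝ → ℂ := fun n y => u * (χ ((n+1:ℕ)) * (((((n+1:ℕ):ℝ) / u : ℝ) : ℂ)^(-((2:ℝ) + y * I) : ℂ) * K y)) with hF
  have hpos : ∀ n : ℕ, 0 < ((n+1:ℕ):ℝ)/u := fun n => by positivity
  have hnorm : ∀ n y, ‖F n y‖ ≤ (u^3 * 4 * (1+y^2)⁻¹) * (((n+1:ℕ):ℝ)^2)⁻¹ := by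
    intro n y
    have h1 := ker_bound 2 y (by norm_num)
    have h2 : ‖χ ((n+1:ℕ))‖ ≤ 1 := DirichletCharacter.norm_le_one χ _
    have h3 : ‖((((n+1:ℕ):ℝ) / u : ℝ) : ℂ)^(-((2:ℝ) + y * I) : ℂ)‖ = (((n+1:ℕ):ℝ)/u)^(-2:ℝ) := by
      rw [Complex.norm_cpow_eq_rpow_re_of_pos (hpos n)]
      simp
    rw [hF]; simp only
    rw [norm_mul, norm_mul, norm_mul, h3, Complex.norm_real, Real.norm_of_nonneg hu.le]
    have h4 : (((n+1:ℕ):ℝ)/u)^(-2:ℝ) = u^2 * (((n+1:ℕ):ℝ)^2)⁻¹ := by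
      rw [Real.rpow_neg (hpos n).le]
      rw [show (2:ℝ) = ((2:ℕ):ℝ) by norm_num, Real.rpow_natCast, div_pow, inv_div]
      rfl
    rw [h4]
    calc u * (‖χ ((n+1:ℕ))‖ * (u^2 * (((n+1:ℕ):ℝ)^2)⁻¹ * ‖K y‖))
        ≤ u * (1 * (u^2 * (((n+1:ℕ):ℝ)^2)⁻¹ * (4 * (1+y^2)⁻¹))) := by gcongr
      _ = _ := by ring
  have hcont : ∀ n, Continuous (F n) := by
    intro n
    have hne : ((((n+1:ℕ):ℝ)/u : ℝ):ℂ) ≠ 0 := by exact_mod_cast (hpos n).ne'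
    have := ker_cont 2 (by norm_num)
    refine continuous_const.mul (continuous_const.mul (Continuous.mul ?_ this))
    exact Continuous.const_cpow (by fun_prop) (Or.inl hne)
  have hintg : ∀ n, MeasureTheory.Integrable (F n) := by
    intro n
    refine MeasureTheory.Integrable.mono' (g := fun y => (u^3 * 4 * (1+y^2)⁻¹) * (((n+1:ℕ):ℝ)^2)⁻¹) ?_ (hcont n).aestronglyMeasurable
      (Filter.Eventually.of_forall fun y => hnorm n y)
    exact (integrable_inv_one_add_sq.const_mul _).mul_const _
  have hs2 : Summable fun n : ℕ => (((n+1:ℕ):ℝ)^2)⁻¹ :=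
    (summable_nat_add_iff (f := fun n : ℕ => ((n:ℝ)^2)⁻¹) 1).2 (Real.summable_nat_pow_inv.2 (by norm_num))
  have hsum : Summable fun n => ∫ y, ‖F n y‖ := by
    refine Summable.of_nonneg_of_le (fun n => MeasureTheory.integral_nonneg fun y => norm_nonneg _) (fun n => ?_)
      (hs2.mul_left (∫ y : ℝ, u^3 * 4 * (1+y^2)⁻¹))
    rw [← MeasureTheory.integral_mul_const]
    exact MeasureTheory.integral_mono (hintg n).norm ((integrable_inv_one_add_sq.const_mul _).mul_const _) (hnorm n)
  have hH := MeasureTheory.hasSum_integral_of_summable_integral_norm hintg hsum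
  have hLs : ∀ y : ℝ, ∑' n, F n y = DirichletCharacter.LFunction χ (((2:ℝ):ℂ) + y * I) * (u:ℂ)^(((2:ℝ):ℂ) + y * I + 1) * K y := by
    intro y
    rw [DirichletCharacter.LFunction_eq_LSeries χ (by simp)]
    have hsm : LSeriesSummable (χ ·) (((2:ℝ):ℂ) + y * I) :=
      DirichletCharacter.LSeriesSummable_of_one_lt_re χ (by simp)
    rw [LSeries, hsm.tsum_eq_zero_add, LSeries.term_zero, zero_add, ← tsum_mul_right, ← tsum_mul_right]
    refine tsum_congr fun n => ?_
    rw [LSeries.term_of_ne_zero (by omega), hF]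
    simp only
    have : ((((n+1:ℕ):ℝ) / u : ℝ) : ℂ)^(-((2:ℝ) + y * I) : ℂ) = (u:ℂ)^(((2:ℝ) + y * I) : ℂ) / ((n+1:ℕ):ℂ)^(((2:ℝ) + y * I) : ℂ) := by
      rw [Complex.cpow_neg, Complex.ofReal_div, Complex.div_cpow_ofReal_nonneg (by positivity) hu.le, inv_div]
      simp
    rw [this, Complex.cpow_add (((2:ℝ):ℂ) + y * I) 1 huC, Complex.cpow_one]
    ring
  have hv : ∀ n, ((1 / (2 * π) : ℝ) : ℂ) * ∫ y, F n y = χ ((n+1:ℕ)) * ((max (u - (n+1:ℕ)) 0 : ℝ) : ℂ) := by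
    intro n
    have h := perron_kernel _ (hpos n)
    have h2 : ∫ y, F n y = u * (χ ((n+1:ℕ)) * ∫ y : ℝ, ((((n+1:ℕ):ℝ) / u : ℝ) : ℂ)^(-((2:ℝ) + y * I) : ℂ) * K y) := by
      rw [← MeasureTheory.integral_const_mul, ← MeasureTheory.integral_const_mul]
    rw [h2]
    have h3 : ((max (u - (n+1:ℕ)) 0 : ℝ) : ℂ) = u * ((max (1 - ((n+1:ℕ):ℝ)/u) 0 : ℝ) : ℂ) := by
      rw [← Complex.ofReal_mul, mul_max_of_nonneg _ _ hu.le, mul_zero]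
      congr 3
      field_simp
    rw [h3, ← h]; ring
  have hI : (∫ y : ℝ, DirichletCharacter.LFunction χ (((2:ℝ):ℂ) + y * I) * (u:ℂ)^(((2:ℝ):ℂ) + y * I + 1) *
        (1 / ((((2:ℝ):ℂ) + y * I) * (((2:ℝ):ℂ) + y * I + 1)))) = ∫ y : ℝ, ∑' n, F n y :=
    MeasureTheory.integral_congr_ae (Filter.Eventually.of_forall fun y => (hLs y).symm)
  rw [hI, ← hH.tsum_eq, ← tsum_mul_left]
  simp_rw [hv]
  rw [tsum_eq_sum (s := range ⌊u⌋₊)]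
  · rw [Finset.sum_bij' (fun n _ => n - 1) (fun n _ => n + 1)]
    · intro n hn; simp at hn ⊢; omega
    · intro n hn; simp at hn ⊢; omega
    · intro n hn; simp at hn ⊢; omega
    · intro n hn; simp
    · intro n hn
      simp only [Finset.mem_Icc] at hn
      have h1 : n - 1 + 1 = n := by omega
      rw [h1, max_eq_left]
      have : (n:ℝ) ≤ u := (Nat.le_floor_iff hu.le).1 hn.2
      linarith
  · intro n hn
    simp only [Finset.mem_range, not_lt] at hn
    rw [max_eq_right]; · simp
    have := Nat.lt_floor_add_one u
    have : (⌊u⌋₊:ℝ) ≤ n := by exact_mod_cast hn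
    push_cast; linarith


lemma L2_bound {q : ℕ} [NeZero q] (χ : DirichletCharacter ℂ q) (y : ℝ) :
    ‖DirichletCharacter.LFunction χ (((2:ℝ):ℂ) + y * I)‖ ≤ B2 := by
  rw [DirichletCharacter.LFunction_eq_LSeries χ (by simp)]
  refine tsum_of_norm_bounded B2_summable.hasSum fun n => ?_
  rcases eq_or_ne n 0 with rfl | hn
  · simp
  rw [LSeries.norm_term_eq, if_neg hn]
  have h2 : ‖χ (n:ZMod q)‖ ≤ 1 := DirichletCharacter.norm_le_one χ _
  have : (((2:ℝ):ℂ) + y * I).re = ((2:ℕ):ℝ) := by simp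
  rw [this, Real.rpow_natCast, inv_eq_one_div]
  gcongr

lemma perronS {q : ℕ} [NeZero q] (χ : DirichletCharacter ℂ q) (hχ : χ ≠ 1) (σ K : ℝ) (h1 : 1/2 ≤ σ) (h2 : σ ≤ 2)
    (hL : ∀ t : ℝ, ‖DirichletCharacter.LFunction χ ((σ:ℂ) + t * I)‖ ≤ K * (1+t^2)^((1:ℝ)/8)) (u : ℝ) (hu : 0 < u) :
    MeasureTheory.Integrable (fun y : ℝ => DirichletCharacter.LFunction χ ((σ:ℂ) + y * I) * (u:ℂ)^((σ:ℂ) + y * I + 1) *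
        (1 / (((σ:ℂ) + y * I) * ((σ:ℂ) + y * I + 1)))) ∧
    ∑ n ∈ Icc 1 ⌊u⌋₊, χ n * ((u - n : ℝ) : ℂ) = ((1 / (2 * π) : ℝ) : ℂ) *
      ∫ y : ℝ, DirichletCharacter.LFunction χ ((σ:ℂ) + y * I) * (u:ℂ)^((σ:ℂ) + y * I + 1) *
        (1 / (((σ:ℂ) + y * I) * ((σ:ℂ) + y * I + 1))) := by
  have huC : (u:ℂ) ≠ 0 := by exact_mod_cast hu.ne'
  have hLd := DirichletCharacter.differentiable_LFunction hχ
  have hcont : ∀ x : ℝ, 1/2 ≤ x → Continuous (fun y : ℝ => DirichletCharacter.LFunction χ ((x:ℂ) + y * I) * (u:ℂ)^((x:ℂ) + y * I + 1) *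
        (1 / (((x:ℂ) + y * I) * ((x:ℂ) + y * I + 1)))) := by
    intro x hx
    refine Continuous.mul (Continuous.mul (hLd.continuous.comp (by fun_prop)) ?_) (ker_cont x hx)
    exact Continuous.const_cpow (by fun_prop) (Or.inl huC)
  have hun : ∀ x y : ℝ, ‖(u:ℂ)^((x:ℂ) + y * I + 1)‖ = u^(x+1) := by
    intro x y
    rw [Complex.norm_cpow_eq_rpow_re_of_pos hu]; simp
  have hintg : ∀ x K : ℝ, 1/2 ≤ x → (∀ t : ℝ, ‖DirichletCharacter.LFunction χ ((x:ℂ) + t * I)‖ ≤ K * (1+t^2)^((1:ℝ)/8)) →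
      MeasureTheory.Integrable (fun y : ℝ => DirichletCharacter.LFunction χ ((x:ℂ) + y * I) * (u:ℂ)^((x:ℂ) + y * I + 1) *
        (1 / (((x:ℂ) + y * I) * ((x:ℂ) + y * I + 1)))) := by
    intro x K hx hK
    have hi : MeasureTheory.Integrable (fun y : ℝ => (1 + ‖y‖^2)^(-((7:ℝ)/4)/2)) :=
      integrable_rpow_neg_one_add_norm_sq (by simp; norm_num)
    refine (hi.const_mul (K * u^(x+1) * 4)).mono' (hcont x hx).aestronglyMeasurable (Filter.Eventually.of_forall fun y => ?_)
    rw [norm_mul, norm_mul, hun]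
    have hk := ker_bound x y hx
    have hKy := hK y
    have hp : (1 + ‖y‖^2)^(-((7:ℝ)/4)/2) = (1+y^2)^((1:ℝ)/8) * (1+y^2)⁻¹ := by
      rw [Real.norm_eq_abs, sq_abs, ← Real.rpow_neg_one, ← Real.rpow_add (by positivity)]
      norm_num
    rw [hp]
    calc _ ≤ (K * (1+y^2)^((1:ℝ)/8)) * u^(x+1) * (4 * (1+y^2)⁻¹) := by
          gcongr
          exact mul_nonneg (le_trans (norm_nonneg _) hKy) (Real.rpow_nonneg hu.le _)
      _ = _ := by ring
  refine ⟨hintg σ K h1 hL, ?_⟩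
  rw [perron2 χ u hu]
  congr 1
  symm
  have hB : ∀ t : ℝ, ‖DirichletCharacter.LFunction χ (((2:ℝ):ℂ) + t * I)‖ ≤ B2 * (1+t^2)^((1:ℝ)/8) := by
    intro t
    refine (L2_bound χ t).trans (le_mul_of_one_le_right B2_nonneg (Real.one_le_rpow ?_ (by norm_num)))
    nlinarith [sq_nonneg t]
  have hvs := vert_shift (fun w => DirichletCharacter.LFunction χ w * (u:ℂ)^(w + 1) * (1 / (w * (w + 1)))) σ 2 h2 ?_
    (fun r => (2 * q * (max 1 u)^(3:ℝ)) / r) ?_ ?_ (hintg σ K h1 hL) (hintg 2 B2 (by norm_num) hB)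
  · exact hvs
  · intro w hw
    simp only [Set.mem_ofPred_eq] at hw
    have hw0 : w * (w+1) ≠ 0 := by
      refine mul_ne_zero (fun h => ?_) (fun h => ?_)
      · rw [h] at hw; simp at hw; linarith
      · have := congrArg Complex.re h
        simp at this; linarith
    refine DifferentiableAt.differentiableWithinAt ?_
    refine DifferentiableAt.mul (DifferentiableAt.mul hLd.differentiableAt ?_) (DifferentiableAt.div (by fun_prop) (by fun_prop) hw0)
    exact DifferentiableAt.const_cpow (by fun_prop) (Or.inl huC)
  · exact tendsto_const_nhds.div_atTop Filter.tendsto_id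
  · intro x y hx hx2 hy
    rw [norm_mul, norm_mul, hun, norm_div, norm_mul, norm_one]
    have hLb := L_bound χ hχ (s := (x:ℂ) + y * I) (by simp; linarith)
    have hre : ((x:ℂ) + y * I).re = x := by simp
    rw [hre] at hLb
    have hs : |y| ≤ ‖(x:ℂ) + y * I + 1‖ := by
      have := Complex.abs_im_le_norm ((x:ℂ) + y * I + 1)
      simpa using this
    have hs0 : |y| ≤ ‖(x:ℂ) + y * I‖ := by
      have := Complex.abs_im_le_norm ((x:ℂ) + y * I)
      simpa using this
    have hy0 : 0 < |y| := by linarith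
    have hs0' : 0 < ‖(x:ℂ) + y * I‖ := by linarith
    have hs' : 0 < ‖(x:ℂ) + y * I + 1‖ := by linarith
    have hx0 : 0 < x := by linarith
    have hup : u^(x+1) ≤ (max 1 u)^(3:ℝ) := by
      calc u^(x+1) ≤ (max 1 u)^(x+1) := Real.rpow_le_rpow hu.le (le_max_right _ _) (by linarith)
        _ ≤ _ := Real.rpow_le_rpow_of_exponent_le (le_max_left _ _) (by linarith)
    have hm0 : 0 < max 1 u := by positivity
    calc _ ≤ (q * ‖(x:ℂ) + y * I‖ / x) * (max 1 u)^(3:ℝ) * (1 / (‖(x:ℂ) + y * I‖ * ‖(x:ℂ) + y * I + 1‖)) := by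
          gcongr
      _ = q * (1/x) * (max 1 u)^(3:ℝ) * (1/‖(x:ℂ) + y * I + 1‖) := by field_simp
      _ ≤ q * 2 * (max 1 u)^(3:ℝ) * (1/|y|) := by
          gcongr
          rw [div_le_iff₀ hx0]; linarith
      _ = _ := by ring


lemma R_ext {q : ℕ} (χ : DirichletCharacter ℂ q) (u : ℝ) (N : ℕ) (hu : 0 < u) (hN : ⌊u⌋₊ ≤ N) :
    ∑ n ∈ Icc 1 ⌊u⌋₊, χ n * ((u - n : ℝ) : ℂ) = ∑ n ∈ Icc 1 N, χ n * ((max (u - n) 0 : ℝ) : ℂ) := by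
  rw [← Finset.sum_subset (Finset.Icc_subset_Icc_right hN)]
  · refine Finset.sum_congr rfl fun n hn => ?_
    rw [max_eq_left]
    have : (n:ℝ) ≤ u := (Nat.le_floor_iff hu.le).1 (Finset.mem_Icc.1 hn).2
    linarith
  · intro n hn hn'
    have h1 : ⌊u⌋₊ < n := by
      by_contra h
      exact hn' (Finset.mem_Icc.2 ⟨(Finset.mem_Icc.1 hn).1, not_lt.1 h⟩)
    have := (Nat.floor_lt hu.le).1 h1
    rw [max_eq_right (by linarith)]; simp

lemma S_ident {q : ℕ} (χ : DirichletCharacter ℂ q) (y T : ℝ) (hy : 2 ≤ y) (hT1 : 1 ≤ T) (hT2 : T ≤ y/2)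
    (f : ℝ → ℝ) (hf : ∀ x : ℝ, 0 < x → f x = if x ≤ y - T then 1 else if x ≤ y then 1 - (x - y + T) / T else 0) :
    ∑ n ∈ Finset.Icc 1 ⌊y⌋₊, (1 - (f n : ℂ)) * χ n =
      (((⌊y⌋₊ - (y - T)) / T : ℝ) : ℂ) * ∑ n ∈ Icc 1 ⌊(⌊y⌋₊ + 1 : ℝ)⌋₊, χ n * (((⌊y⌋₊ + 1 : ℝ) - n : ℝ) : ℂ)
      - (((⌊y⌋₊ - (y - T)) / T + 1 / T : ℝ) : ℂ) * ∑ n ∈ Icc 1 ⌊(⌊y⌋₊ : ℝ)⌋₊, χ n * (((⌊y⌋₊ : ℝ) - n : ℝ) : ℂ)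
      + ((1 / T : ℝ) : ℂ) * ∑ n ∈ Icc 1 ⌊y - T⌋₊, χ n * ((y - T - n : ℝ) : ℂ) := by
  set N := ⌊y⌋₊ with hN
  have hNy : (N:ℝ) ≤ y := Nat.floor_le (by linarith)
  have hN2 : 2 ≤ N := Nat.le_floor (by exact_mod_cast hy)
  have hN2' : (2:ℝ) ≤ N := by exact_mod_cast hN2
  have h1 : ∑ n ∈ Icc 1 ⌊(N + 1 : ℝ)⌋₊, χ n * (((N + 1 : ℝ) - n : ℝ) : ℂ) = ∑ n ∈ Icc 1 N, χ n * (((N + 1 : ℝ) - n : ℝ) : ℂ) := by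
    rw [show ⌊(N + 1 : ℝ)⌋₊ = N + 1 by rw [Nat.floor_add_one (by positivity), Nat.floor_natCast]]
    rw [Finset.sum_Icc_succ_top (by omega)]
    simp
  rw [h1, R_ext χ (y - T) N (by linarith) (Nat.floor_le_floor (by linarith)), Nat.floor_natCast,
    Finset.mul_sum, Finset.mul_sum, Finset.mul_sum, ← Finset.sum_sub_distrib, ← Finset.sum_add_distrib]
  refine Finset.sum_congr rfl fun n hn => ?_
  have hn1 := Finset.mem_Icc.1 hn
  have hn0 : (0:ℝ) < n := by exact_mod_cast hn1.1
  have hnN : (n:ℝ) ≤ N := by exact_mod_cast hn1.2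
  have key : 1 - f n = (N - (y - T)) / T * (N + 1 - n) - ((N - (y - T)) / T + 1 / T) * (N - n) + 1 / T * max (y - T - n) 0 := by
    rw [hf n hn0]
    have hT0 : T ≠ 0 := by linarith
    split_ifs with h h'
    · rw [max_eq_left (by linarith)]; field_simp; ring
    · rw [max_eq_right (by linarith)]; field_simp; ring
    · linarith
  have keyC : 1 - (f n : ℂ) = ((1 - f n : ℝ) : ℂ) := by push_cast; ring
  rw [keyC, key]
  push_cast; ring

lemma cpow_diff (a b : ℝ) (ha : 0 < a) (hab : a ≤ b) (s : ℂ) (hs : 0 < s.re) :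
    ‖(b:ℂ)^(s+1) - (a:ℂ)^(s+1)‖ ≤ ‖s+1‖ * b^s.re * (b - a) := by
  have h := Convex.norm_image_sub_le_of_norm_hasDerivWithin_le (f := fun x : ℝ => (x:ℂ)^(s+1))
    (f' := fun x : ℝ => (s+1) * (x:ℂ)^s) (s := Set.Icc a b) (C := ‖s+1‖ * b^s.re) (x := a) (y := b) ?_ ?_ (convex_Icc a b)
    (Set.left_mem_Icc.2 hab) (Set.right_mem_Icc.2 hab)
  · rwa [Real.norm_of_nonneg (by linarith)] at h
  · intro x hx
    have hx0 : x ≠ 0 := by linarith [hx.1]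
    have hs1 : s + 1 ≠ 0 := fun h => by
      have := congrArg Complex.re h
      simp at this; linarith
    have := hasDerivAt_ofReal_cpow_const hx0 hs1
    rw [show s + 1 - 1 = s by ring] at this
    exact this.hasDerivWithinAt
  · intro x hx
    have hx0 : 0 < x := by linarith [hx.1]
    rw [norm_mul, Complex.norm_cpow_eq_rpow_re_of_pos hx0]
    gcongr
    exact hx.2


lemma L_growth : ∃ D : ℝ, 0 ≤ D ∧ ∀ (q : ℕ) [NeZero q], 3 ≤ q → D ≤ Real.log q →
    ∀ χ : DirichletCharacter ℂ q, χ ≠ 1 → dirichletRH χ → ∀ t : ℝ,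
    ‖DirichletCharacter.LFunction χ (((1/2 + 1/Real.log q : ℝ):ℂ) + t * I)‖
      ≤ (2 * Real.exp D * (q:ℝ)^((1:ℝ)/4)) * (1+t^2)^((1:ℝ)/8) := by
  obtain ⟨_,_,_,_,_,_,_,_,D,hD0,hD⟩ := Ubound
  refine ⟨D, hD0, fun q _ hq hDq χ hχ hRH t => ?_⟩
  have h := hD q hq t hDq χ hχ hRH
  have hcast : (((1/2 + 1/Real.log q : ℝ):ℂ) + t * I) = 1/2 + ((1/Real.log q:ℝ):ℂ) + t*I := by push_cast; ring
  rw [hcast]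
  set z := ‖DirichletCharacter.LFunction χ (1/2 + ((1/Real.log q:ℝ):ℂ) + t*I)‖ with hz
  have hq0 : (0:ℝ) < q := by exact_mod_cast (by omega : 0 < q)
  have hz0 : 0 ≤ z := by rw [hz]; exact norm_nonneg _
  clear_value z
  rcases hz0.eq_or_lt with h0 | h0
  · rw [← h0]; positivity
  have h1 : z ≤ Real.exp (D + LQ q t / 4) := by
    rw [← Real.exp_log h0]; exact Real.exp_le_exp.2 h
  refine h1.trans ?_
  have hpos : 0 < (q:ℝ) * (|t|+4) := by positivity
  have h2 : Real.exp (LQ q t / 4) = (q:ℝ)^((1:ℝ)/4) * (|t|+4)^((1:ℝ)/4) := by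
    rw [← Real.mul_rpow hq0.le (by positivity), Real.rpow_def_of_pos hpos, LQ]
    congr 1; ring
  have h3 : (|t|+4)^((1:ℝ)/4) ≤ 2 * (1+t^2)^((1:ℝ)/8) := by
    have e1 : (|t|+4)^((1:ℝ)/4) = ((|t|+4)^2)^((1:ℝ)/8) := by
      rw [← Real.rpow_natCast, ← Real.rpow_mul (by positivity)]; norm_num
    have e2 : (|t|+4)^2 ≤ 256 * (1+t^2) := by
      have := sq_abs t
      nlinarith [sq_nonneg (4*|t| - 1), abs_nonneg t]
    have e3 : (256:ℝ)^((1:ℝ)/8) = 2 := by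
      rw [show (256:ℝ) = 2^(8:ℝ) by norm_num, ← Real.rpow_mul (by norm_num)]; norm_num
    rw [e1]
    calc _ ≤ (256 * (1+t^2))^((1:ℝ)/8) := Real.rpow_le_rpow (by positivity) e2 (by norm_num)
      _ = _ := by rw [Real.mul_rpow (by norm_num) (by positivity), e3]
  rw [Real.exp_add, h2]
  calc _ ≤ Real.exp D * ((q:ℝ)^((1:ℝ)/4) * (2 * (1+t^2)^((1:ℝ)/8))) := by gcongr
    _ = _ := by ring

lemma integral_comb (a b c : ℂ) (F G H : ℝ → ℂ) (hF : MeasureTheory.Integrable F) (hG : MeasureTheory.Integrable G)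
    (hH : MeasureTheory.Integrable H) :
    ∫ t, (a * F t - b * G t + c * H t) = a * (∫ t, F t) - b * (∫ t, G t) + c * (∫ t, H t) := by
  have h1 := MeasureTheory.integral_add ((hF.const_mul a).sub (hG.const_mul b)) (hH.const_mul c)
  have h2 := MeasureTheory.integral_sub (hF.const_mul a) (hG.const_mul b)
  rw [MeasureTheory.integral_const_mul, MeasureTheory.integral_const_mul] at h2
  rw [MeasureTheory.integral_const_mul] at h1
  exact h1.trans (by rw [← h2]; rfl)

set_option maxHeartbeats 1000000 in
theorem pointwise : ∃ Cd : ℝ, 0 ≤ Cd ∧ ∃ q0 : ℕ, ∀ (q : ℕ) [NeZero q], q0 ≤ q →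
    ∀ y T : ℝ, 2 ≤ y → y ≤ q → 1 ≤ T → T ≤ y/2 →
    ∀ f : ℝ → ℝ, (∀ x : ℝ, 0 < x → f x = if x ≤ y - T then 1 else if x ≤ y then 1 - (x - y + T) / T else 0) →
    ∀ χ : DirichletCharacter ℂ q, χ ≠ 1 → dirichletRH χ →
    ‖∑ n ∈ Finset.Icc 1 ⌊y⌋₊, (1 - (f n : ℂ)) * χ n‖ ≤ Cd * y^((1:ℝ)/2) *
      (1 + ∫ t in (-(q:ℝ)^2)..((q:ℝ)^2), ‖DirichletCharacter.LFunction χ (((1/2 + 1/Real.log q : ℝ):ℂ) + t * I)‖ * (1+|t|)⁻¹) := by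
  obtain ⟨D, hD0, hD⟩ := L_growth
  set J : ℝ := ∫ t : ℝ, (1 + ‖t‖^2)^(-((9:ℝ)/8)/2) with hJ
  have hJ0 : 0 ≤ J := MeasureTheory.integral_nonneg fun t => by positivity
  have hJi : MeasureTheory.Integrable (fun t : ℝ => (1 + ‖t‖^2)^(-((9:ℝ)/8)/2)) :=
    integrable_rpow_neg_one_add_norm_sq (by simp; norm_num)
  obtain ⟨q1, hq1⟩ := Filter.eventually_atTop.1 (ev_log (max D 2))
  refine ⟨2 * Real.exp 2 * (6 + 64 * Real.exp D * J), by positivity, max q1 3, ?_⟩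
  intro q _ hq y T hy hyq hT1 hT2 f hf χ hχ hRH
  have hlq := hq1 q (le_trans (le_max_left _ _) hq)
  have hq3 : 3 ≤ q := le_trans (le_max_right _ _) hq
  have hlD : D ≤ Real.log q := le_trans (le_max_left _ _) hlq
  have hl2 : 2 ≤ Real.log q := le_trans (le_max_right _ _) hlq
  have hq0 : (0:ℝ) < q := by exact_mod_cast (by omega : 0 < q)
  have hq1' : (1:ℝ) ≤ q := by exact_mod_cast (by omega : 1 ≤ q)
  set σ : ℝ := 1/2 + 1/Real.log q with hσ
  have hσl : 0 < 1/Real.log q := by positivity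
  have hσ1 : 1/2 ≤ σ := by linarith
  have hσ2 : σ ≤ 1 := by
    have : 1/Real.log q ≤ 1/2 := one_div_le_one_div_of_le (by norm_num) hl2
    linarith
  have hL := hD q hq3 hlD χ hχ hRH
  set N := ⌊y⌋₊ with hN
  have hNy : (N:ℝ) ≤ y := Nat.floor_le (by linarith)
  have hNy' : y < N + 1 := Nat.lt_floor_add_one y
  have hN2 : 2 ≤ N := Nat.le_floor (by exact_mod_cast hy)
  have hN2' : (2:ℝ) ≤ N := by exact_mod_cast hN2
  have hY0 : 0 < y - T := by linarith
  have hT0 : 0 < T := by linarith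
  have hNY : y - T ≤ N := by linarith
  set α : ℝ := (N - (y - T)) / T with hα
  have hα0 : 0 ≤ α := div_nonneg (by linarith) hT0.le
  have hα1 : α ≤ 1 := by rw [hα, div_le_one hT0]; linarith
  obtain ⟨i1, e1⟩ := perronS χ hχ σ _ hσ1 (by linarith) hL (N+1) (by positivity)
  obtain ⟨i2, e2⟩ := perronS χ hχ σ _ hσ1 (by linarith) hL N (by linarith)
  obtain ⟨i3, e3⟩ := perronS χ hχ σ _ hσ1 (by linarith) hL (y-T) hY0
  have hS := S_ident χ y T hy hT1 hT2 f hf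
  rw [← hN, ← hα, e1, e2, e3] at hS
  set Lf : ℝ → ℂ := fun t => DirichletCharacter.LFunction χ ((σ:ℂ) + t * I) with hLf
  set ker : ℝ → ℂ := fun t => (1:ℂ) / (((σ:ℂ) + t * I) * ((σ:ℂ) + t * I + 1)) with hker
  set num : ℝ → ℂ := fun t => (α:ℂ) * ((((N+1:ℝ):ℂ))^((σ:ℂ) + t * I + 1) - (((N:ℝ):ℂ))^((σ:ℂ) + t * I + 1))
    - ((1/T:ℝ):ℂ) * ((((N:ℝ):ℂ))^((σ:ℂ) + t * I + 1) - (((y-T:ℝ):ℂ))^((σ:ℂ) + t * I + 1)) with hnum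
  have hSint : ∑ n ∈ Finset.Icc 1 N, (1 - (f n : ℂ)) * χ n = ((1 / (2 * π) : ℝ) : ℂ) * ∫ t : ℝ, Lf t * num t * ker t := by
    rw [hS]
    have : (fun t => Lf t * num t * ker t) = fun t => ((α:ℂ) * (Lf t * (((N+1:ℝ):ℂ))^((σ:ℂ) + t * I + 1) * ker t)
        - ((α + 1/T:ℝ):ℂ) * (Lf t * (((N:ℝ):ℂ))^((σ:ℂ) + t * I + 1) * ker t))
        + ((1/T:ℝ):ℂ) * (Lf t * (((y-T:ℝ):ℂ))^((σ:ℂ) + t * I + 1) * ker t) := by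
      funext t
      rw [hnum]; push_cast; ring
    rw [this]
    refine Eq.trans ?_ (congrArg _ (integral_comb (α:ℂ) ((α + 1/T:ℝ):ℂ) ((1/T:ℝ):ℂ) _ _ _ i1 i2 i3).symm)
    ring
  rw [hSint]
  have hre : ∀ t : ℝ, ((σ:ℂ) + t * I).re = σ := by intro t; simp
  have hre1 : ∀ t : ℝ, ((σ:ℂ) + t * I + 1).re = σ + 1 := by intro t; simp
  have hσ0 : 0 < σ := by linarith
  have hy1 : 0 < y + 1 := by linarith
  set P := (y+1)^σ with hP
  have hP0 : 0 < P := by positivity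
  have hnum1 : ∀ t, ‖num t‖ ≤ 2 * ‖(σ:ℂ) + t * I + 1‖ * P := by
    intro t
    have c1 := cpow_diff N (N+1) (by linarith) (by linarith) ((σ:ℂ) + t * I) (by rw [hre]; exact hσ0)
    have c2 := cpow_diff (y-T) N hY0 hNY ((σ:ℂ) + t * I) (by rw [hre]; exact hσ0)
    rw [hre] at c1 c2
    have p1 : ((N:ℝ)+1)^σ ≤ P := Real.rpow_le_rpow (by positivity) (by linarith) hσ0.le
    have p2 : (N:ℝ)^σ ≤ P := Real.rpow_le_rpow (by positivity) (by linarith) hσ0.le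
    calc ‖num t‖ ≤ α * (‖(σ:ℂ) + t * I + 1‖ * (N+1:ℝ)^σ * (N+1 - N)) + (1/T) * (‖(σ:ℂ) + t * I + 1‖ * (N:ℝ)^σ * (N - (y-T))) := by
          refine (norm_sub_le _ _).trans ?_
          rw [norm_mul, norm_mul, Complex.norm_real, Complex.norm_real, Real.norm_of_nonneg hα0, Real.norm_of_nonneg (by positivity)]
          gcongr
      _ = α * (‖(σ:ℂ) + t * I + 1‖ * (N+1:ℝ)^σ) + α * (‖(σ:ℂ) + t * I + 1‖ * (N:ℝ)^σ) := by rw [hα]; ring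
      _ ≤ 1 * (‖(σ:ℂ) + t * I + 1‖ * P) + 1 * (‖(σ:ℂ) + t * I + 1‖ * P) := by gcongr
      _ = _ := by ring
  have hnum2 : ∀ t, ‖num t‖ ≤ 4 * (P * (y+1)) := by
    intro t
    have hb : ∀ u : ℝ, 0 < u → u ≤ y + 1 → ‖(u:ℂ)^((σ:ℂ) + t * I + 1)‖ ≤ P * (y+1) := by
      intro u hu huy
      rw [Complex.norm_cpow_eq_rpow_re_of_pos hu, hre1]
      calc u^(σ+1) ≤ (y+1)^(σ+1) := Real.rpow_le_rpow hu.le huy (by linarith)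
        _ = _ := by rw [Real.rpow_add hy1, Real.rpow_one]
    have b1 := hb (N+1) (by positivity) (by linarith)
    have b2 := hb N (by linarith) (by linarith)
    have b3 := hb (y-T) hY0 (by linarith)
    have hT1' : 1/T ≤ 1 := by rw [div_le_one hT0]; exact hT1
    have hPy : 0 ≤ P * (y+1) := by positivity
    calc ‖num t‖ ≤ α * (P * (y+1) + P * (y+1)) + (1/T) * (P * (y+1) + P * (y+1)) := by
          refine (norm_sub_le _ _).trans ?_
          rw [norm_mul, norm_mul, Complex.norm_real, Complex.norm_real, Real.norm_of_nonneg hα0, Real.norm_of_nonneg (by positivity)]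
          gcongr
          · exact (norm_sub_le _ _).trans (add_le_add b1 b2)
          · exact (norm_sub_le _ _).trans (add_le_add b2 b3)
      _ ≤ 1 * (P * (y+1) + P * (y+1)) + 1 * (P * (y+1) + P * (y+1)) := by gcongr
      _ = _ := by ring
  set Q : ℝ := (q:ℝ)^2 with hQ
  have hQ1 : 1 ≤ Q := by rw [hQ]; exact one_le_pow₀ hq1'
  have hLc : Continuous Lf := (DirichletCharacter.differentiable_LFunction hχ).continuous.comp (by fun_prop)
  have hwc : Continuous fun t : ℝ => ‖Lf t‖ * (1+|t|)⁻¹ :=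
    hLc.norm.mul (Continuous.inv₀ (by fun_prop) fun t => by positivity)
  have hbd : ∀ t : ℝ, ‖Lf t * num t * ker t‖ ≤ P * (6 * Set.indicator (Set.Ioc (-Q) Q) (fun t => ‖Lf t‖ * (1+|t|)⁻¹) t
      + 64 * Real.exp D * (1 + ‖t‖^2)^(-((9:ℝ)/8)/2)) := by
    intro t
    have hpn : 0 ≤ (1 + ‖t‖^2)^(-((9:ℝ)/8)/2) := by positivity
    rw [norm_mul, norm_mul]
    by_cases ht : t ∈ Set.Ioc (-Q) Q
    · rw [Set.indicator_of_mem ht]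
      have hs0 : |t| ≤ ‖(σ:ℂ) + t * I‖ := by
        have := Complex.abs_im_le_norm ((σ:ℂ) + t * I)
        simpa using this
      have hs1 : 1/2 ≤ ‖(σ:ℂ) + t * I‖ := by
        have := Complex.re_le_norm ((σ:ℂ) + t * I)
        rw [hre] at this; linarith
      have hs2 : 0 < ‖(σ:ℂ) + t * I + 1‖ := by
        have := Complex.re_le_norm ((σ:ℂ) + t * I + 1)
        rw [hre1] at this; linarith
      have hs3 : 0 < ‖(σ:ℂ) + t * I‖ := by linarith
      have hk : ‖ker t‖ = (‖(σ:ℂ) + t * I‖)⁻¹ * (‖(σ:ℂ) + t * I + 1‖)⁻¹ := by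
        rw [hker]; simp only [norm_div, norm_mul, norm_one, one_div, mul_inv, norm_inv]
      have hinv : (‖(σ:ℂ) + t * I‖)⁻¹ ≤ 3 * (1+|t|)⁻¹ := by
        rw [← div_eq_mul_inv, inv_eq_one_div, div_le_div_iff₀ hs3 (by positivity)]
        linarith
      calc ‖Lf t‖ * ‖num t‖ * ‖ker t‖ ≤ ‖Lf t‖ * (2 * ‖(σ:ℂ) + t * I + 1‖ * P) * ((‖(σ:ℂ) + t * I‖)⁻¹ * (‖(σ:ℂ) + t * I + 1‖)⁻¹) := by
            rw [hk]; gcongr; exact hnum1 t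
        _ = ‖Lf t‖ * (2 * P) * (‖(σ:ℂ) + t * I‖)⁻¹ * (‖(σ:ℂ) + t * I + 1‖ * (‖(σ:ℂ) + t * I + 1‖)⁻¹) := by ring
        _ = ‖Lf t‖ * (2 * P) * (‖(σ:ℂ) + t * I‖)⁻¹ := by rw [mul_inv_cancel₀ hs2.ne', mul_one]
        _ ≤ ‖Lf t‖ * (2 * P) * (3 * (1+|t|)⁻¹) := by gcongr
        _ = P * (6 * (‖Lf t‖ * (1+|t|)⁻¹)) := by ring
        _ ≤ _ := by
            have : 0 ≤ 64 * Real.exp D * (1 + ‖t‖^2)^(-((9:ℝ)/8)/2) := by positivity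
            gcongr; linarith
    · rw [Set.indicator_of_notMem ht]
      have htQ : Q ≤ |t| := by
        by_contra h
        push Not at h
        rw [abs_lt] at h
        exact ht ⟨h.1, h.2.le⟩
      have hq54 : (q:ℝ)^((5:ℝ)/4) ≤ (1+t^2)^((5:ℝ)/16) := by
        have : (q:ℝ)^((5:ℝ)/4) = (Q^2)^((5:ℝ)/16) := by
          rw [hQ, ← pow_mul, ← Real.rpow_natCast, ← Real.rpow_mul hq0.le]; norm_num
        rw [this]
        refine Real.rpow_le_rpow (by positivity) ?_ (by norm_num)
        have := sq_abs t
        nlinarith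
      have hkb := ker_bound σ t hσ1
      have hLt := hL t
      have hyq2 : y + 1 ≤ 2 * q := by linarith
      have hn2 := hnum2 t
      have hqq : (q:ℝ)^((1:ℝ)/4) * q = (q:ℝ)^((5:ℝ)/4) := by
        rw [← Real.rpow_add_one hq0.ne']; norm_num
      have hpw : (1 + ‖t‖^2)^(-((9:ℝ)/8)/2) = (1+t^2)^((5:ℝ)/16) * ((1+t^2)^((1:ℝ)/8) * (1+t^2)⁻¹) := by
        rw [Real.norm_eq_abs, sq_abs, ← Real.rpow_neg_one, ← Real.rpow_add (by positivity), ← Real.rpow_add (by positivity)]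
        norm_num
      calc ‖Lf t‖ * ‖num t‖ * ‖ker t‖ ≤ ((2 * Real.exp D * (q:ℝ)^((1:ℝ)/4)) * (1+t^2)^((1:ℝ)/8)) * (4 * (P * (2 * q))) * (4 * (1+t^2)⁻¹) := by
            refine mul_le_mul (mul_le_mul hLt (hn2.trans ?_) (norm_nonneg _) (by positivity)) hkb (norm_nonneg _) (by positivity)
            gcongr
        _ = P * (64 * Real.exp D * (((q:ℝ)^((1:ℝ)/4) * q) * ((1+t^2)^((1:ℝ)/8) * (1+t^2)⁻¹))) := by ring
        _ ≤ P * (64 * Real.exp D * ((1+t^2)^((5:ℝ)/16) * ((1+t^2)^((1:ℝ)/8) * (1+t^2)⁻¹))) := by rw [hqq]; gcongr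
        _ = _ := by rw [hpw]; ring
  have hindi : MeasureTheory.Integrable (Set.indicator (Set.Ioc (-Q) Q) (fun t => ‖Lf t‖ * (1+|t|)⁻¹)) :=
    (MeasureTheory.integrable_indicator_iff measurableSet_Ioc).2
      (hwc.integrableOn_Ioc)
  have hgi := (((hindi.const_mul 6).add (hJi.const_mul (64 * Real.exp D))).const_mul P)
  have hnI := MeasureTheory.norm_integral_le_of_norm_le hgi (Filter.Eventually.of_forall hbd)
  have hval : (∫ t, P * (6 * Set.indicator (Set.Ioc (-Q) Q) (fun t => ‖Lf t‖ * (1+|t|)⁻¹) t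
      + 64 * Real.exp D * (1 + ‖t‖^2)^(-((9:ℝ)/8)/2))) = P * (6 * (∫ t in (-Q)..Q, ‖Lf t‖ * (1+|t|)⁻¹) + 64 * Real.exp D * J) := by
    rw [MeasureTheory.integral_const_mul, MeasureTheory.integral_add (hindi.const_mul 6) (hJi.const_mul (64 * Real.exp D)),
      MeasureTheory.integral_const_mul, MeasureTheory.integral_const_mul, MeasureTheory.integral_indicator measurableSet_Ioc,
      intervalIntegral.integral_of_le (by linarith)]
  have hnI2 : ‖∫ t, Lf t * num t * ker t‖ ≤ P * (6 * (∫ t in (-Q)..Q, ‖Lf t‖ * (1+|t|)⁻¹) + 64 * Real.exp D * J) :=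
    hnI.trans (le_of_eq hval)
  have hI0 : 0 ≤ ∫ t in (-Q)..Q, ‖Lf t‖ * (1+|t|)⁻¹ :=
    intervalIntegral.integral_nonneg (by linarith) fun t _ => by positivity
  set Int := ∫ t in (-Q)..Q, ‖Lf t‖ * (1+|t|)⁻¹ with hInt
  have hPle : P ≤ 2 * Real.exp 2 * y^((1:ℝ)/2) := by
    rw [hP, hσ, Real.rpow_add hy1]
    have a1 : (y+1)^((1:ℝ)/2) ≤ 2 * y^((1:ℝ)/2) := by
      have : (4:ℝ)^((1:ℝ)/2) = 2 := by
        rw [show (4:ℝ) = 2^(2:ℝ) by norm_num, ← Real.rpow_mul (by norm_num)]; norm_num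
      calc (y+1)^((1:ℝ)/2) ≤ (4*y)^((1:ℝ)/2) := Real.rpow_le_rpow hy1.le (by linarith) (by norm_num)
        _ = _ := by rw [Real.mul_rpow (by norm_num) (by linarith), this]
    have a2 : (y+1)^(1/Real.log q) ≤ Real.exp 2 := by
      have hq3' : (3:ℝ) ≤ q := by exact_mod_cast hq3
      calc (y+1)^(1/Real.log q) ≤ ((q:ℝ)^2)^(1/Real.log q) := Real.rpow_le_rpow hy1.le (by nlinarith) hσl.le
        _ = Real.exp 2 := by
          rw [Real.rpow_def_of_pos (by positivity), Real.log_pow]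
          congr 1
          have : Real.log q ≠ 0 := by linarith
          field_simp; norm_num
    calc _ ≤ (2 * y^((1:ℝ)/2)) * Real.exp 2 := by gcongr
      _ = _ := by ring
  have hpi : ‖((1 / (2 * π) : ℝ) : ℂ)‖ ≤ 1 := by
    rw [Complex.norm_real, Real.norm_of_nonneg (by positivity), div_le_one (by positivity)]
    linarith [Real.pi_gt_three]
  rw [norm_mul]
  calc _ ≤ 1 * (P * (6 * Int + 64 * Real.exp D * J)) := by gcongr
    _ ≤ (2 * Real.exp 2 * y^((1:ℝ)/2)) * ((6 + 64 * Real.exp D * J) * (1 + Int)) := by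
        rw [one_mul]
        refine mul_le_mul hPle ?_ (by positivity) (by positivity)
        have : 0 ≤ 64 * Real.exp D * J * Int := by positivity
        nlinarith
    _ = _ := by ring


lemma jensen_w (g w : ℝ → ℝ) (hg : Continuous g) (hw : Continuous w) (hg0 : ∀ t, 0 ≤ g t) (hw0 : ∀ t, 0 < w t)
    (a b p : ℝ) (hab : a < b) (hp : 1 ≤ p) :
    (∫ t in a..b, g t * w t)^p ≤ (∫ t in a..b, w t)^(p-1) * ∫ t in a..b, g t ^ p * w t := by
  have hp0 : 0 < p := by linarith
  have hgp : Continuous fun t => g t ^ p := hg.rpow_const fun t => Or.inr hp0.le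
  set W := ∫ t in a..b, w t with hW
  have hW0 : 0 < W := intervalIntegral.intervalIntegral_pos_of_pos (hw.intervalIntegrable a b) hw0 hab
  have hI0 : 0 ≤ ∫ t in a..b, g t * w t := intervalIntegral.integral_nonneg hab.le fun t _ => mul_nonneg (hg0 t) (hw0 t).le
  set I0 := ∫ t in a..b, g t * w t with hI
  have hJ0 : 0 ≤ ∫ t in a..b, g t ^ p * w t := intervalIntegral.integral_nonneg hab.le fun t _ => mul_nonneg (Real.rpow_nonneg (hg0 t) _) (hw0 t).le
  clear_value I0
  rcases hI0.eq_or_lt with h0 | h0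
  · rw [← h0, Real.zero_rpow hp0.ne']; positivity
  set μ := I0 / W with hμ
  have hμ0 : 0 < μ := by positivity
  have hpt : ∀ t, μ^p * ((1 - p) * w t) + (μ^p * (p/μ)) * (g t * w t) ≤ g t ^ p * w t := by
    intro t
    have h1 := one_add_mul_self_le_rpow_one_add (s := g t / μ - 1) (by have := div_nonneg (hg0 t) hμ0.le; linarith) hp
    rw [show 1 + (g t / μ - 1) = g t / μ by ring, Real.div_rpow (hg0 t) hμ0.le, le_div_iff₀ (by positivity)] at h1
    have := mul_le_mul_of_nonneg_right h1 (hw0 t).le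
    refine le_trans (le_of_eq ?_) this
    field_simp
    ring
  have hwi := hw.intervalIntegrable (μ := MeasureTheory.volume) a b
  have hgwi := (hg.mul hw).intervalIntegrable (μ := MeasureTheory.volume) a b
  have hmono := intervalIntegral.integral_mono (μ := MeasureTheory.volume) hab.le
    (((hwi.const_mul (1-p)).const_mul (μ^p)).add (hgwi.const_mul (μ^p * (p/μ)))) ((hgp.mul hw).intervalIntegrable a b) hpt
  have hval : (∫ t in a..b, (μ^p * ((1 - p) * w t) + (μ^p * (p/μ)) * (g t * w t))) = μ^p * W := by
    have := intervalIntegral.integral_add (μ := MeasureTheory.volume) ((hwi.const_mul (1-p)).const_mul (μ^p)) (hgwi.const_mul (μ^p * (p/μ)))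
    refine this.trans ?_
    simp only [Pi.mul_apply, intervalIntegral.integral_const_mul]
    rw [← hI, ← hW, hμ]
    field_simp
    ring
  have hle : μ^p * W ≤ ∫ t in a..b, g t ^ p * w t := hval ▸ hmono
  calc I0^p = W^(p-1) * (μ^p * W) := by
        rw [hμ, Real.div_rpow h0.le hW0.le, Real.rpow_sub hW0, Real.rpow_one]
        field_simp
    _ ≤ _ := by gcongr

lemma w_int (Q : ℝ) (hQ : 0 ≤ Q) : ∫ t in (-Q)..Q, (1+|t|)⁻¹ = 2 * Real.log (1+Q) := by
  have hc : Continuous fun t : ℝ => (1+|t|)⁻¹ := Continuous.inv₀ (by fun_prop) fun t => by positivity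
  have h1 : ∫ t in (0:ℝ)..Q, (1+|t|)⁻¹ = Real.log (1+Q) := by
    have e : ∫ t in (0:ℝ)..Q, (1+|t|)⁻¹ = ∫ t in (0:ℝ)..Q, (1+t)⁻¹ := by
      refine intervalIntegral.integral_congr fun t ht => ?_
      rw [Set.uIcc_of_le hQ] at ht
      simp only [abs_of_nonneg ht.1]
    rw [e, intervalIntegral.integral_comp_add_left (fun t => t⁻¹), integral_inv_of_pos (by norm_num) (by linarith)]
    norm_num
  have h2 : ∫ t in (-Q)..0, (1+|t|)⁻¹ = Real.log (1+Q) := by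
    have := intervalIntegral.integral_comp_neg (a := 0) (b := Q) (fun t : ℝ => (1+|t|)⁻¹)
    simp only [abs_neg, neg_zero] at this
    rw [← this, h1]
  rw [← intervalIntegral.integral_add_adjacent_intervals (hc.intervalIntegrable _ 0) (hc.intervalIntegrable _ _), h1, h2]
  ring

set_option maxHeartbeats 1000000 in
theorem mom_big (m : ℝ) (hm : 1 ≤ m) : ∃ Cm : ℝ, 0 ≤ Cm ∧ ∃ q0 : ℕ, ∀ (q : ℕ) [NeZero q], q0 ≤ q →
    ∀ y T : ℝ, 2 ≤ y → y ≤ q → 1 ≤ T → T ≤ y/2 →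
    ∀ f : ℝ → ℝ, (∀ x : ℝ, 0 < x → f x = if x ≤ y - T then 1 else if x ≤ y then 1 - (x - y + T) / T else 0) →
    ∀ X : Finset (DirichletCharacter ℂ q), (∀ χ ∈ X, χ ≠ 1 ∧ dirichletRH χ) →
    ∑ χ ∈ X, ‖∑ n ∈ Finset.Icc 1 ⌊y⌋₊, (1 - (f n : ℂ)) * χ n‖^(2*m) ≤ Cm * q.totient * y^m * Real.log q ^ ((m+1)^2) := by
  obtain ⟨Cd, hCd0, q1, hpw⟩ := pointwise
  obtain ⟨Cc, hCc0, q2, hsh⟩ := sharp m (by linarith)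
  obtain ⟨q3, hq3⟩ := Filter.eventually_atTop.1 (ev_log 1)
  refine ⟨Cd^(2*m) * 2^(2*m) * (1 + 6^(2*m) * Cc), by positivity, max (max q1 q2) (max q3 3), ?_⟩
  intro q _ hq y T hy hyq hT1 hT2 f hf X hX
  have hqq1 : q1 ≤ q := le_trans (le_trans (le_max_left _ _) (le_max_left _ _)) hq
  have hqq2 : q2 ≤ q := le_trans (le_trans (le_max_right _ _) (le_max_left _ _)) hq
  have hqq3 : q3 ≤ q := le_trans (le_trans (le_max_left _ _) (le_max_right _ _)) hq
  have hqq : 3 ≤ q := le_trans (le_trans (le_max_right _ _) (le_max_right _ _)) hq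
  have hq3' : (3:ℝ) ≤ q := by exact_mod_cast hqq
  have hl1 := hq3 q hqq3
  have hl0 : 0 < Real.log q := by linarith
  set Q : ℝ := (q:ℝ)^2 with hQ
  have hQ0 : 0 < Q := by positivity
  set w : ℝ → ℝ := fun t => (1+|t|)⁻¹ with hw
  have hwc : Continuous w := Continuous.inv₀ (by fun_prop) fun t => by positivity
  have hw0 : ∀ t, 0 < w t := fun t => by simp only [hw]; positivity
  set g : DirichletCharacter ℂ q → ℝ → ℝ := fun χ t => ‖DirichletCharacter.LFunction χ (((1/2 + 1/Real.log q : ℝ):ℂ) + t * I)‖ with hg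
  have hgc : ∀ χ ∈ X, Continuous (g χ) := fun χ hχ =>
    ((DirichletCharacter.differentiable_LFunction (hX χ hχ).1).continuous.comp (by fun_prop)).norm
  have hg0 : ∀ χ t, 0 ≤ g χ t := fun χ t => norm_nonneg _
  set W := ∫ t in (-Q)..Q, w t with hW
  have hWle : W ≤ 6 * Real.log q := by
    rw [hW, hw, w_int Q hQ0.le]
    have : 1 + Q ≤ (q:ℝ)^3 := by rw [hQ]; nlinarith [sq_nonneg (q:ℝ)]
    have h := Real.log_le_log (by positivity) this
    rw [Real.log_pow] at h
    push_cast at h; linarith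
  have hW0 : 0 < W := intervalIntegral.intervalIntegral_pos_of_pos (hwc.intervalIntegrable _ _) hw0 (by linarith)
  set I0 : DirichletCharacter ℂ q → ℝ := fun χ => ∫ t in (-Q)..Q, g χ t * w t with hI0
  have hI0n : ∀ χ, 0 ≤ I0 χ := fun χ => intervalIntegral.integral_nonneg (by linarith) fun t _ => mul_nonneg (hg0 χ t) (hw0 t).le
  have hgpc : ∀ χ ∈ X, Continuous fun t => g χ t ^ (2*m) := fun χ hχ => (hgc χ hχ).rpow_const fun t => Or.inr (by linarith)
  set B : ℝ := q.totient * (Cc * Real.log q ^ (m^2+1)) with hB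
  have hIsum : ∑ χ ∈ X, I0 χ ^ (2*m) ≤ W^(2*m) * B := by
    calc ∑ χ ∈ X, I0 χ ^ (2*m) ≤ ∑ χ ∈ X, W^(2*m-1) * ∫ t in (-Q)..Q, g χ t ^ (2*m) * w t :=
          Finset.sum_le_sum fun χ hχ => jensen_w (g χ) w (hgc χ hχ) hwc (hg0 χ) hw0 _ _ _ (by linarith) (by linarith)
      _ = W^(2*m-1) * ∫ t in (-Q)..Q, ∑ χ ∈ X, g χ t ^ (2*m) * w t := by
          rw [← Finset.mul_sum, intervalIntegral.integral_finsetSum]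
          intro χ hχ
          exact ((hgpc χ hχ).mul hwc).intervalIntegrable _ _
      _ ≤ W^(2*m-1) * ∫ t in (-Q)..Q, B * w t := by
          refine mul_le_mul_of_nonneg_left ?_ (by positivity)
          refine intervalIntegral.integral_mono_on (by linarith) ?_ ((hwc.const_smul B).intervalIntegrable _ _) ?_
          · exact (continuous_finsetSum _ fun χ hχ => (hgpc χ hχ).mul hwc).intervalIntegrable _ _
          · intro t ht
            rw [← Finset.sum_mul]
            refine mul_le_mul_of_nonneg_right ?_ (hw0 t).le
            have := hsh q hqq2 t (abs_le.2 ⟨ht.1, ht.2⟩) X hX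
            refine le_trans (le_of_eq ?_) this
            refine Finset.sum_congr rfl fun χ _ => ?_
            simp only [hg]
            congr 3
            push_cast; ring
      _ = W^(2*m) * B := by
          rw [intervalIntegral.integral_const_mul, ← hW]
          have : W^(2*m) = W^(2*m-1) * W := by
            rw [← Real.rpow_add_one hW0.ne']; ring_nf
          rw [this]; ring
  have hy0 : 0 < y := by linarith
  have hlp : ∀ e : ℝ, 0 ≤ e → 1 ≤ Real.log q ^ e := fun e he => Real.one_le_rpow hl1 he
  have hSb : ∀ χ ∈ X, ‖∑ n ∈ Finset.Icc 1 ⌊y⌋₊, (1 - (f n : ℂ)) * χ n‖^(2*m) ≤ Cd^(2*m) * y^m * (2^(2*m) * (1 + I0 χ ^ (2*m))) := by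
    intro χ hχ
    have h := hpw q hqq1 y T hy hyq hT1 hT2 f hf χ (hX χ hχ).1 (hX χ hχ).2
    have h' : ‖∑ n ∈ Finset.Icc 1 ⌊y⌋₊, (1 - (f n : ℂ)) * χ n‖ ≤ Cd * y^((1:ℝ)/2) * (1 + I0 χ) := h
    have hmx : (1 + I0 χ)^(2*m) ≤ 2^(2*m) * (1 + I0 χ ^ (2*m)) := by
      have hn := hI0n χ
      have e1 : 1 + I0 χ ≤ 2 * max 1 (I0 χ) := by
        have := le_max_left 1 (I0 χ); have := le_max_right 1 (I0 χ); linarith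
      have e2 : (max 1 (I0 χ))^(2*m) ≤ 1 + I0 χ ^ (2*m) := by
        rcases le_total 1 (I0 χ) with h | h
        · rw [max_eq_right h]; linarith
        · rw [max_eq_left h, Real.one_rpow]; have := Real.rpow_nonneg hn (2*m); linarith
      calc (1 + I0 χ)^(2*m) ≤ (2 * max 1 (I0 χ))^(2*m) := Real.rpow_le_rpow (by linarith) e1 (by linarith)
        _ = 2^(2*m) * (max 1 (I0 χ))^(2*m) := Real.mul_rpow (by norm_num) (by positivity)
        _ ≤ _ := by gcongr
    have hn := hI0n χ
    calc _ ≤ (Cd * y^((1:ℝ)/2) * (1 + I0 χ))^(2*m) := Real.rpow_le_rpow (norm_nonneg _) h' (by linarith)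
      _ = Cd^(2*m) * y^m * (1 + I0 χ)^(2*m) := by
          rw [Real.mul_rpow (by positivity) (by linarith), Real.mul_rpow hCd0 (by positivity), ← Real.rpow_mul hy0.le]
          congr 3; ring
      _ ≤ _ := by gcongr
  have hcard := card_le_phi X
  have hφ0 : (0:ℝ) ≤ q.totient := by positivity
  have hWB : W^(2*m) * B ≤ 6^(2*m) * Cc * q.totient * Real.log q ^ ((m+1)^2) := by
    have e1 : W^(2*m) ≤ 6^(2*m) * Real.log q ^ (2*m) := by
      rw [← Real.mul_rpow (by norm_num) hl0.le]
      exact Real.rpow_le_rpow hW0.le hWle (by linarith)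
    have e2 : Real.log q ^ ((m+1)^2) = Real.log q ^ (2*m) * Real.log q ^ (m^2+1) := by
      rw [← Real.rpow_add hl0]; ring_nf
    rw [hB, e2]
    calc _ ≤ (6^(2*m) * Real.log q ^ (2*m)) * (q.totient * (Cc * Real.log q ^ (m^2+1))) := by gcongr
      _ = _ := by ring
  calc _ ≤ ∑ χ ∈ X, Cd^(2*m) * y^m * (2^(2*m) * (1 + I0 χ ^ (2*m))) := Finset.sum_le_sum hSb
    _ = Cd^(2*m) * y^m * (2^(2*m) * (X.card + ∑ χ ∈ X, I0 χ ^ (2*m))) := by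
        rw [← Finset.mul_sum, ← Finset.mul_sum, Finset.sum_add_distrib]; simp
    _ ≤ Cd^(2*m) * y^m * (2^(2*m) * (q.totient * Real.log q ^ ((m+1)^2) + 6^(2*m) * Cc * q.totient * Real.log q ^ ((m+1)^2))) := by
        gcongr
        · exact hcard.trans (le_mul_of_one_le_right hφ0 (hlp _ (by positivity)))
        · exact hIsum.trans hWB
    _ = _ := by ring


lemma f_bound (y T : ℝ) (hT : 0 < T) (f : ℝ → ℝ)
    (hf : ∀ x : ℝ, 0 < x → f x = if x ≤ y - T then 1 else if x ≤ y then 1 - (x - y + T) / T else 0)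
    (x : ℝ) (hx : 0 < x) (hxy : x ≤ y) : |1 - f x| ≤ 1 ∧ (x ≤ y - T → 1 - f x = 0) := by
  rw [hf x hx]
  split_ifs with h
  · simp
  · refine ⟨?_, fun h' => absurd h' h⟩
    push Not at h
    rw [show 1 - (1 - (x - y + T) / T) = (x - y + T)/T by ring, abs_le]
    constructor
    · have : 0 ≤ (x - y + T)/T := div_nonneg (by linarith) hT.le
      linarith
    · rw [div_le_one hT]; linarith

lemma norm_coef (z : ℝ) : ‖(1:ℂ) - (z:ℂ)‖ = |1 - z| := by
  rw [← Complex.ofReal_one, ← Complex.ofReal_sub, Complex.norm_real, Real.norm_eq_abs]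

lemma powmean {ι : Type*} (X : Finset ι) (a : ι → ℝ) (ha : ∀ i ∈ X, 0 ≤ a i) (φ z p : ℝ) (hp : 1 ≤ p) (hφ : 0 < φ) (hz : 0 ≤ z)
    (hc : (X.card:ℝ) ≤ φ) (h : ∑ i ∈ X, a i ^ p ≤ φ * z) : ∑ i ∈ X, a i ≤ φ * z^(1/p) := by
  have hp0 : 0 < p := by linarith
  have h1 := Real.rpow_sum_le_const_mul_sum_rpow X a hp
  have e1 : ∑ i ∈ X, |a i| = ∑ i ∈ X, a i := Finset.sum_congr rfl fun i hi => abs_of_nonneg (ha i hi)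
  have e2 : ∑ i ∈ X, |a i| ^ p = ∑ i ∈ X, a i ^ p := Finset.sum_congr rfl fun i hi => by rw [abs_of_nonneg (ha i hi)]
  rw [e1, e2] at h1
  have h2 : (∑ i ∈ X, a i)^p ≤ (φ * z^(1/p))^p := by
    refine h1.trans ?_
    rw [Real.mul_rpow hφ.le (by positivity), ← Real.rpow_mul hz, one_div_mul_cancel hp0.ne', Real.rpow_one]
    calc _ ≤ φ^(p-1) * (φ * z) := by
          refine mul_le_mul (Real.rpow_le_rpow (by positivity) hc (by linarith)) h
            (Finset.sum_nonneg fun i hi => Real.rpow_nonneg (ha i hi) _) (by positivity)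
      _ = _ := by rw [← mul_assoc, ← Real.rpow_add_one hφ.ne']; ring_nf
  exact (Real.rpow_le_rpow_iff (Finset.sum_nonneg ha) (by positivity) hp0).1 h2

set_option maxHeartbeats 1000000 in
theorem mom_all (m : ℝ) (hm : 1 ≤ m) : ∃ Cm : ℝ, 0 ≤ Cm ∧ ∃ q0 : ℕ, ∀ (q : ℕ) [NeZero q], q0 ≤ q →
    ∀ y T : ℝ, 3 ≤ y → y ≤ q → 1 ≤ T → T ≤ y/2 →
    ∀ f : ℝ → ℝ, (∀ x : ℝ, 0 < x → f x = if x ≤ y - T then 1 else if x ≤ y then 1 - (x - y + T) / T else 0) →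
    ∀ X : Finset (DirichletCharacter ℂ q), (∀ χ ∈ X, χ ≠ 1 ∧ dirichletRH χ) →
    ∑ χ ∈ X, ‖∑ n ∈ Finset.Icc 1 ⌊y⌋₊, (1 - (f n : ℂ)) * χ n‖^(2*m) ≤ Cm * q.totient * y^m * Real.log y ^ ((m+1)^2) := by
  obtain ⟨Cb, hCb0, q0, hbig⟩ := mom_big m hm
  set M := ⌈m⌉₊ with hM
  have hmM : m ≤ M := Nat.le_ceil m
  have hMm : (M:ℝ) ≤ m + 1 := (Nat.ceil_lt_add_one (by linarith)).le
  have hM1 : (1:ℝ) ≤ M := by linarith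
  refine ⟨Cb * (M:ℝ)^((m+1)^2) + 2^(M*m), by positivity, q0, ?_⟩
  intro q _ hq y T hy hyq hT1 hT2 f hf X hX
  have hy0 : 0 < y := by linarith
  have hly : 1 ≤ Real.log y := by
    rw [Real.le_log_iff_exp_le hy0]
    linarith [Real.exp_one_lt_d9]
  have hq0 : 0 < q := Nat.pos_of_ne_zero (NeZero.ne q)
  have hφ : (0:ℝ) < q.totient := by exact_mod_cast Nat.totient_pos.2 hq0
  set N := ⌊y⌋₊ with hN
  have hNy : (N:ℝ) ≤ y := Nat.floor_le hy0.le
  have hN1 : 1 ≤ N := Nat.le_floor (by push_cast; linarith)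
  have hN1' : (1:ℝ) ≤ N := by exact_mod_cast hN1
  set E := Real.log y ^ ((m+1)^2) with hE
  have hE0 : 0 < E := by positivity
  have hym : 0 < y^m := by positivity
  by_cases hc : N^M ≤ q
  · have hsm := short_moment X M N hc (fun n => 1 - (f n : ℂ)) (by
      intro n hn
      have hn' := Finset.mem_Icc.1 hn
      have h1 : (0:ℝ) < n := by exact_mod_cast hn'.1
      have h2 : (n:ℝ) ≤ N := by exact_mod_cast hn'.2
      rw [norm_coef]
      exact (f_bound y T (by linarith) f hf n h1 (by linarith)).1)
    set H : ℝ := ∑ a ∈ Icc 1 N, (1/a:ℝ) with hH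
    have hH0 : 0 ≤ H := Finset.sum_nonneg fun a _ => by positivity
    have hHle : H ≤ 2 * Real.log y := by
      have h1 := harmonic_le_one_add_log N
      rw [harmonic_eq_sum_Icc] at h1
      push_cast at h1
      have h2 : H ≤ 1 + Real.log N := by
        refine le_trans (le_of_eq ?_) h1
        exact Finset.sum_congr rfl fun a _ => one_div _
      have := Real.log_le_log (by linarith) hNy
      linarith
    have hz0 : 0 ≤ (N:ℝ)^M * H^(M*M) := by positivity
    have hpm := powmean X (fun χ => ‖∑ n ∈ Finset.Icc 1 N, (1 - (f n : ℂ)) * χ n‖^(2*m)) (fun χ _ => by positivity)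
      q.totient ((N:ℝ)^M * H^(M*M)) (M/m) (by rw [le_div_iff₀ (by linarith)]; linarith) hφ hz0 (card_le_phi X) (by
        refine le_trans (le_of_eq ?_) hsm
        refine Finset.sum_congr rfl fun χ _ => ?_
        rw [← Real.rpow_mul (norm_nonneg _), ← Real.rpow_natCast]
        congr 1
        push_cast
        field_simp)
    have hzz : ((N:ℝ)^M * H^(M*M))^(1/((M:ℝ)/m)) = (N:ℝ)^m * H^(M*m) := by
      rw [Real.mul_rpow (by positivity) (by positivity), ← Real.rpow_natCast, ← Real.rpow_natCast,
        ← Real.rpow_mul (by positivity), ← Real.rpow_mul hH0]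
      congr 2 <;> (push_cast; field_simp)
    rw [hzz] at hpm
    refine hpm.trans ?_
    have a1 : (N:ℝ)^m ≤ y^m := Real.rpow_le_rpow (by linarith) hNy (by linarith)
    have a2 : H^(M*m) ≤ 2^(M*m) * E := by
      calc H^(M*m) ≤ (2 * Real.log y)^(M*m) := Real.rpow_le_rpow hH0 hHle (by positivity)
        _ = 2^(M*m) * Real.log y^(M*m) := Real.mul_rpow (by norm_num) (by linarith)
        _ ≤ _ := by
          gcongr
          rw [hE]
          exact Real.rpow_le_rpow_of_exponent_le hly (by nlinarith)
    calc (q.totient:ℝ) * ((N:ℝ)^m * H^(M*m)) ≤ q.totient * (y^m * (2^(M*m) * E)) := by gcongr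
      _ = 2^(M*m) * q.totient * y^m * E := by ring
      _ ≤ _ := by
          gcongr
          exact le_add_of_nonneg_left (by positivity)
  · push Not at hc
    have hb := hbig q hq y T (by linarith) hyq hT1 hT2 f hf X hX
    refine hb.trans ?_
    have hlq : Real.log q ≤ M * Real.log y := by
      have h1 : (q:ℝ) ≤ y^M := by
        have : (q:ℝ) ≤ (N:ℝ)^M := by exact_mod_cast hc.le
        exact this.trans (by gcongr)
      have := Real.log_le_log (by exact_mod_cast hq0) h1
      rwa [Real.log_pow] at this
    have hlq0 : 0 ≤ Real.log q := Real.log_natCast_nonneg q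
    have hE2 : Real.log q ^ ((m+1)^2) ≤ (M:ℝ)^((m+1)^2) * E := by
      rw [hE, ← Real.mul_rpow (by linarith) (by linarith)]
      exact Real.rpow_le_rpow hlq0 hlq (by positivity)
    calc _ ≤ Cb * q.totient * y^m * ((M:ℝ)^((m+1)^2) * E) := by gcongr
      _ = (Cb * (M:ℝ)^((m+1)^2)) * q.totient * y^m * E := by ring
      _ ≤ _ := by
          gcongr
          exact le_add_of_nonneg_right (by positivity)

lemma second_mom {q : ℕ} [NeZero q] (X : Finset (DirichletCharacter ℂ q)) (y T : ℝ) (hy : 2 ≤ y) (hyq : y ≤ q) (hT1 : 1 ≤ T) (hT2 : T ≤ y/2)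
    (f : ℝ → ℝ) (hf : ∀ x : ℝ, 0 < x → f x = if x ≤ y - T then 1 else if x ≤ y then 1 - (x - y + T) / T else 0) :
    ∑ χ ∈ X, ‖∑ n ∈ Finset.Icc 1 ⌊y⌋₊, (1 - (f n : ℂ)) * χ n‖^2 ≤ q.totient * (2 * T) := by
  set N := ⌊y⌋₊ with hN
  have hNy : (N:ℝ) ≤ y := Nat.floor_le (by linarith)
  have hNq : N ≤ q := by exact_mod_cast hNy.trans hyq
  have h := A1 X (Finset.Icc 1 N) (fun n => n) (fun n => 1 - (f n : ℂ))
    (fun n hn => ⟨(Finset.mem_Icc.1 hn).1, (Finset.mem_Icc.1 hn).2.trans hNq⟩) (fun a _ b _ h => h)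
  refine h.trans (mul_le_mul_of_nonneg_left ?_ (by positivity))
  set K := ⌊y - T⌋₊ with hK
  have hKN : K ≤ N := Nat.floor_le_floor (by linarith)
  have hb : ∀ n ∈ Icc 1 N, ‖(1:ℂ) - (f n : ℂ)‖^2 ≤ if n ∈ Ioc K N then (1:ℝ) else 0 := by
    intro n hn
    have hn' := Finset.mem_Icc.1 hn
    have h1 : (0:ℝ) < n := by exact_mod_cast hn'.1
    have h2 : (n:ℝ) ≤ N := by exact_mod_cast hn'.2
    have hfb := f_bound y T (by linarith) f hf n h1 (by linarith)
    rw [norm_coef]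
    split_ifs with hm
    · exact pow_le_one₀ (abs_nonneg _) hfb.1
    · have : n ≤ K := by
        by_contra h
        exact hm (Finset.mem_Ioc.2 ⟨not_le.1 h, hn'.2⟩)
      rw [hfb.2 ((Nat.le_floor_iff (by linarith)).1 this)]; simp
  refine (Finset.sum_le_sum hb).trans ?_
  rw [← Finset.sum_filter]
  have hsub : (Icc 1 N).filter (fun n => n ∈ Ioc K N) ⊆ Ioc K N := fun n hn => (Finset.mem_filter.1 hn).2
  rw [Finset.sum_const, nsmul_eq_mul, mul_one]
  have hcard := Finset.card_le_card hsub
  rw [Nat.card_Ioc] at hcard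
  have h3 : (((Icc 1 N).filter (fun n => n ∈ Ioc K N)).card : ℝ) ≤ ((N - K : ℕ):ℝ) := by exact_mod_cast hcard
  rw [Nat.cast_sub hKN] at h3
  have := Nat.lt_floor_add_one (y - T)
  linarith

lemma T_range (C : ℝ) (hC : 0 < C) : ∃ Y1 : ℝ, 3 ≤ Y1 ∧ ∀ y : ℝ, Y1 ≤ y → 1 ≤ y / Real.log y ^ C ∧ y / Real.log y ^ C ≤ y/2 := by
  have h1 : ∀ᶠ y : ℝ in Filter.atTop, (2:ℝ) ≤ Real.log y ^ C :=
    ((tendsto_rpow_atTop hC).comp Real.tendsto_log_atTop).eventually_ge_atTop 2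
  have h2 := (isLittleO_log_rpow_rpow_atTop C one_pos).bound one_pos
  obtain ⟨Y, hY⟩ := Filter.eventually_atTop.1 (h1.and h2)
  refine ⟨max Y 3, le_max_right _ _, fun y hy => ?_⟩
  obtain ⟨a, b⟩ := hY y (le_trans (le_max_left _ _) hy)
  have hy3 : 3 ≤ y := le_trans (le_max_right _ _) hy
  rw [Real.rpow_one, one_mul, Real.norm_of_nonneg (by linarith), Real.norm_of_nonneg (by linarith)] at b
  have hpos : 0 < Real.log y ^ C := by linarith
  exact ⟨by rw [le_div_iff₀ hpos]; linarith, by gcongr⟩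

open Classical in
theorem stmt16 (k : ℝ) (hk : 2 < k) (C : ℝ) (hC : 0 < C) :
    ∃ C' : ℝ, 0 < C' ∧ ∃ q0 : ℕ, ∀ (q : ℕ) [NeZero q], q0 ≤ q →
      (∀ χ : DirichletCharacter ℂ q, dirichletRH χ) →
      ∀ y : ℝ, 2 ≤ y → y ≤ (q : ℝ) → ∀ T : ℝ, T = y / Real.log y ^ C →
      ∀ f : ℝ → ℝ, (∀ x : ℝ, 0 < x → f x = if x ≤ y - T then 1 else if x ≤ y then 1 - (x - y + T) / T else 0) →
      ∑ χ ∈ Finset.univ.filter (fun χ : DirichletCharacter ℂ q => χ.IsPrimitive),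
        ‖∑ n ∈ Finset.Icc 1 ⌊y⌋₊, (1 - (f n : ℂ)) * χ n‖ ^ (2 * k)
      ≤ C' * (Nat.totient q) * y ^ k * Real.log y ^ (2 * k ^ 2 - C / 2) := by
  obtain ⟨Cm, hCm0, q1, hmom⟩ := mom_all (2*k-1) (by linarith)
  obtain ⟨Y1, hY3, hY1⟩ := T_range C hC
  set e : ℝ := 2 * k^2 - C/2 with he
  set c0 : ℝ := min (Real.log 2 ^ e) (Real.log Y1 ^ e) with hc0
  have hl2 : 0 < Real.log 2 := Real.log_pos (by norm_num)
  have hlY : 0 < Real.log Y1 := Real.log_pos (by linarith)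
  have hc0p : 0 < c0 := lt_min (by positivity) (by positivity)
  refine ⟨Y1^(2*k) / c0 + Real.sqrt (2 * Cm), by positivity, max q1 3, ?_⟩
  intro q _ hq hRH y hy hyq T hT f hf
  have hq1 : q1 ≤ q := le_trans (le_max_left _ _) hq
  have hq3 : 3 ≤ q := le_trans (le_max_right _ _) hq
  have hφ : (0:ℝ) < q.totient := by exact_mod_cast Nat.totient_pos.2 (by omega)
  set X := Finset.univ.filter (fun χ : DirichletCharacter ℂ q => χ.IsPrimitive) with hX
  have hXp : ∀ χ ∈ X, χ ≠ 1 ∧ dirichletRH χ := by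
    intro χ hχ
    refine ⟨fun h => ?_, hRH χ⟩
    have hp : χ.IsPrimitive := (Finset.mem_filter.1 hχ).2
    rw [h, DirichletCharacter.IsPrimitive, DirichletCharacter.conductor_one] at hp
    omega
  have hly : 0 < Real.log y := Real.log_pos (by linarith)
  have hT0 : 0 < T := by rw [hT]; positivity
  set S : DirichletCharacter ℂ q → ℝ := fun χ => ‖∑ n ∈ Finset.Icc 1 ⌊y⌋₊, (1 - (f n : ℂ)) * χ n‖ with hS
  have hS0 : ∀ χ, 0 ≤ S χ := fun χ => norm_nonneg _
  have hy0 : 0 < y := by linarith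
  change ∑ χ ∈ X, S χ ^ (2*k) ≤ _
  rcases le_total y Y1 with hyY | hyY
  · have hSb : ∀ χ, S χ ≤ Y1 := by
      intro χ
      have : S χ ≤ ∑ n ∈ Finset.Icc 1 ⌊y⌋₊, (1:ℝ) := by
        refine norm_sum_le_of_le _ fun n hn => ?_
        have hn' := Finset.mem_Icc.1 hn
        have h1 : (0:ℝ) < n := by exact_mod_cast hn'.1
        have h2 : (n:ℝ) ≤ y := (Nat.le_floor_iff hy0.le).1 hn'.2
        rw [norm_mul, norm_coef]
        exact mul_le_one₀ (f_bound y T hT0 f hf n h1 h2).1 (norm_nonneg _) (DirichletCharacter.norm_le_one χ _)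
      refine this.trans ?_
      simp only [Finset.sum_const, Nat.card_Icc, nsmul_eq_mul, mul_one, Nat.add_sub_cancel]
      exact (Nat.floor_le hy0.le).trans hyY
    have hc0y : c0 ≤ Real.log y ^ e := by
      rcases le_total 0 e with h | h
      · exact (min_le_left _ _).trans (Real.rpow_le_rpow hl2.le (Real.log_le_log (by norm_num) hy) h)
      · exact (min_le_right _ _).trans (Real.rpow_le_rpow_of_nonpos hly (Real.log_le_log hy0 hyY) h)
    have hyk : 1 ≤ y^k := Real.one_le_rpow (by linarith) (by linarith)
    calc ∑ χ ∈ X, S χ ^ (2*k) ≤ ∑ χ ∈ X, Y1^(2*k) :=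
          Finset.sum_le_sum fun χ _ => Real.rpow_le_rpow (hS0 χ) (hSb χ) (by linarith)
      _ = X.card * Y1^(2*k) := by rw [Finset.sum_const, nsmul_eq_mul]
      _ ≤ q.totient * Y1^(2*k) := mul_le_mul_of_nonneg_right (card_le_phi X) (by positivity)
      _ = (Y1^(2*k)/c0) * q.totient * 1 * c0 := by field_simp
      _ ≤ (Y1^(2*k) / c0 + Real.sqrt (2 * Cm)) * q.totient * y^k * Real.log y ^ e := by
          gcongr
          exact le_add_of_nonneg_right (Real.sqrt_nonneg _)
  · obtain ⟨hT1, hT2⟩ := hY1 y hyY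
    rw [← hT] at hT1 hT2
    have h1 := second_mom X y T hy hyq hT1 hT2 f hf
    have h2 := hmom q hq1 y T (by linarith) hyq hT1 hT2 f hf X hXp
    have hsplit : ∀ χ, S χ ^ (2*k) = S χ * S χ ^ (2*k-1) := by
      intro χ
      rcases (hS0 χ).eq_or_lt with h | h
      · rw [← h, Real.zero_rpow (by linarith), zero_mul]
      · rw [mul_comm (S χ), ← Real.rpow_add_one h.ne']; ring_nf
    have hcs := Finset.sum_mul_sq_le_sq_mul_sq X S (fun χ => S χ ^ (2*k-1))
    have hsq : ∀ χ, (S χ ^ (2*k-1))^2 = S χ ^ (2*(2*k-1)) := by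
      intro χ
      rw [← Real.rpow_natCast, ← Real.rpow_mul (hS0 χ)]
      congr 1; push_cast; ring
    simp_rw [hsq, ← hsplit] at hcs
    set R := q.totient * y^k * Real.log y ^ e with hR
    have hR0 : 0 ≤ R := by positivity
    have hfin : (∑ χ ∈ X, S χ ^ (2*k))^2 ≤ (Real.sqrt (2*Cm) * R)^2 := by
      refine hcs.trans ((mul_le_mul h1 h2 (Finset.sum_nonneg fun χ _ => Real.rpow_nonneg (hS0 χ) _) (by positivity)).trans (le_of_eq ?_))
      rw [mul_pow, Real.sq_sqrt (by positivity), hR, mul_pow, mul_pow]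
      have e1 : (y^k)^2 = y * y^(2*k-1) := by
        rw [← Real.rpow_natCast, ← Real.rpow_mul hy0.le, mul_comm y, ← Real.rpow_add_one hy0.ne']
        congr 1; push_cast; ring
      have e2 : (Real.log y ^ e)^2 = Real.log y ^ ((2*k-1+1)^2) / Real.log y ^ C := by
        rw [← Real.rpow_natCast, ← Real.rpow_mul hly.le, ← Real.rpow_sub hly]
        congr 1; rw [he]; push_cast; ring
      rw [e1, e2, hT]
      ring
    have hle := abs_le_of_sq_le_sq hfin (by positivity)
    calc _ ≤ |∑ χ ∈ X, S χ ^ (2*k)| := le_abs_self _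
      _ ≤ Real.sqrt (2*Cm) * R := hle
      _ ≤ (Y1^(2*k) / c0 + Real.sqrt (2*Cm)) * R := by
          gcongr
          exact le_add_of_nonneg_left (by positivity)
      _ = _ := by rw [hR]; ring
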